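/- arXiv:2507.15153 — 5 statements merged into one kernel-verified Lean document; each statement's English description precedes it below -/
import Mathlib

section
/- For any real number L with 0 ≤ L ≤ 1 and any ε > 0, there exists a finite group G such that |θ_II(G) − L| < ε. -/
open scoped Classical

noncomputable section

/-- `z` is a (complex) root of unity. -/
def IsRootOfUnity (z : ℂ) : Prop := ∃ n : ℕ, 0 < n ∧ z ^ n = 1

/-- `χ` is an irreducible complex character of the group `G`, i.e. the character of some
simple (irreducible) finite-dimensional complex representation of `G`. -/
def IsIrredChar {G : Type} [Group G] (χ : G → ℂ) : Prop :=
  ∃ V : FDRep ℂ G, CategoryTheory.Simple V ∧ χ = V.character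

/-- `z_I(G)`: the proportion of pairs `(χ, g) ∈ Irr(G) × G` with `χ g = 0`. -/
def zIG (G : Type) [Group G] : ℝ :=
  (Nat.card {p : (G → ℂ) × G | IsIrredChar p.1 ∧ p.1 p.2 = 0} : ℝ) /
    ((Nat.card {χ : G → ℂ | IsIrredChar χ} : ℝ) * (Nat.card G : ℝ))

/-- `u_I(G)`: the proportion of pairs `(χ, g) ∈ Irr(G) × G` with `χ g` a root of unity. -/
def uIG (G : Type) [Group G] : ℝ :=
  (Nat.card {p : (G → ℂ) × G | IsIrredChar p.1 ∧ IsRootOfUnity (p.1 p.2)} : ℝ) /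
    ((Nat.card {χ : G → ℂ | IsIrredChar χ} : ℝ) * (Nat.card G : ℝ))

/-- `θ(G)`: the proportion of pairs `(χ, g) ∈ Irr(G) × G` with `χ g` zero or a root of
unity. -/
def thetaG (G : Type) [Group G] : ℝ :=
  (Nat.card {p : (G → ℂ) × G |
      IsIrredChar p.1 ∧ (p.1 p.2 = 0 ∨ IsRootOfUnity (p.1 p.2))} : ℝ) /
    ((Nat.card {χ : G → ℂ | IsIrredChar χ} : ℝ) * (Nat.card G : ℝ))

/-- `z_II(G)`: the proportion of pairs `(χ, C) ∈ Irr(G) × Cl(G)` such that `χ` vanishes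
on the conjugacy class `C`. -/
def zIIG (G : Type) [Group G] : ℝ :=
  (Nat.card {p : (G → ℂ) × ConjClasses G |
      IsIrredChar p.1 ∧ ∀ g ∈ p.2.carrier, p.1 g = 0} : ℝ) /
    ((Nat.card {χ : G → ℂ | IsIrredChar χ} : ℝ) * (Nat.card (ConjClasses G) : ℝ))

/-- `u_II(G)`: the proportion of pairs `(χ, gᴳ) ∈ Irr(G) × Cl(G)` with `χ g` a root of
unity. -/
def uIIG (G : Type) [Group G] : ℝ :=
  (Nat.card {p : (G → ℂ) × ConjClasses G |
      IsIrredChar p.1 ∧ ∃ g, ConjClasses.mk g = p.2 ∧ IsRootOfUnity (p.1 g)} : ℝ) /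
    ((Nat.card {χ : G → ℂ | IsIrredChar χ} : ℝ) * (Nat.card (ConjClasses G) : ℝ))

/-- `θ_II(G)`: the proportion of pairs `(χ, gᴳ) ∈ Irr(G) × Cl(G)` with `χ g` zero or a
root of unity. -/
def thetaIIG (G : Type) [Group G] : ℝ :=
  (Nat.card {p : (G → ℂ) × ConjClasses G |
      IsIrredChar p.1 ∧ ∃ g, ConjClasses.mk g = p.2 ∧
        (p.1 g = 0 ∨ IsRootOfUnity (p.1 g))} : ℝ) /
    ((Nat.card {χ : G → ℂ | IsIrredChar χ} : ℝ) * (Nat.card (ConjClasses G) : ℝ))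


lemma IsIrredChar.conj_apply {G : Type} [Group G] {χ : G → ℂ} (hχ : IsIrredChar χ) {g h : G}
    (hgh : IsConj g h) : χ g = χ h := by
  obtain ⟨V, -, rfl⟩ := hχ
  obtain ⟨c, rfl⟩ := isConj_iff.1 hgh
  exact (V.char_conj g c).symm

lemma isIrredChar_of_norm {G : Type} [Group G] [Fintype G] {V : Type} [AddCommGroup V]
    [Module ℂ V] [Module.Finite ℂ V] (ρ : Representation ℂ G V) (χ : G → ℂ)
    (hχ : ∀ g, LinearMap.trace ℂ V (ρ g) = χ g)
    (hnorm : ∑ g : G, χ g * χ g⁻¹ = Nat.card G) : IsIrredChar χ := by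
  have hχ' : (FDRep.of ρ).character = χ := funext hχ
  refine ⟨FDRep.of ρ, ?_, hχ'.symm⟩
  rw [FDRep.simple_iff_char_is_norm_one, hχ', hnorm]

lemma IsIrredChar.sum_mul_inv {G : Type} [Group G] [Fintype G] {χ η : G → ℂ}
    (hχ : IsIrredChar χ) (hη : IsIrredChar η) :
    ∑ g : G, χ g * η g⁻¹ = if χ = η then (Nat.card G : ℂ) else 0 := by
  obtain ⟨V, hV, rfl⟩ := hχ
  obtain ⟨W, hW, rfl⟩ := hη
  have := invertibleOfNonzero (NeZero.ne (Nat.card G : ℂ))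
  split_ifs with h
  · rw [← h]
    exact (FDRep.simple_iff_char_is_norm_one V).1 hV
  · have horth := FDRep.char_orthonormal V W
    rw [if_neg (fun ⟨i⟩ => h (FDRep.char_iso i))] at horth
    exact (mul_eq_zero.1 horth).resolve_left (inv_ne_zero (NeZero.ne (Nat.card G : ℂ)))

lemma card_le_card_conjClasses {G : Type} [Group G] [Fintype G] {ι : Type} [Fintype ι]
    {f : ι → G → ℂ} (hf : Function.Injective f) (hirr : ∀ i, IsIrredChar (f i)) :
    Fintype.card ι ≤ Nat.card (ConjClasses G) := by
  let F : ι → ConjClasses G → ℂ := fun i =>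
    Quotient.lift (f i) fun _ _ h => (hirr i).conj_apply h
  have hF : LinearIndependent ℂ F := by
    rw [Fintype.linearIndependent_iff]
    intro c hc j
    have hpt : ∀ g, ∑ i, c i * f i g = 0 := fun g => by
      have h := congrFun hc (ConjClasses.mk g)
      rw [Finset.sum_apply] at h
      exact h
    have hzero : ∑ g, (∑ i, c i * f i g) * f j g⁻¹ = 0 := by simp [hpt]
    simp_rw [Finset.sum_mul, mul_assoc] at hzero
    rw [Finset.sum_comm] at hzero
    simp_rw [← Finset.mul_sum, (hirr _).sum_mul_inv (hirr j), hf.eq_iff] at hzero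
    simpa using hzero
  have hcard := hF.fintype_card_le_finrank
  rwa [Module.finrank_fintype_fun_eq_card,
    ← Nat.card_eq_fintype_card (α := ConjClasses G)] at hcard

/-- If as many irreducible characters and representatives of conjugacy classes are listed, and
the values that are neither zero nor a root of unity form a rectangular block, then `thetaIIG`
is determined by the size of the block. -/
lemma thetaIIG_eq_of_block {G : Type} [Group G] [Fintype G] {I₁ I₂ J₁ J₂ : Type}
    [Fintype I₁] [Fintype I₂] [Fintype J₁] [Fintype J₂]
    (f : I₁ ⊕ I₂ → G → ℂ) (r : J₁ ⊕ J₂ → G) (hf : Function.Injective f)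
    (hirr : ∀ i, IsIrredChar (f i)) (hr : Function.Surjective fun j => ConjClasses.mk (r j))
    (hcard : Fintype.card (I₁ ⊕ I₂) = Fintype.card (J₁ ⊕ J₂))
    (hgood : ∀ i j, (f i (r j) = 0 ∨ IsRootOfUnity (f i (r j))) ↔ (i.isRight → j.isLeft)) :
    thetaIIG G = 1 - (Fintype.card I₂ * Fintype.card J₂ : ℝ) /
      (Fintype.card I₁ + Fintype.card I₂ : ℝ) ^ 2 := by
  have hle := card_le_card_conjClasses hf hirr
  have hge : Nat.card (ConjClasses G) ≤ Fintype.card (J₁ ⊕ J₂) := by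
    rw [← Nat.card_eq_fintype_card]
    exact Nat.card_le_card_of_surjective _ hr
  have hJ : Nat.card (ConjClasses G) = Fintype.card (J₁ ⊕ J₂) := le_antisymm hge (hcard ▸ hle)
  have hrbij : Function.Bijective fun j => ConjClasses.mk (r j) := by
    rw [Fintype.bijective_iff_surjective_and_card]
    exact ⟨hr, by rw [← hJ, Nat.card_eq_fintype_card]⟩
  have hsurj : ∀ χ, IsIrredChar χ → ∃ i, f i = χ := by
    intro χ hχ
    by_contra! hne
    have hinj : Function.Injective fun o : Option (I₁ ⊕ I₂) => o.elim χ f := by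
      rintro (_ | i) (_ | j) hij
      · rfl
      · exact (hne j hij.symm).elim
      · exact (hne i hij).elim
      · exact congrArg some (hf hij)
    have := card_le_card_conjClasses hinj (by rintro (_ | i); exacts [hχ, hirr i])
    rw [Fintype.card_option] at this
    omega
  have hIrr : Nat.card {χ : G → ℂ | IsIrredChar χ} = Fintype.card (I₁ ⊕ I₂) := by
    rw [← Nat.card_eq_fintype_card]
    refine (Nat.card_congr (Equiv.ofBijective (fun i => ⟨f i, hirr i⟩) ⟨?_, ?_⟩)).symm
    · exact fun i j hij => hf (congrArg Subtype.val hij)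
    · exact fun ⟨χ, hχ⟩ => (hsurj χ hχ).imp fun i hi => Subtype.ext hi
  have hpairs : Nat.card {p : (G → ℂ) × ConjClasses G |
      IsIrredChar p.1 ∧ ∃ g, ConjClasses.mk g = p.2 ∧ (p.1 g = 0 ∨ IsRootOfUnity (p.1 g))} =
      Nat.card {q : (I₁ ⊕ I₂) × (J₁ ⊕ J₂) // q.1.isRight → q.2.isLeft} := by
    refine (Nat.card_congr (Equiv.ofBijective (fun q => ⟨(f q.1.1, ConjClasses.mk (r q.1.2)),
      hirr _, r q.1.2, rfl, (hgood _ _).2 q.2⟩) ⟨?_, ?_⟩)).symm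
    · intro q q' h
      have h' := Prod.ext_iff.1 (Subtype.ext_iff.1 h)
      exact Subtype.ext (Prod.ext (hf h'.1) (hrbij.1 h'.2))
    · rintro ⟨⟨χ, C⟩, hχ, g, hg, hval⟩
      obtain ⟨i, rfl⟩ := hsurj χ hχ
      obtain ⟨j, rfl⟩ := hrbij.2 C
      refine ⟨⟨(i, j), ?_⟩, rfl⟩
      rw [← hgood]
      rwa [hχ.conj_apply (ConjClasses.mk_eq_mk_iff_isConj.1 hg)] at hval
  have hbad : Nat.card {q : (I₁ ⊕ I₂) × (J₁ ⊕ J₂) // ¬ (q.1.isRight → q.2.isLeft)} =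
      Fintype.card I₂ * Fintype.card J₂ := by
    rw [← Fintype.card_prod, ← Nat.card_eq_fintype_card]
    refine (Nat.card_congr (Equiv.ofBijective
      (fun q : I₂ × J₂ => ⟨(Sum.inr q.1, Sum.inr q.2), by simp⟩) ⟨?_, ?_⟩)).symm
    · intro q q' h
      simpa [Prod.ext_iff] using h
    · rintro ⟨⟨i | i, j | j⟩, h⟩
      · simp at h
      · simp at h
      · simp at h
      · exact ⟨(i, j), rfl⟩
  have hsum : Nat.card {q : (I₁ ⊕ I₂) × (J₁ ⊕ J₂) // q.1.isRight → q.2.isLeft} +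
      Fintype.card I₂ * Fintype.card J₂ = Fintype.card (I₁ ⊕ I₂) * Fintype.card (I₁ ⊕ I₂) := by
    rw [← hbad, Nat.card_eq_fintype_card, Nat.card_eq_fintype_card, Fintype.card_subtype_compl,
      Nat.add_sub_cancel' (Fintype.card_subtype_le _), Fintype.card_prod, hcard]
  have hpos : 0 < Fintype.card (I₁ ⊕ I₂) := by
    rw [hcard, ← hJ]
    exact Nat.card_pos
  have hsum' : (Nat.card {q : (I₁ ⊕ I₂) × (J₁ ⊕ J₂) // q.1.isRight → q.2.isLeft} : ℝ) =
      (Fintype.card (I₁ ⊕ I₂) : ℝ) ^ 2 - Fintype.card I₂ * Fintype.card J₂ := by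
    rw [eq_sub_iff_add_eq, sq]
    exact_mod_cast hsum
  have hpos' : (Fintype.card (I₁ ⊕ I₂) : ℝ) ≠ 0 := by exact_mod_cast hpos.ne'
  rw [thetaIIG, hpairs, hIrr, hJ, ← hcard, hsum', ← Nat.cast_add, ← Fintype.card_sum]
  field_simp

open Polynomial in
lemma prime_dvd_eval_one {p : ℕ} [hp : Fact p.Prime] {ζ : ℂ} (hζ : IsPrimitiveRoot ζ p)
    {P : ℤ[X]} (hP : aeval ζ P = 0) : (p : ℤ) ∣ P.eval 1 := by
  have hdvd : cyclotomic p ℤ ∣ P := by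
    rw [cyclotomic_eq_minpoly hζ hp.out.pos]
    exact minpoly.isIntegrallyClosed_dvd (hζ.isIntegral hp.out.pos) hP
  simpa using eval_dvd (x := 1) hdvd

lemma prime_dvd_card_of_sum_eq_zero {p : ℕ} [Fact p.Prime] {ζ : ℂ} (hζ : IsPrimitiveRoot ζ p)
    {ι : Type} [Fintype ι] {e : ι → ℕ} (h : ∑ i, ζ ^ e i = 0) :
    (p : ℤ) ∣ Fintype.card ι := by
  simpa [Polynomial.eval_finsetSum] using
    prime_dvd_eval_one hζ (P := ∑ i, Polynomial.X ^ e i) (by simpa using h)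

lemma prime_dvd_card_of_isRootOfUnity_sum {p : ℕ} [hp : Fact p.Prime] (hodd : Odd p) {ζ : ℂ}
    (hζ : IsPrimitiveRoot ζ p) {ι : Type} [Fintype ι] {e : ι → ℕ}
    (h : IsRootOfUnity (∑ i, ζ ^ e i)) :
    (p : ℤ) ∣ Fintype.card ι - 1 ∨ (p : ℤ) ∣ Fintype.card ι + 1 := by
  let K := IntermediateField.adjoin ℚ {ζ}
  have : IsCyclotomicExtension {p} ℚ K := by
    change IsCyclotomicExtension {p} ℚ K.toSubalgebra
    rw [IntermediateField.adjoin_simple_toSubalgebra_of_isAlgebraic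
      ((hζ.isIntegral hp.out.pos).tower_top.isAlgebraic)]
    exact hζ.adjoin_isCyclotomicExtension ℚ
  have : NumberField K := IsCyclotomicExtension.numberField {p} ℚ K
  let z : K := ⟨ζ, IntermediateField.mem_adjoin_simple_self ℚ ζ⟩
  have hz : IsPrimitiveRoot z p := (IsPrimitiveRoot.coe_submonoidClass_iff (M := ℂ)).1 hζ
  have hfin : IsOfFinOrder (∑ i, z ^ e i) := by
    obtain ⟨n, hn, hpow⟩ := h
    refine isOfFinOrder_iff_pow_eq_one.2 ⟨n, hn, Subtype.ext ?_⟩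
    simpa [z] using hpow
  obtain ⟨r, -, hr | hr⟩ := hz.exists_pow_or_neg_mul_pow_of_isOfFinOrder hodd hfin
  · left
    have hr' : ∑ i, ζ ^ e i = ζ ^ r := by simpa [z] using congrArg (algebraMap K ℂ) hr
    have hdvd := prime_dvd_eval_one hζ (P := ∑ i, Polynomial.X ^ e i - Polynomial.X ^ r)
      (by simp [hr'])
    simpa [Polynomial.eval_finsetSum] using hdvd
  · right
    have hr' : ∑ i, ζ ^ e i = -ζ ^ r := by simpa [z] using congrArg (algebraMap K ℂ) hr
    have hdvd := prime_dvd_eval_one hζ (P := ∑ i, Polynomial.X ^ e i + Polynomial.X ^ r)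
      (by simp [hr'])
    simpa [Polynomial.eval_finsetSum] using hdvd

lemma isRootOfUnity_units {G : Type} [Group G] [Finite G] (φ : G →* ℂˣ) (g : G) :
    IsRootOfUnity (φ g : ℂ) :=
  ⟨orderOf g, orderOf_pos g, by
    rw [← Units.val_pow_eq_pow_val, ← map_pow, pow_orderOf_eq_one, map_one, Units.val_one]⟩

lemma Subgroup.mul_units_smul {F : Type} [Field F] {H : Subgroup Fˣ} (h : H) (x y : F) :
    x * h • y = h • (x * y) := by
  simp only [Subgroup.smul_def, Units.smul_def, smul_eq_mul]
  ring

/-- The affine maps `x ↦ lin • x + trans` of `F` whose linear part lies in `H`. -/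
@[ext]
structure AffineGroup {F : Type} [Field F] (H : Subgroup Fˣ) where
  /-- The translation part. -/
  trans : F
  /-- The linear part. -/
  lin : H

namespace AffineGroup

section Group

variable {F : Type} [Field F] {H : Subgroup Fˣ}

instance : Group (AffineGroup H) where
  mul g h := ⟨g.trans + g.lin • h.trans, g.lin * h.lin⟩
  one := ⟨0, 1⟩
  inv g := ⟨-(g.lin⁻¹ • g.trans), g.lin⁻¹⟩
  mul_assoc a b c := by
    refine AffineGroup.ext ?_ (mul_assoc _ _ _)
    change a.trans + a.lin • b.trans + (a.lin * b.lin) • c.trans =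
      a.trans + a.lin • (b.trans + b.lin • c.trans)
    rw [smul_add, mul_smul, add_assoc]
  one_mul a := AffineGroup.ext ((zero_add _).trans (one_smul _ _)) (one_mul _)
  mul_one a := AffineGroup.ext ((congrArg _ (smul_zero _)).trans (add_zero _)) (mul_one _)
  inv_mul_cancel a := AffineGroup.ext (neg_add_cancel _) (inv_mul_cancel _)

@[simp] lemma trans_mul (g h : AffineGroup H) : (g * h).trans = g.trans + g.lin • h.trans := rfl
@[simp] lemma lin_mul (g h : AffineGroup H) : (g * h).lin = g.lin * h.lin := rfl
@[simp] lemma trans_one : (1 : AffineGroup H).trans = 0 := rfl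
@[simp] lemma lin_one : (1 : AffineGroup H).lin = 1 := rfl
@[simp] lemma trans_inv (g : AffineGroup H) : g⁻¹.trans = -(g.lin⁻¹ • g.trans) := rfl
@[simp] lemma lin_inv (g : AffineGroup H) : g⁻¹.lin = g.lin⁻¹ := rfl

/-- An affine map is determined by its translation and linear parts. -/
def equivProd (H : Subgroup Fˣ) : AffineGroup H ≃ F × H where
  toFun g := (g.trans, g.lin)
  invFun x := ⟨x.1, x.2⟩

/-- Taking linear parts is a homomorphism. -/
def linHom (H : Subgroup Fˣ) : AffineGroup H →* H where
  toFun := lin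
  map_one' := rfl
  map_mul' _ _ := rfl

lemma natCard : Nat.card (AffineGroup H) = Nat.card F * Nat.card H := by
  rw [Nat.card_congr (equivProd H), Nat.card_prod]

lemma isConj_of_lin_ne_one {g : AffineGroup H} (hg : g.lin ≠ 1) : IsConj ⟨0, g.lin⟩ g := by
  have hne : (1 : F) - (g.lin : Fˣ) ≠ 0 := by
    rw [sub_ne_zero]
    exact fun h => hg (Subtype.ext (Units.ext h.symm))
  refine isConj_iff.2 ⟨⟨g.trans / (1 - (g.lin : Fˣ)), 1⟩, ?_⟩
  ext
  · simp only [trans_mul, lin_mul, trans_inv, inv_one, one_smul, one_mul, smul_zero, add_zero,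
      Subgroup.smul_def, Units.smul_def, smul_eq_mul]
    field_simp
    ring
  · simp

lemma isConj_smul (h : H) (x : F) : IsConj (⟨x, 1⟩ : AffineGroup H) ⟨h • x, 1⟩ :=
  isConj_iff.2 ⟨⟨0, h⟩, by ext <;> simp⟩

instance [Fintype F] : Fintype (AffineGroup H) := Fintype.ofEquiv _ (equivProd H).symm

lemma sum_eq [Fintype F] {M : Type} [AddCommMonoid M] (f : AffineGroup H → M) :
    ∑ g, f g = ∑ h : H, ∑ x : F, f ⟨x, h⟩ := by
  rw [← (equivProd H).symm.sum_comp, Fintype.sum_prod_type_right]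
  rfl

/-- The linear character of the affine group inflated from a character of `H`. -/
def linearChar (H : Subgroup Fˣ) (φ : H →* ℂˣ) (g : AffineGroup H) : ℂ := φ g.lin

lemma linearChar_injective : Function.Injective (linearChar H) := fun _ _ h =>
  MonoidHom.ext fun k => Units.ext (congrFun h ⟨0, k⟩)

end Group

section Characters

variable {F : Type} [Field F] [Fintype F] (H : Subgroup Fˣ) (ψ : AddChar F ℂ)

/-- The monomial representation of the affine group on functions on `H`, induced from the
character `x ↦ ψ (a * x)` of the translation subgroup. -/
def inducedRep (a : F) : Representation ℂ (AffineGroup H) (H → ℂ) where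
  toFun g :=
    { toFun := fun f k => ψ (k • (a * g.trans)) * f (k * g.lin)
      map_add' := fun f₁ f₂ => by ext k; simp [mul_add]
      map_smul' := fun c f => by ext k; simp [mul_left_comm] }
  map_one' := by ext; simp
  map_mul' g h := by
    refine LinearMap.ext fun f => funext fun k => ?_
    simp [mul_add, AddChar.map_add_eq_mul, mul_assoc, mul_smul,
      Subgroup.mul_units_smul]

/-- The character of `inducedRep`. -/
def inducedChar (a : F) (g : AffineGroup H) : ℂ :=
  if g.lin = 1 then ∑ k : H, ψ (k • (a * g.trans)) else 0

variable {H ψ}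

lemma trace_inducedRep (a : F) (g : AffineGroup H) :
    LinearMap.trace ℂ (H → ℂ) (inducedRep H ψ a g) = inducedChar H ψ a g := by
  rw [LinearMap.trace_eq_matrix_trace ℂ (Pi.basisFun ℂ H), Matrix.trace]
  simp [inducedRep, inducedChar, Pi.single_apply]

lemma sum_inducedChar_mul (hψ : ψ.IsPrimitive) (a b : F) :
    ∑ g, inducedChar H ψ a g * inducedChar H ψ b g⁻¹ =
      ∑ k : H, ∑ l : H, if k • a = l • b then (Nat.card F : ℂ) else 0 := by
  calc ∑ g, inducedChar H ψ a g * inducedChar H ψ b g⁻¹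
      = ∑ x : F, ∑ k : H, ∑ l : H, ψ (x * (k • a - l • b)) := by
        rw [sum_eq, Finset.sum_eq_single 1 (fun h _ hh => by simp [inducedChar, hh]) (by simp)]
        refine Finset.sum_congr rfl fun x _ => ?_
        simp only [inducedChar, lin_inv, inv_one, if_true, trans_inv, one_smul,
          Finset.sum_mul_sum, ← AddChar.map_add_eq_mul]
        refine Finset.sum_congr rfl fun k _ => Finset.sum_congr rfl fun l _ => congrArg ψ ?_
        simp only [Subgroup.smul_def, Units.smul_def, smul_eq_mul]
        ring
    _ = ∑ k : H, ∑ l : H, ∑ x : F, ψ (x * (k • a - l • b)) := by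
        rw [Finset.sum_comm]
        exact Finset.sum_congr rfl fun k _ => Finset.sum_comm
    _ = _ := by
        simp_rw [AddChar.sum_mulShift _ hψ, sub_eq_zero, Nat.card_eq_fintype_card]
        push_cast
        rfl

lemma sum_inducedChar_mul_self (hψ : ψ.IsPrimitive) {a : F} (ha : a ≠ 0) :
    ∑ g, inducedChar H ψ a g * inducedChar H ψ a g⁻¹ = Nat.card (AffineGroup H) := by
  have hinj : ∀ k l : H, k • a = l • a ↔ k = l := fun k l => by
    rw [Subgroup.smul_def, Subgroup.smul_def, Units.smul_def, Units.smul_def, smul_eq_mul,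
      smul_eq_mul, mul_left_inj' ha, Units.val_inj, Subtype.val_inj]
  rw [natCard]
  simp [sum_inducedChar_mul hψ, hinj, mul_comm]

lemma isIrredChar_inducedChar (hψ : ψ.IsPrimitive) {a : F} (ha : a ≠ 0) :
    IsIrredChar (inducedChar H ψ a) :=
  isIrredChar_of_norm (inducedRep H ψ a) _ (trace_inducedRep a) (sum_inducedChar_mul_self hψ ha)

lemma exists_smul_eq_of_inducedChar_eq (hψ : ψ.IsPrimitive) {a b : F} (ha : a ≠ 0)
    (hab : inducedChar H ψ a = inducedChar H ψ b) : ∃ k l : H, k • a = l • b := by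
  by_contra! hne
  have h := sum_inducedChar_mul_self (H := H) hψ ha
  conv_lhs at h => enter [2, g]; rw [congrFun hab g⁻¹]
  rw [sum_inducedChar_mul hψ] at h
  simp only [hne, if_false, Finset.sum_const_zero] at h
  exact NeZero.ne (Nat.card (AffineGroup H) : ℂ) h.symm

lemma isIrredChar_linearChar (φ : H →* ℂˣ) : IsIrredChar (linearChar H φ) := by
  refine isIrredChar_of_norm
    ((Algebra.lmul ℂ ℂ).toMonoidHom.comp ((Units.coeHom ℂ).comp (φ.comp (linHom H)))) _ ?_ ?_
  · intro g
    rw [LinearMap.trace_eq_matrix_trace ℂ (Module.Basis.singleton Unit ℂ), Matrix.trace]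
    simp [LinearMap.toMatrix_apply, linHom, linearChar]
  · simp [linearChar]

lemma linearChar_ne_inducedChar (hH : 2 ≤ Nat.card H) (φ : H →* ℂˣ) (a : F) :
    linearChar H φ ≠ inducedChar H ψ a := fun h => by
  have h1 := congrFun h 1
  simp [linearChar, inducedChar] at h1
  have : Fintype.card H = 1 := by exact_mod_cast h1.symm
  rw [Nat.card_eq_fintype_card] at hH
  omega

end Characters

end AffineGroup

lemma AddChar.exists_eq_pow {F : Type} [Field F] {p : ℕ} [NeZero p] [CharP F p] (ψ : AddChar F ℂ)
    {ζ : ℂ} (hζ : IsPrimitiveRoot ζ p) (x : F) : ∃ n : ℕ, ψ x = ζ ^ n := by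
  have hx : ψ x ^ p = 1 := by
    rw [← AddChar.map_nsmul_eq_pow, nsmul_eq_mul, CharP.cast_eq_zero, zero_mul,
      AddChar.map_zero_eq_one]
  obtain ⟨n, -, hn⟩ := hζ.eq_pow_of_pow_eq_one hx
  exact ⟨n, hn.symm⟩

theorem thetaIIG_affineGroup {F : Type} [Field F] [Fintype F] {p : ℕ} [Fact p.Prime] [CharP F p]
    (hp : Odd p) (H : Subgroup Fˣ) (hH : 2 ≤ Nat.card H) (h0 : ¬ (p : ℤ) ∣ Nat.card H)
    (hsub : ¬ (p : ℤ) ∣ Nat.card H - 1) (hadd : ¬ (p : ℤ) ∣ Nat.card H + 1) :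
    thetaIIG (AffineGroup H) =
      1 - (H.index * (H.index + 1) : ℝ) / (Nat.card H + H.index : ℝ) ^ 2 := by
  obtain ⟨ψ, hψ⟩ : ∃ ψ : AddChar F ℂ, ψ.IsPrimitive := by
    obtain ⟨ψ, hψ⟩ := AddChar.exists_apply_ne_zero.2 (one_ne_zero (α := F))
    exact ⟨ψ, .of_ne_one fun h => hψ (by rw [h, AddChar.one_apply])⟩
  have hζ := Complex.isPrimitiveRoot_exp p (NeZero.ne p)
  have hdual : Nat.card (H →* ℂˣ) = Nat.card H :=
    CommGroup.card_monoidHom_of_hasEnoughRootsOfUnity H ℂ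
  have : Finite (H →* ℂˣ) := Nat.finite_of_card_ne_zero (hdual ▸ Nat.card_pos.ne')
  have : Fintype (H →* ℂˣ) := Fintype.ofFinite _
  have hone : Fintype.card {h : H // h ≠ 1} + 1 = Fintype.card H := by
    rw [Fintype.card_subtype_compl, Fintype.card_subtype_eq, Nat.sub_add_cancel Fintype.card_pos]
  have hindex : Fintype.card (Fˣ ⧸ H) = H.index := by
    rw [Subgroup.index, Nat.card_eq_fintype_card]
  rw [thetaIIG_eq_of_block
    (Sum.elim (AffineGroup.linearChar H)
      fun c : Fˣ ⧸ H => AffineGroup.inducedChar H ψ (c.out : Fˣ))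
    (Sum.elim (fun h : {h : H // h ≠ 1} => ⟨0, h⟩)
      fun o : Option (Fˣ ⧸ H) => ⟨o.elim 0 fun c => (c.out : Fˣ), 1⟩)
    ?_ ?_ ?_ ?_ ?_]
  · rw [Fintype.card_option, hindex, ← Nat.card_eq_fintype_card, hdual]
    push_cast
    rfl
  · refine AffineGroup.linearChar_injective.sumElim ?_
      fun φ c => AffineGroup.linearChar_ne_inducedChar hH φ _
    intro c d hcd
    obtain ⟨k, l, hkl⟩ := AffineGroup.exists_smul_eq_of_inducedChar_eq hψ (Units.ne_zero _) hcd
    have hkl' : (k : Fˣ) * c.out = l * d.out := Units.ext hkl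
    rw [← c.out_eq', ← d.out_eq', QuotientGroup.eq]
    have : c.out⁻¹ * d.out = k * (l : Fˣ)⁻¹ := by
      rw [inv_mul_eq_iff_eq_mul, mul_left_comm, ← mul_assoc, hkl']
      simp
    rw [this]
    exact H.mul_mem k.2 (H.inv_mem l.2)
  · rintro (φ | c)
    · exact AffineGroup.isIrredChar_linearChar φ
    · exact AffineGroup.isIrredChar_inducedChar hψ (Units.ne_zero _)
  · intro C
    obtain ⟨g, rfl⟩ := ConjClasses.exists_rep C
    simp only [ConjClasses.mk_eq_mk_iff_isConj]
    by_cases hg : g.lin = 1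
    · obtain ⟨x, h⟩ := g
      obtain rfl : h = 1 := hg
      by_cases hx : x = 0
      · subst hx
        exact ⟨Sum.inr none, IsConj.refl _⟩
      · obtain ⟨h, hh⟩ := QuotientGroup.mk_out_eq_mul H (Units.mk0 x hx)
        refine ⟨Sum.inr (some (QuotientGroup.mk (Units.mk0 x hx))), ?_⟩
        have hsmul : ((QuotientGroup.mk (Units.mk0 x hx) : Fˣ ⧸ H).out : F) = h • x := by
          rw [hh, Subgroup.smul_def, Units.smul_def, Units.val_mul, Units.val_mk0, smul_eq_mul,
            mul_comm]
        simp only [Sum.elim_inr, Option.elim_some, hsmul]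
        exact (AffineGroup.isConj_smul h x).symm
    · exact ⟨Sum.inl ⟨g.lin, hg⟩, AffineGroup.isConj_of_lin_ne_one hg⟩
  · rw [Fintype.card_sum, Fintype.card_sum, Fintype.card_option, ← Nat.card_eq_fintype_card,
      hdual, Nat.card_eq_fintype_card]
    omega
  · rintro (φ | c) (h | o)
    · exact iff_of_true (Or.inr (isRootOfUnity_units φ _)) (by simp)
    · exact iff_of_true (Or.inr (isRootOfUnity_units φ _)) (by simp)
    · simp [AffineGroup.inducedChar, h.2]
    · simp only [Sum.elim_inr, AffineGroup.inducedChar, if_true, Sum.isRight_inr, Sum.isLeft_inr]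
      choose e he using fun k : H => ψ.exists_eq_pow hζ (k • ((c.out : Fˣ) *
        o.elim 0 fun c => ((c.out : Fˣ) : F)))
      simp only [he]
      rw [Nat.card_eq_fintype_card] at h0 hsub hadd
      refine iff_of_false ?_ (by simp)
      rintro (hz | hu)
      · exact h0 (prime_dvd_card_of_sum_eq_zero hζ hz)
      · exact (prime_dvd_card_of_isRootOfUnity_sum hp hζ hu).elim hsub hadd

lemma exists_thetaIIG_eq {p : ℕ} (hp : p.Prime) {m n : ℕ} (hm : 0 < m) (hn : 0 < n)
    (hmn : m ≠ n) (hlt : m + n < p) (hpm : 2 * m < p) (hsub : (m : ℤ) ∣ p - 1)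
    (hadd : (n : ℤ) ∣ p + 1) :
    ∃ (G : Type) (_ : Group G) (_ : Fintype G), ∃ d r : ℝ, m * d = n * (p - 1) ∧
      n * r = m * (p + 1) ∧ thetaIIG G = 1 - (r * (r + 1)) / (d + r) ^ 2 := by
  have := Fact.mk hp
  obtain ⟨s, hs⟩ := hsub
  obtain ⟨t, ht⟩ := hadd
  have hs0 : 0 < s := by nlinarith
  have ht0 : 0 < t := by nlinarith
  lift s to ℕ using hs0.le
  lift t to ℕ using ht0.le
  have hcard : Nat.card (GaloisField p 2)ˣ = (n * s) * (m * t) := by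
    rw [Nat.card_units, GaloisField.card p 2 two_ne_zero]
    zify [Nat.one_le_pow 2 p hp.pos]
    linear_combination ht * (p - 1) + hs * n * t
  have : Fintype (GaloisField p 2) := Fintype.ofFinite _
  let H : Subgroup (GaloisField p 2)ˣ := (powMonoidHom (n * s)).ker
  have hH : Nat.card H = n * s := by
    rw [IsCyclic.card_powMonoidHom_ker, hcard]
    simp
  have hns : 0 < n * s := Nat.mul_pos hn (by exact_mod_cast hs0)
  have hindex : H.index = m * t := by
    have h := H.card_mul_index
    rw [hH, hcard] at h
    exact Nat.eq_of_mul_eq_mul_left hns h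
  have key : ∀ e : ℤ, (p : ℤ) ∣ (n * s : ℕ) + e → (p : ℤ) ∣ e * m - n := by
    intro e h
    have h1 : (e * m - n : ℤ) = m * ((n * s : ℕ) + e) - n * p := by
      push_cast
      linear_combination n * hs
    rw [h1]
    exact dvd_sub (h.mul_left _) (dvd_mul_left _ _)
  refine ⟨AffineGroup H, inferInstance, inferInstance, (n * s : ℕ), (m * t : ℕ), ?_, ?_, ?_⟩
  · have hs' : (p : ℝ) - 1 = m * s := by exact_mod_cast hs
    push_cast
    linear_combination -n * hs'
  · have ht' : (p : ℝ) + 1 = n * t := by exact_mod_cast ht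
    push_cast
    linear_combination -m * ht'
  · have h2 : 2 ≤ s := by
      by_contra hlt2
      have : s = 1 := by omega
      subst this
      push_cast at hs
      omega
    rw [thetaIIG_affineGroup (p := p) (hp.odd_of_ne_two (by omega)) H ?_ ?_ ?_ ?_, hH, hindex]
    · rw [hH]
      exact h2.trans (Nat.le_mul_of_pos_left s hn)
    all_goals rw [hH]; intro h
    · have := Int.eq_zero_of_abs_lt_dvd (key 0 (by simpa using h)) (abs_lt.2 (by omega))
      omega
    · have := Int.eq_zero_of_abs_lt_dvd (key (-1) (by rwa [← sub_eq_add_neg]))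
        (abs_lt.2 (by omega))
      omega
    · have := Int.eq_zero_of_abs_lt_dvd (key 1 h) (abs_lt.2 (by omega))
      omega

lemma exists_prime_gt_dvd_sub_one_dvd_add_one {m n : ℕ} (hm : 0 < m) (hn : 0 < n)
    (hmn : m.Coprime n) (N : ℕ) :
    ∃ p > N, p.Prime ∧ (m : ℤ) ∣ p - 1 ∧ (n : ℤ) ∣ p + 1 := by
  obtain ⟨u, v, huv⟩ := Nat.isCoprime_iff_coprime.2 hmn
  have hcop : IsCoprime (v * n - u * m) ((m * n : ℕ) : ℤ) :=
    ⟨v * n - u * m, 4 * u * v, by push_cast; linear_combination (u * m + v * n + 1) * huv⟩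
  obtain ⟨p, hpN, hp, hmod⟩ := Nat.forall_exists_prime_gt_and_zmodEq N (by positivity) hcop
  obtain ⟨w, hw⟩ := hmod.symm.dvd
  push_cast at hw
  refine ⟨p, hpN, hp, ⟨n * w - 2 * u, ?_⟩, ⟨m * w + 2 * v, ?_⟩⟩
  · linear_combination hw + huv
  · linear_combination hw - huv

/-- The limits, as `p → ∞`, of `thetaIIG` of affine groups over the field with `p ^ 2`
elements are approximated. -/
lemma exists_abs_thetaIIG_sub_lt_of_coprime {m n : ℕ} (hm : 0 < m) (hn : 0 < n) (hne : m ≠ n)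
    (hmn : m.Coprime n) {ε : ℝ} (hε : 0 < ε) :
    ∃ (G : Type) (_ : Group G) (_ : Fintype G),
      |thetaIIG G - (1 - ((m / n : ℝ) ^ 2 / (1 + (m / n : ℝ) ^ 2)) ^ 2)| < ε := by
  have hm' : (0 : ℝ) < m := by exact_mod_cast hm
  have hn' : (0 : ℝ) < n := by exact_mod_cast hn
  let f : ℝ → ℝ := fun e => 1 - ((m / n) * (1 + e)) * ((m / n) * (1 + e) + e) /
    ((n / m) * (1 - e) + (m / n) * (1 + e)) ^ 2
  have hf0 : f 0 = 1 - ((m / n : ℝ) ^ 2 / (1 + (m / n : ℝ) ^ 2)) ^ 2 := by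
    simp only [f]
    field_simp
    ring
  have hcont : ContinuousAt f 0 := by
    have : ((n / m : ℝ) * (1 - 0) + (m / n) * (1 + 0)) ^ 2 ≠ 0 := by
      simp only [sub_zero, add_zero, mul_one]
      positivity
    fun_prop (disch := assumption)
  have hlim : Filter.Tendsto (fun p : ℕ => f (1 / p)) Filter.atTop (nhds (f 0)) :=
    hcont.tendsto.comp tendsto_one_div_atTop_nhds_zero_nat
  obtain ⟨N, hN⟩ := Metric.tendsto_atTop.1 hlim ε hε
  obtain ⟨p, hpN, hp, hsub, hadd⟩ :=
    exists_prime_gt_dvd_sub_one_dvd_add_one hm hn hmn (max N (2 * m + n))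
  obtain ⟨G, hG, hG', d, r, hd, hr, hθ⟩ :=
    exists_thetaIIG_eq hp hm hn hne (by omega) (by omega) hsub hadd
  refine ⟨G, hG, hG', ?_⟩
  have hp' : (0 : ℝ) < p := by exact_mod_cast hp.pos
  have hfp : thetaIIG G = f (1 / p) := by
    have hd' : d = n * (p - 1) / m := by rw [eq_div_iff hm'.ne']; linear_combination hd
    have hr' : r = m * (p + 1) / n := by rw [eq_div_iff hn'.ne']; linear_combination hr
    have hu : (m / n : ℝ) * (1 + 1 / p) = r / p := by rw [hr']; field_simp
    have hv : (n / m : ℝ) * (1 - 1 / p) = d / p := by rw [hd']; field_simp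
    rw [hθ]
    simp only [f]
    rw [hu, hv, ← add_div, ← add_div, div_mul_div_comm, div_pow, ← sq (p : ℝ),
      div_div_div_cancel_right₀ (by positivity)]
  rw [hfp, ← hf0, ← Real.dist_eq]
  exact hN p (by omega)

lemma exists_abs_thetaIIG_sub_lt {L : ℝ} (hL0 : 0 < L) (hL1 : L < 1) {ε : ℝ} (hε : 0 < ε) :
    ∃ (G : Type) (_ : Group G) (_ : Fintype G), |thetaIIG G - L| < ε := by
  let f : ℝ → ℝ := fun y => 1 - (y ^ 2 / (1 + y ^ 2)) ^ 2
  have hf : Continuous f := by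
    have : ∀ y : ℝ, 1 + y ^ 2 ≠ 0 := fun y => by positivity
    fun_prop (disch := assumption)
  have hs0 : 0 < √(1 - L) := Real.sqrt_pos.2 (by linarith)
  have hs1 : √(1 - L) < 1 := by
    rw [Real.sqrt_lt' one_pos]
    linarith
  have hpos : 0 < √(1 - L) / (1 - √(1 - L)) := div_pos hs0 (by linarith)
  have hy : f √(√(1 - L) / (1 - √(1 - L))) = L := by
    have hs : √(1 - L) ^ 2 = 1 - L := Real.sq_sqrt (by linarith)
    have hne : 1 - √(1 - L) ≠ 0 := by linarith
    simp only [f]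
    rw [Real.sq_sqrt hpos.le]
    have : √(1 - L) / (1 - √(1 - L)) / (1 + √(1 - L) / (1 - √(1 - L))) = √(1 - L) := by
      field_simp
      ring
    rw [this, hs]
    ring
  let U : Set ℝ := Set.Ioi 0 ∩ f ⁻¹' Metric.ball L (ε / 2)
  have hU : IsOpen U := isOpen_Ioi.inter (Metric.isOpen_ball.preimage hf)
  obtain ⟨y, hyU, hy1⟩ := (dense_compl_singleton (1 : ℝ)).inter_open_nonempty U hU
    ⟨_, Real.sqrt_pos.2 hpos, by
      rw [Set.mem_preimage, hy]
      exact Metric.mem_ball_self (half_pos hε)⟩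
  obtain ⟨_, ⟨hqU, hq1⟩, q, rfl⟩ := Rat.denseRange_cast.inter_open_nonempty (U ∩ {1}ᶜ)
    (hU.inter isOpen_compl_singleton) ⟨y, hyU, hy1⟩
  have hq0 : 0 < q := Rat.cast_pos.1 (Set.mem_Ioi.1 hqU.1)
  have hnum : (q.num.natAbs : ℤ) = q.num := Int.natAbs_of_nonneg (Rat.num_nonneg.2 hq0.le)
  have hcast : (q.num.natAbs / q.den : ℝ) = q := by
    rw [Rat.cast_def, ← hnum]
    simp
  obtain ⟨G, hG, hG', h⟩ := exists_abs_thetaIIG_sub_lt_of_coprime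
    (Int.natAbs_pos.2 (Rat.num_pos.2 hq0).ne') q.den_pos
    (fun h => hq1 (by rw [Set.mem_singleton_iff, ← hcast, h, div_self (by simp)])) q.reduced
    (half_pos hε)
  refine ⟨G, hG, hG', ?_⟩
  rw [hcast] at h
  have h' : |f q - L| < ε / 2 := hqU.2
  calc |thetaIIG G - L| ≤ |thetaIIG G - f q| + |f q - L| := abs_sub_le _ _ _
    _ < ε := by linarith

/-- Denseness of values of `thetaIIG` on finite groups. -/
theorem denseness_thetaII_group (L : ℝ) (hL1 : 0 ≤ L) (hL2 : L ≤ 1) (ε : ℝ) (hε : 0 < ε) :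
    ∃ (G : Type) (_ : Group G) (_ : Fintype G), |thetaIIG G - L| < ε := by
  obtain ⟨L', ⟨hL0', hL1'⟩, hL'⟩ : ∃ L' ∈ Set.Ioo (0 : ℝ) 1, dist L L' < ε / 2 := by
    refine Metric.mem_closure_iff.1 ?_ _ (half_pos hε)
    rw [closure_Ioo zero_ne_one]
    exact ⟨hL1, hL2⟩
  obtain ⟨G, hG, hG', h⟩ := exists_abs_thetaIIG_sub_lt hL0' hL1' (half_pos hε)
  refine ⟨G, hG, hG', ?_⟩
  rw [dist_comm, Real.dist_eq] at hL'
  calc |thetaIIG G - L| ≤ |thetaIIG G - L'| + |L' - L| := abs_sub_le _ _ _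
    _ < ε := by linarith
end
end

section
/- If χ is an irreducible complex character of a finite nilpotent group G and g ∈ G, then χ(g) is a root of unity if and only if χ(1) = 1. -/
open scoped Classical

noncomputable section

/-- In a finite nilpotent group, elements of coprime order commute. -/
theorem Group.IsNilpotent.commute_of_coprime_orderOf {G : Type*} [Group G] [Finite G]
    [Group.IsNilpotent G] {x y : G} (h : (orderOf x).Coprime (orderOf y)) : Commute x y := by
  obtain ⟨e⟩ := ((Group.isNilpotent_of_finite_tfae (G := G)).out 0 4 rfl rfl).mp ‹_›
  suffices Commute (e.symm x) (e.symm y) by simpa using this.map e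
  refine funext fun q ↦ funext fun Q ↦ ?_
  change Commute (e.symm x q Q) (e.symm y q Q)
  have hq : (q : ℕ).Prime := Nat.prime_of_mem_primeFactors q.2
  have hdvd (z : G) : orderOf (e.symm z q Q) ∣ orderOf z := by
    refine orderOf_dvd_of_pow_eq_one ?_
    rw [← Pi.pow_apply, ← Pi.pow_apply, ← map_pow, pow_orderOf_eq_one, map_one]
    rfl
  obtain ⟨a, ha⟩ := Q.isPGroup' (e.symm x q Q)
  obtain ⟨b, hb⟩ := Q.isPGroup' (e.symm y q Q)
  obtain ⟨a, -, ha⟩ := (Nat.dvd_prime_pow hq).mp (orderOf_dvd_of_pow_eq_one ha)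
  obtain ⟨b, -, hb⟩ := (Nat.dvd_prime_pow hq).mp (orderOf_dvd_of_pow_eq_one hb)
  have hc := (h.coprime_dvd_left (hdvd x)).coprime_dvd_right (hdvd y)
  rw [ha, hb] at hc
  rcases Nat.eq_zero_or_pos a with rfl | ha0
  · rw [pow_zero, orderOf_eq_one_iff] at ha
    rw [ha]
    exact Commute.one_left _
  rcases Nat.eq_zero_or_pos b with rfl | hb0
  · rw [pow_zero, orderOf_eq_one_iff] at hb
    rw [hb]
    exact Commute.one_right _
  rw [Nat.coprime_pow_left_iff ha0, Nat.coprime_pow_right_iff hb0, Nat.coprime_self] at hc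
  exact absurd hc hq.one_lt.ne'

/-- In a finite nilpotent group, a prime not dividing the order of an element does not divide
the size of its conjugacy class. -/
theorem Group.IsNilpotent.not_dvd_card_isConj {G : Type*} [Group G] [Fintype G]
    [Group.IsNilpotent G] {p : ℕ} [Fact p.Prime] {h : G} (hp : ¬ p ∣ orderOf h) :
    ¬ p ∣ (Finset.univ.filter fun c ↦ IsConj c h).card := by
  obtain ⟨P⟩ : Nonempty (Sylow p G) := inferInstance
  let Q := (P : Subgroup G).map (ConjAct.toConjAct (G := G)).toMonoidHom
  have hQ : Q ≤ MulAction.stabilizer (ConjAct G) h := by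
    rintro _ ⟨x, hx, rfl⟩
    obtain ⟨k, hk⟩ := P.isPGroup' ⟨x, hx⟩
    have hk : x ^ p ^ k = 1 := congrArg Subtype.val hk
    have hc : Commute x h := by
      refine commute_of_coprime_orderOf (Nat.Coprime.coprime_dvd_left
        (orderOf_dvd_of_pow_eq_one hk) (Nat.Coprime.pow_left _ ?_))
      exact (Nat.Prime.coprime_iff_not_dvd Fact.out).mpr hp
    change ConjAct.toConjAct x • h = h
    rw [ConjAct.toConjAct_smul, hc.eq, mul_inv_cancel_right]
  have hcard : (Finset.univ.filter fun c ↦ IsConj c h).card =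
      (MulAction.stabilizer (ConjAct G) h).index := by
    rw [MulAction.index_stabilizer, ← Set.ncard_coe_finset]
    congr 1
    ext c
    simp [ConjAct.mem_orbit_conjAct]
  have hindex : Q.index = (P : Subgroup G).index :=
    Subgroup.index_map_equiv (P : Subgroup G) (ConjAct.toConjAct (G := G))
  rw [hcard]
  intro hd
  exact P.not_dvd_index (hindex ▸ hd.trans (Subgroup.index_dvd_of_le hQ))

/-- An endomorphism of finite order over the complex numbers has a basis of eigenvectors. -/
theorem Module.End.exists_basis_eigenvectors_of_pow_eq_one {V : Type*} [AddCommGroup V]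
    [Module ℂ V] [FiniteDimensional ℂ V] {A : Module.End ℂ V} {n : ℕ} (hn : n ≠ 0)
    (hA : A ^ n = 1) :
    ∃ (b : Module.Basis (Fin (Module.finrank ℂ V)) ℂ V) (μ : Fin (Module.finrank ℂ V) → ℂ),
      ∀ i, A (b i) = μ i • b i := by
  have hs : A.IsSemisimple := by
    refine Module.End.isSemisimple_of_squarefree_aeval_eq_zero
      (p := (Polynomial.X ^ n - 1 : Polynomial ℂ)) ?_ (by simp [hA])
    exact (Polynomial.X_pow_sub_one_separable_iff.mpr (by exact_mod_cast hn)).squarefree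
  have htop : ⨆ μ, A.eigenspace μ = ⊤ := by
    rw [← Module.End.iSup_maxGenEigenspace_eq_top A]
    simp_rw [hs.isFinitelySemisimple.maxGenEigenspace_eq_eigenspace]
  have hint := DirectSum.isInternal_submodule_of_iSupIndep_of_iSup_eq_top
    A.eigenspaces_iSupIndep htop
  let b := hint.collectedBasis fun μ ↦ Module.finBasis ℂ (A.eigenspace μ)
  let _ := FiniteDimensional.fintypeBasisIndex b
  let e := Fintype.equivFinOfCardEq (Module.finrank_eq_card_basis b).symm
  refine ⟨b.reindex e, fun i ↦ (e.symm i).1, fun i ↦ ?_⟩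
  rw [Module.Basis.reindex_apply]
  exact Module.End.mem_eigenspace_iff.mp
    (hint.collectedBasis_mem (fun μ ↦ Module.finBasis ℂ (A.eigenspace μ)) (e.symm i))

/-- The traces of the powers of an endomorphism of finite order `n` are the power sums of
a family of `n`-th roots of unity. -/
theorem Module.End.exists_trace_pow_eq_sum_of_pow_eq_one {V : Type*} [AddCommGroup V]
    [Module ℂ V] [FiniteDimensional ℂ V] {A : Module.End ℂ V} {n : ℕ} (hn : n ≠ 0)
    (hA : A ^ n = 1) :
    ∃ μ : Fin (Module.finrank ℂ V) → ℂ, (∀ i, μ i ^ n = 1) ∧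
      ∀ k : ℕ, LinearMap.trace ℂ V (A ^ k) = ∑ i, μ i ^ k := by
  obtain ⟨b, μ, hb⟩ := exists_basis_eigenvectors_of_pow_eq_one hn hA
  have hpow (k : ℕ) (i) : (A ^ k) (b i) = μ i ^ k • b i := by
    induction k with
    | zero => simp
    | succ k ih => rw [pow_succ, Module.End.mul_apply, hb, map_smul, ih, smul_smul, pow_succ']
  refine ⟨μ, fun i ↦ ?_, fun k ↦ ?_⟩
  · have h := hpow n i
    rw [hA, Module.End.one_apply] at h
    refine smul_left_injective ℂ (b.ne_zero i) ?_
    simpa using h.symm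
  · rw [LinearMap.trace_eq_matrix_trace ℂ b, Matrix.trace]
    simp [LinearMap.toMatrix_apply, hpow]

/-- Modulo a prime `p`, a `p`-power of a sum is the sum of the `p`-powers. -/
theorem Finset.natCast_dvd_sum_pow_prime_pow_sub {R ι : Type*} [CommRing R] (p k : ℕ)
    [Fact p.Prime] (s : Finset ι) (f : ι → R) :
    (p : R) ∣ (∑ i ∈ s, f i) ^ p ^ k - ∑ i ∈ s, f i ^ p ^ k := by
  induction s using Finset.induction_on with
  | empty =>
    simp [(Fact.out : p.Prime).ne_zero]
  | insert a s ha ih =>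
    obtain ⟨r, hr⟩ := exists_add_pow_prime_pow_eq (Fact.out : p.Prime) (f a) (∑ i ∈ s, f i) k
    obtain ⟨c, hc⟩ := ih
    rw [Finset.sum_insert ha, Finset.sum_insert ha, hr]
    refine ⟨f a * (∑ i ∈ s, f i) * r + c, ?_⟩
    linear_combination hc

/-- The eigenvalues of a group element in a finite-dimensional complex representation. -/
theorem FDRep.exists_character_pow_eq_sum {G : Type} [Group G] [Fintype G] (V : FDRep ℂ G)
    (g : G) :
    ∃ μ : Fin (Module.finrank ℂ V) → ℂ, (∀ i, μ i ^ Fintype.card G = 1) ∧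
      ∀ k : ℕ, V.character (g ^ k) = ∑ i, μ i ^ k := by
  obtain ⟨μ, h1, h2⟩ := Module.End.exists_trace_pow_eq_sum_of_pow_eq_one (A := V.ρ g)
    Fintype.card_ne_zero (by rw [← map_pow, pow_card_eq_one, map_one])
  refine ⟨μ, h1, fun k ↦ ?_⟩
  rw [← h2, ← map_pow]
  rfl

/-- The value of a character at a `p ^ k`-th power is congruent to the `p ^ k`-th power of its
value, modulo `p` times an algebraic integer. -/
theorem FDRep.exists_character_pow_prime_pow_eq {G : Type} [Group G] [Fintype G]
    (V : FDRep ℂ G) (g : G) (p k : ℕ) [Fact p.Prime] :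
    ∃ r : ℂ, IsIntegral ℤ r ∧
      V.character g ^ p ^ k = V.character (g ^ p ^ k) + p * r := by
  obtain ⟨μ, h1, h2⟩ := V.exists_character_pow_eq_sum g
  have hμ (i) : IsIntegral ℤ (μ i) :=
    IsIntegral.of_pow Fintype.card_pos (by rw [h1 i]; exact isIntegral_one)
  obtain ⟨r, hr⟩ := Finset.natCast_dvd_sum_pow_prime_pow_sub p k Finset.univ
    fun i ↦ (⟨μ i, hμ i⟩ : integralClosure ℤ ℂ)
  refine ⟨r, r.2, ?_⟩
  have hr := congrArg (algebraMap (integralClosure ℤ ℂ) ℂ) hr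
  simp only [map_sub, map_pow, map_sum, map_mul, map_natCast] at hr
  have h3 := h2 1
  simp only [pow_one] at h3
  rw [h3, h2]
  exact sub_eq_iff_eq_add'.mp hr

/-- **Schur's lemma** for a simple object of `FDRep`. -/
theorem FDRep.exists_eq_smul_one_of_commute {G : Type} [Group G] (V : FDRep ℂ G)
    [CategoryTheory.Simple V] (S : Module.End ℂ V) (hS : ∀ g, Commute S (V.ρ g)) :
    ∃ ω : ℂ, S = ω • 1 := by
  let f : V ⟶ V := ⟨CategoryTheory.InducedCategory.homMk (ModuleCat.ofHom S), fun g ↦ by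
    ext v
    exact LinearMap.congr_fun (hS g).eq v⟩
  obtain ⟨c, hc⟩ := CategoryTheory.endomorphism_simple_eq_smul_id ℂ f
  refine ⟨c, ?_⟩
  have h := congrArg (fun φ : V ⟶ V ↦ φ.hom.hom.hom) hc
  exact h.symm

/-- The central character of an irreducible representation takes integral values on class sums. -/
theorem FDRep.exists_isIntegral_card_isConj_mul_character {G : Type} [Group G] [Fintype G]
    (V : FDRep ℂ G) [CategoryTheory.Simple V] (h : G) :
    ∃ ω : ℂ, IsIntegral ℤ ω ∧
      ((Finset.univ.filter fun c ↦ IsConj c h).card : ℂ) * V.character h =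
        ω * V.character 1 := by
  set C : Finset G := Finset.univ.filter fun c ↦ IsConj c h with hC
  let S : Module.End ℂ V := ∑ c ∈ C, V.ρ c
  obtain ⟨ω, hω⟩ := V.exists_eq_smul_one_of_commute S fun g ↦ by
    change S * V.ρ g = V.ρ g * S
    simp only [S, Finset.sum_mul, Finset.mul_sum, ← map_mul]
    refine Finset.sum_equiv (MulAut.conj g⁻¹).toEquiv (fun c ↦ ?_) fun c _ ↦ ?_
    · simp only [hC, Finset.mem_filter_univ]
      have hcc : IsConj c (g⁻¹ * c * g⁻¹⁻¹) := isConj_iff.mpr ⟨g⁻¹, rfl⟩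
      exact ⟨hcc.symm.trans, hcc.trans⟩
    · simp [mul_assoc]
  have htr : LinearMap.trace ℂ V S = C.card * V.character h := by
    rw [map_sum, ← nsmul_eq_mul]
    refine Finset.sum_eq_card_nsmul fun c hc ↦ ?_
    obtain ⟨x, rfl⟩ := isConj_iff.mp (Finset.mem_filter.mp hc).2.symm
    exact V.char_conj h x
  by_cases hV : Nontrivial V
  · refine ⟨ω, ?_, ?_⟩
    · have hint : IsIntegral ℤ S := by
        have hK : IsIntegral ℤ (∑ c ∈ C, MonoidAlgebra.of ℤ G c) :=
          Algebra.IsIntegral.isIntegral _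
        simpa [S] using hK.map (MonoidAlgebra.lift ℤ (Module.End ℂ V) G V.ρ)
      rw [hω, ← Algebra.algebraMap_eq_smul_one] at hint
      exact (isIntegral_algebraMap_iff (algebraMap ℂ (Module.End ℂ V)).injective).mp hint
    · rw [← htr, hω, map_smul, smul_eq_mul, ← map_one V.ρ]
      rfl
  · rw [not_nontrivial_iff_subsingleton] at hV
    refine ⟨0, isIntegral_zero, ?_⟩
    rw [← htr, Subsingleton.elim S 0, map_zero, zero_mul]

/-- The inverse of a prime number is not an algebraic integer. -/
theorem Nat.Prime.natCast_mul_ne_one_of_isIntegral {p : ℕ} (hp : p.Prime) {r : ℂ}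
    (hr : IsIntegral ℤ r) : (p : ℂ) * r ≠ 1 := by
  intro h
  have hp0 : (p : ℂ) ≠ 0 := by exact_mod_cast hp.ne_zero
  have hr' : r = algebraMap ℚ ℂ ((p : ℚ)⁻¹) := by
    rw [map_inv₀, map_natCast]
    exact eq_inv_of_mul_eq_one_right h
  rw [hr', isIntegral_algebraMap_iff (algebraMap ℚ ℂ).injective] at hr
  obtain ⟨z, hz⟩ := IsIntegrallyClosed.isIntegral_iff.mp hr
  have hpz : (p : ℤ) * z = 1 := by
    have hq : (p : ℚ) * z = 1 := by
      rw [show (z : ℚ) = (p : ℚ)⁻¹ from hz]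
      exact mul_inv_cancel₀ (by exact_mod_cast hp.ne_zero)
    exact_mod_cast hq
  exact hp.one_lt.ne' (by exact_mod_cast Int.eq_one_of_mul_eq_one_right (by positivity) hpz)

/-- If a prime `p` divides the degree of an irreducible representation of a finite nilpotent group,
then it divides the character values at elements of order prime to `p`. -/
theorem FDRep.exists_character_eq_prime_mul {G : Type} [Group G] [Fintype G]
    [Group.IsNilpotent G] (V : FDRep ℂ G) [CategoryTheory.Simple V] {p : ℕ} [Fact p.Prime]
    (hp : p ∣ Module.finrank ℂ V) {h : G} (hh : ¬ p ∣ orderOf h) :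
    ∃ r : ℂ, IsIntegral ℤ r ∧ V.character h = p * r := by
  obtain ⟨ω, hω, hmul⟩ := V.exists_isIntegral_card_isConj_mul_character h
  obtain ⟨d, hd⟩ := hp
  set m := (Finset.univ.filter fun c ↦ IsConj c h).card
  have hm : IsCoprime (m : ℤ) p := Nat.isCoprime_iff_coprime.mpr
    ((Nat.Prime.coprime_iff_not_dvd Fact.out).mpr
      (Group.IsNilpotent.not_dvd_card_isConj hh)).symm
  obtain ⟨a, b, hab⟩ := hm
  have hχ : IsIntegral ℤ (V.character h) := by
    obtain ⟨μ, h1, h2⟩ := V.exists_character_pow_eq_sum h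
    have h3 := h2 1
    simp only [pow_one] at h3
    rw [h3]
    exact IsIntegral.sum _ fun i _ ↦
      IsIntegral.of_pow Fintype.card_pos (by rw [h1 i]; exact isIntegral_one)
  refine ⟨a * (ω * d) + b * V.character h, ?_, ?_⟩
  · exact ((isIntegral_algebraMap (x := a)).mul (hω.mul (isIntegral_algebraMap (x := (d : ℤ))))).add
      ((isIntegral_algebraMap (x := b)).mul hχ)
  · have hab' : (a : ℂ) * m + b * p = 1 := by exact_mod_cast hab
    rw [V.char_one, hd, Nat.cast_mul] at hmul
    linear_combination (-V.character h) * hab' + a * hmul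

/-- If `χ` is an irreducible character of a finite nilpotent group `G` and `g ∈ G`, then
`χ g` is a root of unity if and only if `χ 1 = 1` (i.e. `χ` has degree `1`). -/
theorem rootOfUnity_value_iff_degree_one {G : Type} [Group G] [Fintype G]
    [Group.IsNilpotent G] (χ : G → ℂ) (hχ : IsIrredChar χ) (g : G) :
    IsRootOfUnity (χ g) ↔ χ 1 = 1 := by
  obtain ⟨V, hV, rfl⟩ := hχ
  constructor
  · rintro ⟨n, hn, hroot⟩
    by_contra hne
    have hdeg : Module.finrank ℂ V ≠ 1 := fun h ↦ hne (by rw [V.char_one, h, Nat.cast_one])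
    obtain ⟨p, hp, hpd⟩ := Nat.exists_prime_and_dvd hdeg
    have : Fact p.Prime := ⟨hp⟩
    set k := (Fintype.card G).factorization p
    have hord : ¬ p ∣ orderOf (g ^ p ^ k) := fun h ↦ by
      refine Nat.not_dvd_ordCompl hp (Fintype.card_ne_zero (α := G))
        (h.trans (orderOf_dvd_of_pow_eq_one ?_))
      rw [← pow_mul, Nat.ordProj_mul_ordCompl_eq_self, pow_card_eq_one]
    obtain ⟨s, hs, hsr⟩ := V.exists_character_eq_prime_mul hpd hord
    obtain ⟨r, hr, hrr⟩ := V.exists_character_pow_prime_pow_eq g p k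
    have hχ : V.character g ^ p ^ k = p * (s + r) := by rw [hrr, hsr, mul_add]
    refine hp.natCast_mul_ne_one_of_isIntegral
      (r := (s + r) * (p * (s + r)) ^ (n - 1)) ?_ ?_
    · exact (hs.add hr).mul
        (((isIntegral_algebraMap (x := (p : ℤ))).mul (hs.add hr)).pow _)
    · rw [← mul_assoc, mul_pow_sub_one hn.ne', ← hχ, pow_right_comm, hroot, one_pow]
  · intro h
    have hdeg : Module.finrank ℂ V = 1 := by
      rw [V.char_one] at h
      exact_mod_cast h
    obtain ⟨μ, h1, h2⟩ := V.exists_character_pow_eq_sum g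
    refine ⟨Fintype.card G, Fintype.card_pos, ?_⟩
    have : Subsingleton (Fin (Module.finrank ℂ V)) := Fin.subsingleton_iff_le_one.mpr hdeg.le
    have hχ := h2 1
    rw [Fintype.sum_subsingleton _ ⟨0, by omega⟩, pow_one, pow_one] at hχ
    rw [hχ, h1]
end
end

section
/- Let q be a prime power, let L₂(q) = PSL₂(q) act faithfully in the natural way on the points of the projective line over 𝔽_q with permutation character π_q, and let χ_q = π_q − 1. Then χ_q is the unique irreducible complex character of L₂(q) of degree q, and moreover: (1) χ_q vanishes on exactly 2/gcd(2,q) conjugacy classes, each of size |L₂(q)|/q; (2) if g ∈ L₂(q) with g ≠ 1 and χ_q(g) ≠ 0, then χ_q(g) = ±1. -/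
open scoped Classical

noncomputable section

open Matrix

/-- A point `x` of the projective line over `F` is fixed by the element
`g ∈ PSL₂(F)` under the natural action: every matrix `A ∈ SL₂(F)` representing `g`
maps a representative vector of `x` to a scalar multiple of itself. -/
def FixedPt {F : Type} [Field F] [Fintype F]
    (g : ProjectiveSpecialLinearGroup (Fin 2) F)
    (x : Projectivization F (Fin 2 → F)) : Prop :=
  ∀ A : SpecialLinearGroup (Fin 2) F, QuotientGroup.mk A = g →
    ∃ c : F, SpecialLinearGroup.toLin' A x.rep = c • x.rep

/-- The permutation character `π_q` of the natural action of `PSL₂(F)` on the points of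
the projective line over `F`: `π_q g` is the number of fixed points of `g`. -/
def permChar (F : Type) [Field F] [Fintype F] :
    ProjectiveSpecialLinearGroup (Fin 2) F → ℂ :=
  fun g => (Nat.card {x : Projectivization F (Fin 2 → F) | FixedPt g x} : ℂ)

/-- `χ_q = π_q - 1`. -/
def chiQ (F : Type) [Field F] [Fintype F] :
    ProjectiveSpecialLinearGroup (Fin 2) F → ℂ :=
  fun g => permChar F g - 1

/-- An endomorphism of finite order of a complex vector space has an eigenbasis whose eigenvalues
are roots of unity. -/
theorem exists_eigenbasis_of_pow_eq_one {V : Type*} [AddCommGroup V] [Module ℂ V]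
    [FiniteDimensional ℂ V] {f : Module.End ℂ V} {n : ℕ} (hn : n ≠ 0) (hf : f ^ n = 1) :
    ∃ (ι : Type) (_ : Fintype ι) (b : Module.Basis ι ℂ V) (μ : ι → ℂ),
      ∀ i, f (b i) = μ i • b i ∧ μ i ^ n = 1 := by
  have hs : f.IsSemisimple := by
    refine Module.End.isSemisimple_of_squarefree_aeval_eq_zero
      (p := (Polynomial.X ^ n - 1 : Polynomial ℂ)) ?_ (by simp [hf])
    exact (Polynomial.separable_X_pow_sub_C (1 : ℂ) (by exact_mod_cast hn) one_ne_zero).squarefree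
  have hd := DirectSum.isInternal_submodule_of_iSupIndep_of_iSup_eq_top
    f.eigenspaces_iSupIndep hs.iSup_eigenspace_eq_top
  let b := hd.collectedBasis fun μ => Module.finBasis ℂ (f.eigenspace μ)
  have hb (i) : f (b i) = i.1 • b i :=
    Module.End.mem_eigenspace_iff.mp (hd.collectedBasis_mem _ i)
  refine ⟨_, FiniteDimensional.fintypeBasisIndex b, b, Sigma.fst, fun i => ⟨hb i, ?_⟩⟩
  have hpow (k : ℕ) : (f ^ k) (b i) = i.1 ^ k • b i := by
    induction k with
    | zero => simp
    | succ k ih => rw [pow_succ', Module.End.mul_apply, ih, map_smul, hb, smul_smul, pow_succ]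
  have h := hpow n
  rw [hf, Module.End.one_apply] at h
  by_contra hne
  have h0 : (i.1 ^ n - 1) • b i = 0 := by rw [sub_smul, ← h, one_smul, sub_self]
  exact (smul_ne_zero (sub_ne_zero.mpr hne) (b.ne_zero i)) h0

theorem LinearMap.trace_eq_sum_of_apply_basis {ι V : Type*} [Fintype ι] [AddCommGroup V]
    [Module ℂ V] (b : Module.Basis ι ℂ V) {f : Module.End ℂ V} {μ : ι → ℂ}
    (hf : ∀ i, f (b i) = μ i • b i) : LinearMap.trace ℂ V f = ∑ i, μ i := by
  rw [LinearMap.trace_eq_matrix_trace ℂ b, Matrix.trace]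
  simp [LinearMap.toMatrix_apply, hf]

namespace FDRep

variable {G : Type} [Group G] [Fintype G] (V : FDRep ℂ G)

theorem rho_pow_card (g : G) : V.ρ g ^ Fintype.card G = 1 := by
  rw [← map_pow, pow_card_eq_one, map_one]

theorem isIntegral_character (g : G) : IsIntegral ℤ (V.character g) := by
  obtain ⟨ι, _, b, μ, h⟩ := exists_eigenbasis_of_pow_eq_one Fintype.card_ne_zero (V.rho_pow_card g)
  rw [character, LinearMap.trace_eq_sum_of_apply_basis b fun i => (h i).1]
  refine IsIntegral.sum _ fun i _ => ⟨Polynomial.X ^ Fintype.card G - 1, ?_, ?_⟩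
  · exact Polynomial.monic_X_pow_sub_C (1 : ℤ) Fintype.card_ne_zero
  · simp [(h i).2]

theorem character_inv (g : G) : V.character g⁻¹ = (starRingEnd ℂ) (V.character g) := by
  obtain ⟨ι, _, b, μ, h⟩ := exists_eigenbasis_of_pow_eq_one Fintype.card_ne_zero (V.rho_pow_card g)
  have hμ (i : ι) : μ i ≠ 0 := fun h0 => by
    simpa [h0, zero_pow Fintype.card_ne_zero] using (h i).2
  have hinv (i : ι) : V.ρ g⁻¹ (b i) = (μ i)⁻¹ • b i := by
    rw [← smul_right_inj (hμ i), smul_smul, mul_inv_cancel₀ (hμ i), one_smul, ← map_smul,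
      ← (h i).1, ← Module.End.mul_apply, ← map_mul, inv_mul_cancel, map_one, Module.End.one_apply]
  rw [character, character, LinearMap.trace_eq_sum_of_apply_basis b hinv,
    LinearMap.trace_eq_sum_of_apply_basis b fun i => (h i).1, map_sum]
  exact Finset.sum_congr rfl fun i _ => Complex.inv_eq_conj
    (Complex.norm_eq_one_of_pow_eq_one (h i).2 Fintype.card_ne_zero)

theorem sum_norm_sq_character (hV : CategoryTheory.Simple V) :
    ∑ g : G, ‖V.character g‖ ^ 2 = Fintype.card G := by
  have h := V.simple_iff_char_is_norm_one.mp hV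
  rw [Nat.card_eq_fintype_card] at h
  apply Complex.ofReal_injective
  push_cast
  rw [← h]
  refine Finset.sum_congr rfl fun g _ => ?_
  rw [character_inv, Complex.mul_conj, Complex.normSq_eq_norm_sq]
  push_cast
  rfl

end FDRep

/-- The average of the character of a representation over a finite group is the dimension of the
space of invariants. -/
theorem sum_trace_eq_card_mul_finrank_invariants {H V : Type*} [Group H] [Fintype H]
    [AddCommGroup V] [Module ℂ V] [FiniteDimensional ℂ V] (ρ : Representation ℂ H V) :
    ∑ h, LinearMap.trace ℂ V (ρ h) =
      Fintype.card H * Module.finrank ℂ (Representation.invariants ρ) := by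
  have := invertibleOfNonzero (NeZero.ne (Nat.card H : ℂ))
  rw [← ρ.card_inv_mul_sum_char_eq_finrank, ← Nat.card_eq_fintype_card,
    mul_inv_cancel_left₀ (NeZero.ne _)]
  rfl

section PermutationCharacter

variable (G X : Type) [Group G] [MulAction G X]

/-- The space of complex functions on `X` with zero sum. -/
def sumZero [Fintype X] : Submodule ℂ (X → ℂ) :=
  LinearMap.ker (∑ x, LinearMap.proj x : (X → ℂ) →ₗ[ℂ] ℂ)

variable {X} in
theorem mem_sumZero [Fintype X] {f : X → ℂ} : f ∈ sumZero X ↔ ∑ x, f x = 0 := by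
  simp [sumZero]

/-- The permutation representation on functions. -/
def permRep : Representation ℂ G (X → ℂ) where
  toFun g := LinearMap.funLeft ℂ ℂ (g⁻¹ • ·)
  map_one' := by ext; simp [LinearMap.funLeft]
  map_mul' g h := by
    ext f x
    simp [LinearMap.funLeft_apply, mul_smul]

variable {G X} in
theorem permRep_apply (g : G) (f : X → ℂ) (x : X) : permRep G X g f x = f (g⁻¹ • x) := rfl

variable {G X} in
theorem sum_permRep [Fintype X] (g : G) (f : X → ℂ) : ∑ x, permRep G X g f x = ∑ x, f x :=
  Equiv.sum_comp (MulAction.toPerm g⁻¹) f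

theorem trace_permRep [Fintype X] (g : G) :
    LinearMap.trace ℂ _ (permRep G X g) = Nat.card (MulAction.fixedBy X g) := by
  rw [LinearMap.trace_eq_matrix_trace ℂ (Pi.basisFun ℂ X), Matrix.trace]
  simp only [Matrix.diag_apply, LinearMap.toMatrix_apply, Pi.basisFun_apply, Pi.basisFun_repr,
    permRep_apply, Pi.single_apply, inv_smul_eq_iff, Finset.sum_boole]
  rw [Nat.card_eq_fintype_card, ← Set.toFinset_card]
  congr 2
  ext x
  simp [eq_comm]

/-- The restriction of the permutation representation to functions with zero sum. -/
def sumZeroRep [Fintype X] : Representation ℂ G (sumZero X) :=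
  Subrepresentation.toRepresentation ⟨sumZero X, fun g f hf => by
    rw [mem_sumZero] at hf ⊢
    rw [sum_permRep, hf]⟩

theorem trace_sumZeroRep [Fintype X] [Nonempty X] (g : G) :
    LinearMap.trace ℂ _ (sumZeroRep G X g) = Nat.card (MulAction.fixedBy X g) - 1 := by
  have hX : (Fintype.card X : ℂ) ≠ 0 := by exact_mod_cast Fintype.card_ne_zero
  let avg : Module.End ℂ (X → ℂ) :=
    LinearMap.pi fun _ => (Fintype.card X : ℂ)⁻¹ • ∑ x, LinearMap.proj x
  have havg (f : X → ℂ) (x : X) : avg f x = (Fintype.card X : ℂ)⁻¹ * ∑ y, f y := by simp [avg]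
  have htr : LinearMap.trace ℂ _ avg = 1 := by
    rw [LinearMap.trace_eq_matrix_trace ℂ (Pi.basisFun ℂ X), Matrix.trace]
    simp [havg, hX]
  have hmem (f : X → ℂ) : (permRep G X g - avg) f ∈ sumZero X := by
    rw [mem_sumZero]
    simp only [LinearMap.sub_apply, Pi.sub_apply, Finset.sum_sub_distrib, sum_permRep, havg,
      Finset.sum_const, Finset.card_univ, nsmul_eq_mul]
    rw [mul_inv_cancel_left₀ hX, sub_self]
  have hres : sumZeroRep G X g =
      (permRep G X g - avg).restrict fun f _ => hmem f := by
    ext f x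
    have h0 : avg f.1 x = 0 := by rw [havg, mem_sumZero.mp f.2, mul_zero]
    change permRep G X g f.1 x = permRep G X g f.1 x - avg f.1 x
    rw [h0, sub_zero]
  rw [hres, LinearMap.trace_restrict_eq_of_forall_mem _ _ hmem, map_sub, trace_permRep, htr]

variable {G X} in
theorem card_orbitRel_quotient_prod_of_two_pretransitive [Nontrivial X]
    (h2 : ∀ {a b c d : X}, a ≠ b → c ≠ d → ∃ g : G, g • a = c ∧ g • b = d) :
    Nat.card (MulAction.orbitRel.Quotient G (X × X)) = 2 := by
  obtain ⟨a, b, hab⟩ := exists_pair_ne X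
  rw [Nat.card_eq_two_iff]
  refine ⟨Quotient.mk'' (a, a), Quotient.mk'' (a, b), fun h => ?_, ?_⟩
  · rw [Quotient.eq'', MulAction.orbitRel_apply] at h
    obtain ⟨g, hg⟩ := h
    obtain ⟨h1, h3⟩ := Prod.ext_iff.mp hg
    exact hab (MulAction.injective g (h1.trans h3.symm))
  · ext z
    simp only [Set.mem_insert_iff, Set.mem_singleton_iff, Set.mem_univ, iff_true]
    induction z using Quotient.inductionOn' with
    | h z =>
      obtain ⟨x, y⟩ := z
      rcases eq_or_ne x y with rfl | hxy
      · left
        obtain ⟨c, hc⟩ := exists_ne a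
        obtain ⟨d, hd⟩ := exists_ne x
        obtain ⟨g, hg, -⟩ := h2 hc.symm hd.symm
        exact Quotient.sound' ⟨g, Prod.ext hg hg⟩
      · right
        obtain ⟨g, hg, hg'⟩ := h2 hab hxy
        exact Quotient.sound' ⟨g, Prod.ext hg hg'⟩

variable {G X} in
theorem isIrredChar_of_two_pretransitive [Fintype G] [Fintype X] [Nontrivial X]
    (h2 : ∀ {a b c d : X}, a ≠ b → c ≠ d → ∃ g : G, g • a = c ∧ g • b = d) :
    IsIrredChar fun g : G => (Nat.card (MulAction.fixedBy X g) : ℂ) - 1 := by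
  have hchar : (fun g : G => (Nat.card (MulAction.fixedBy X g) : ℂ) - 1) =
      (FDRep.of (sumZeroRep G X)).character :=
    funext fun g => (trace_sumZeroRep G X g).symm
  refine ⟨FDRep.of (sumZeroRep G X), ?_, hchar⟩
  rw [FDRep.simple_iff_char_is_norm_one, ← hchar]
  have hinv (g : G) : MulAction.fixedBy X g⁻¹ = MulAction.fixedBy X g := MulAction.fixedBy_inv ..
  have h1 := MulAction.sum_card_fixedBy_eq_card_orbits_mul_card_group G X
  have h2' := MulAction.sum_card_fixedBy_eq_card_orbits_mul_card_group G (X × X)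
  have hΩ : Fintype.card (MulAction.orbitRel.Quotient G X) = 1 := by
    have : MulAction.IsPretransitive G X := ⟨fun x y => by
      obtain ⟨c, hc⟩ := exists_ne x
      obtain ⟨d, hd⟩ := exists_ne y
      obtain ⟨g, hg, -⟩ := h2 hc.symm hd.symm
      exact ⟨g, hg⟩⟩
    have := (MulAction.pretransitive_iff_subsingleton_quotient G X).mp this
    have : Nonempty (MulAction.orbitRel.Quotient G X) := ⟨Quotient.mk'' (Classical.arbitrary X)⟩
    exact Nat.card_eq_fintype_card (α := MulAction.orbitRel.Quotient G X) ▸ Nat.card_unique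
  have hΩ2 : Fintype.card (MulAction.orbitRel.Quotient G (X × X)) = 2 := by
    rw [← Nat.card_eq_fintype_card, card_orbitRel_quotient_prod_of_two_pretransitive h2]
  rw [hΩ, one_mul] at h1
  rw [hΩ2] at h2'
  have hprod (g : G) : Fintype.card (MulAction.fixedBy (X × X) g) =
      Fintype.card (MulAction.fixedBy X g) ^ 2 := by
    rw [sq, ← Fintype.card_prod]
    refine Fintype.card_congr ⟨fun z => (⟨z.1.1, congrArg Prod.fst z.2⟩,
      ⟨z.1.2, congrArg Prod.snd z.2⟩), fun z => ⟨(z.1.1, z.2.1), Prod.ext z.1.2 z.2.2⟩,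
      fun _ => rfl, fun _ => rfl⟩
  simp only [hprod] at h2'
  have h1c : ∑ g : G, (Fintype.card (MulAction.fixedBy X g) : ℂ) = Fintype.card G := by
    exact_mod_cast h1
  have h2c : ∑ g : G, (Fintype.card (MulAction.fixedBy X g) : ℂ) ^ 2 = 2 * Fintype.card G := by
    exact_mod_cast h2'
  simp only [hinv, Nat.card_eq_fintype_card]
  calc _ = ∑ g : G, ((Fintype.card (MulAction.fixedBy X g) : ℂ) ^ 2 -
        2 * Fintype.card (MulAction.fixedBy X g) + 1) := Finset.sum_congr rfl fun _ _ => by ring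
    _ = (Fintype.card G : ℂ) := by
      rw [Finset.sum_add_distrib, Finset.sum_sub_distrib, ← Finset.mul_sum, h1c, h2c]
      simp

end PermutationCharacter


namespace FDRep

theorem eq_top_of_simple {G : Type} [Group G] {V : FDRep ℂ G} (hV : CategoryTheory.Simple V)
    {W : Submodule ℂ V} (hW : ∀ g, ∀ w ∈ W, V.ρ g w ∈ W) (hne : W ≠ ⊥) : W = ⊤ := by
  let σ : Representation ℂ G W := Subrepresentation.toRepresentation ⟨W, fun g w hw => hW g w hw⟩
  let i : FDRep.of σ ⟶ V :=
    ⟨CategoryTheory.InducedCategory.homMk (ModuleCat.ofHom W.subtype), fun g => rfl⟩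
  have hi : CategoryTheory.Mono i := CategoryTheory.ConcreteCategory.mono_of_injective i
    W.injective_subtype
  have h0 : i ≠ 0 := by
    intro h
    obtain ⟨w, hw, hw0⟩ := W.exists_mem_ne_zero_of_ne_bot hne
    apply hw0
    have := congrArg (fun j : FDRep.of σ ⟶ V => (CategoryTheory.ConcreteCategory.hom j) ⟨w, hw⟩) h
    exact this
  have hiso := CategoryTheory.isIso_of_mono_of_nonzero h0
  exact Submodule.eq_top_of_finrank_eq
    (FDRep.isoToLinearEquiv (CategoryTheory.asIso i)).finrank_eq

end FDRep

theorem FDRep.sum_card_fixedBy_mul_character {G : Type} [Group G] [Fintype G] (X : Type)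
    [Fintype X] [MulAction G X] (V : FDRep ℂ G) :
    ∑ g : G, (Nat.card (MulAction.fixedBy X g) : ℂ) * V.character g⁻¹ =
      (∑ x : X, Fintype.card (MulAction.stabilizer G x) * Module.finrank ℂ
        (Representation.invariants (V.ρ.comp (MulAction.stabilizer G x).subtype)) : ℕ) := by
  have hstab (x : X) : ∑ g : G, (if g • x = x then V.character g⁻¹ else 0) =
      Fintype.card (MulAction.stabilizer G x) * Module.finrank ℂ
        (Representation.invariants (V.ρ.comp (MulAction.stabilizer G x).subtype)) := by
    rw [← sum_trace_eq_card_mul_finrank_invariants, ← Finset.sum_filter,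
      ← Equiv.sum_comp (Equiv.inv (MulAction.stabilizer G x))]
    exact Finset.sum_subtype _ (fun g => by simp) fun g => V.character g⁻¹
  push_cast
  rw [← Finset.sum_congr rfl fun x _ => hstab x, Finset.sum_comm]
  refine Finset.sum_congr rfl fun g _ => ?_
  rw [← Finset.sum_filter, Finset.sum_const, nsmul_eq_mul, Nat.card_eq_fintype_card,
    Fintype.card_subtype]
  rfl

theorem FDRep.sum_character_eq_zero {G : Type} [Group G] [Fintype G] {V : FDRep ℂ G}
    (hV : CategoryTheory.Simple V) (h1 : V.character 1 ≠ 1) : ∑ g, V.character g = 0 := by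
  change ∑ g, LinearMap.trace ℂ V (V.ρ g) = 0
  rw [sum_trace_eq_card_mul_finrank_invariants]
  by_cases h : Representation.invariants V.ρ = ⊥
  · rw [h, finrank_bot, Nat.cast_zero, mul_zero]
  · obtain ⟨v, hv, hv0⟩ := Submodule.exists_mem_ne_zero_of_ne_bot h
    have htop : Submodule.span ℂ {v} = ⊤ := by
      refine FDRep.eq_top_of_simple hV (fun g w hw => ?_) (by simpa using hv0)
      obtain ⟨c, rfl⟩ := Submodule.mem_span_singleton.mp hw
      rw [map_smul, hv g]
      exact hw
    have hfin := finrank_span_singleton (K := ℂ) hv0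
    rw [htop, finrank_top] at hfin
    rw [V.char_one, hfin, Nat.cast_one] at h1
    exact absurd rfl h1

theorem FDRep.character_eq_of_two_pretransitive {G X : Type} [Group G] [Fintype G] [Fintype X]
    [Nontrivial X] [MulAction G X]
    (h2 : ∀ {a b c d : X}, a ≠ b → c ≠ d → ∃ g : G, g • a = c ∧ g • b = d)
    {V : FDRep ℂ G} (hV : CategoryTheory.Simple V) (h1 : V.character 1 ≠ 1) {x : X} {v : V}
    (hv : v ≠ 0) (hx : ∀ g : G, g • x = x → V.ρ g v = v) (g : G) :
    V.character g = Nat.card (MulAction.fixedBy X g) - 1 := by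
  obtain ⟨W, hW, hchar⟩ := isIrredChar_of_two_pretransitive h2
  have := invertibleOfNonzero (NeZero.ne (Nat.card G : ℂ))
  have horth := FDRep.char_orthonormal W V
  by_cases hiso : Nonempty (CategoryTheory.Iso W V)
  · exact (congrFun (hchar.trans (FDRep.char_iso hiso.some)) g).symm
  · rw [if_neg hiso, mul_eq_zero_iff_left (inv_ne_zero (NeZero.ne _)), ← hchar] at horth
    have hsum : ∑ g : G, V.character g⁻¹ = 0 :=
      (Equiv.sum_comp (Equiv.inv G) V.character).trans (FDRep.sum_character_eq_zero hV h1)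
    simp only [sub_mul, one_mul, Finset.sum_sub_distrib, hsum, sub_zero] at horth
    rw [FDRep.sum_card_fixedBy_mul_character, Nat.cast_eq_zero, Finset.sum_eq_zero_iff] at horth
    have hinv := (mul_eq_zero.mp (horth x (Finset.mem_univ x))).resolve_left Fintype.card_ne_zero
    rw [Submodule.finrank_eq_zero] at hinv
    refine absurd ((Submodule.eq_bot_iff _).mp hinv v fun h => ?_) hv
    exact hx h h.2

open scoped MatrixGroups

namespace PSLTwo

variable {F : Type} [Field F]

/-- The `2 × 2` matrix with the given entries and determinant one. -/
def slMatrix (a b c d : F) (h : a * d - b * c = 1) : SL(2, F) :=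
  ⟨!![a, b; c, d], by rw [Matrix.det_fin_two_of, h]⟩

/-- The class in `PSL₂(F)` of a `2 × 2` matrix of determinant one. -/
def ofMatrix (a b c d : F) (h : a * d - b * c = 1) : PSL(2, F) :=
  QuotientGroup.mk (slMatrix a b c d h)

theorem exists_eq_ofMatrix (g : PSL(2, F)) : ∃ a b c d h, g = ofMatrix (F := F) a b c d h := by
  obtain ⟨A, rfl⟩ := QuotientGroup.mk_surjective g
  refine ⟨A.1 0 0, A.1 0 1, A.1 1 0, A.1 1 1, ?_, congrArg _ (Subtype.ext ?_)⟩
  · rw [← Matrix.det_fin_two, A.2]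
  · exact Matrix.eta_fin_two _

theorem ofMatrix_congr {a b c d a' b' c' d' : F} {h h'} (ha : a = a') (hb : b = b') (hc : c = c')
    (hd : d = d') : ofMatrix a b c d h = ofMatrix a' b' c' d' h' := by
  subst ha hb hc hd
  rfl

theorem ofMatrix_mul {a b c d a' b' c' d' : F} (h h') :
    ofMatrix a b c d h * ofMatrix a' b' c' d' h' =
      ofMatrix (a * a' + b * c') (a * b' + b * d') (c * a' + d * c') (c * b' + d * d')
        (by linear_combination (a' * d' - b' * c') * h + h') := by
  refine (QuotientGroup.mk_mul _ _ _).symm.trans (congrArg QuotientGroup.mk (Subtype.ext ?_))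
  exact Matrix.mul_fin_two ..

theorem ofMatrix_one {h} : ofMatrix (1 : F) 0 0 1 h = 1 := by
  refine congrArg QuotientGroup.mk (Subtype.ext ?_)
  exact Matrix.one_fin_two.symm

theorem ofMatrix_eq_iff {a b c d a' b' c' d' : F} {h h'} :
    ofMatrix a b c d h = ofMatrix a' b' c' d' h' ↔
      ∃ ε : F, ε ^ 2 = 1 ∧ a' = ε * a ∧ b' = ε * b ∧ c' = ε * c ∧ d' = ε * d := by
  rw [ofMatrix, ofMatrix, QuotientGroup.eq, Matrix.SpecialLinearGroup.mem_center_iff]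
  simp only [Fintype.card_fin]
  refine exists_congr fun ε => and_congr_right fun _ => ?_
  rw [Matrix.SpecialLinearGroup.coe_mul, Matrix.SpecialLinearGroup.coe_inv, Matrix.adjugate_fin_two]
  simp only [slMatrix, ← Matrix.ext_iff, Fin.forall_fin_two, Matrix.scalar_apply,
    Matrix.diagonal_apply, Matrix.mul_apply, Fin.sum_univ_two]
  simp
  constructor
  · rintro ⟨⟨h1, h2⟩, h3, h4⟩
    refine ⟨?_, ?_, ?_, ?_⟩
    · linear_combination -a' * h - a * h1 - b * h3
    · linear_combination -b' * h - a * h2 - b * h4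
    · linear_combination -c' * h - c * h1 - d * h3
    · linear_combination -d' * h - c * h2 - d * h4
  · rintro ⟨rfl, rfl, rfl, rfl⟩
    refine ⟨⟨?_, ?_⟩, ?_, ?_⟩
    · linear_combination -ε * h
    · ring
    · ring
    · linear_combination -ε * h

theorem ofMatrix_smul_mk {a b c d : F} (h) (v : Fin 2 → F) (hv : v ≠ 0) :
    ∃ hv', ofMatrix a b c d h • Projectivization.mk F v hv =
      Projectivization.mk F ![a * v 0 + b * v 1, c * v 0 + d * v 1] hv' := by
  have hmul : !![a, b; c, d] *ᵥ v = ![a * v 0 + b * v 1, c * v 0 + d * v 1] := by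
    ext i
    fin_cases i <;> simp [Matrix.mulVec, dotProduct, Fin.sum_univ_two]
  rw [← hmul]
  exact ⟨_, rfl⟩

theorem fixedPt_iff [Fintype F] (g : PSL(2, F)) (x : Projectivization F (Fin 2 → F)) :
    FixedPt g x ↔ g • x = x := by
  have key (A : SpecialLinearGroup (Fin 2) F) :
      (∃ c : F, SpecialLinearGroup.toLin' A x.rep = c • x.rep) ↔ A • x = x := by
    conv_rhs => rw [← x.mk_rep, Projectivization.smul_mk]
    rw [Projectivization.mk_eq_mk_iff']
    exact exists_congr fun c => eq_comm
  obtain ⟨A, rfl⟩ := QuotientGroup.mk_surjective g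
  refine ⟨fun h => (key A).mp (h A rfl), fun h B hB => (key B).mpr ?_⟩
  rw [← hB] at h
  exact h

theorem chiQ_eq [Fintype F] (g : PSL(2, F)) :
    chiQ F g = Nat.card (MulAction.fixedBy (Projectivization F (Fin 2 → F)) g) - 1 := by
  rw [chiQ, permChar]
  congr 3
  exact congrArg _ (Set.ext fun x => fixedPt_iff g x)

theorem exists_smul_eq_and_smul_eq {x y x' y' : Projectivization F (Fin 2 → F)} (hxy : x ≠ y)
    (hxy' : x' ≠ y') : ∃ g : PSL(2, F), g • x = x' ∧ g • y = y' := by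
  obtain ⟨A, hA⟩ := (MulAction.is_two_pretransitive_iff (G := SpecialLinearGroup (Fin 2) F)).mp
    inferInstance hxy hxy'
  exact ⟨QuotientGroup.mk A, hA⟩

/-- The parametrisation of the projective line by `F` and a point at infinity. -/
def point : Option F → Projectivization F (Fin 2 → F)
  | none => Projectivization.mk F ![1, 0] (by simp)
  | some z => Projectivization.mk F ![z, 1] (by simp)

theorem point_bijective : Function.Bijective (point (F := F)) := by
  refine ⟨?_, fun x => ?_⟩
  · rintro (_ | z) (_ | z') h <;>
      simp only [point, Projectivization.mk_eq_mk_iff', funext_iff, Fin.forall_fin_two] at h <;>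
      simp_all
  · induction x using Projectivization.ind with
    | h v hv =>
      by_cases h1 : v 1 = 0
      · refine ⟨none, ?_⟩
        have h0 : v 0 ≠ 0 := fun h0 => hv (funext fun i => by fin_cases i <;> simp [h0, h1])
        rw [point, Projectivization.mk_eq_mk_iff']
        exact ⟨(v 0)⁻¹, funext fun i => by fin_cases i <;> simp [h0, h1]⟩
      · refine ⟨some (v 0 / v 1), ?_⟩
        rw [point, Projectivization.mk_eq_mk_iff']
        exact ⟨(v 1)⁻¹, funext fun i => by fin_cases i <;> simp [h1, div_eq_inv_mul]⟩

theorem ofMatrix_smul_point_none {a b c d : F} {h} :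
    ofMatrix a b c d h • point (F := F) none = point none ↔ c = 0 := by
  obtain ⟨hv, e⟩ := ofMatrix_smul_mk h ![1, 0] (by simp)
  rw [point, e, Projectivization.mk_eq_mk_iff']
  simp only [funext_iff, Fin.forall_fin_two]
  simp [eq_comm]

theorem ofMatrix_smul_point_some {a b d z : F} {h} :
    ofMatrix a b 0 d h • point (some z) = point (some z) ↔ a * z + b = d * z := by
  obtain ⟨hv, e⟩ := ofMatrix_smul_mk h ![z, 1] (by simp)
  rw [point, e, Projectivization.mk_eq_mk_iff']
  simp only [funext_iff, Fin.forall_fin_two]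
  simp [eq_comm]

instance : Nontrivial (Projectivization F (Fin 2 → F)) :=
  ⟨⟨point (F := F) none, point (some 0), fun h => by simpa using point_bijective.1 h⟩⟩

theorem card_projectiveLine [Fintype F] :
    Nat.card (Projectivization F (Fin 2 → F)) = Fintype.card F + 1 := by
  rw [← Nat.card_congr (Equiv.ofBijective _ (point_bijective (F := F))), Nat.card_eq_fintype_card,
    Fintype.card_option]

/-- The image of an upper unitriangular matrix. -/
def unip (x : F) : PSL(2, F) := ofMatrix 1 x 0 1 (by ring)

theorem unip_add (x y : F) : unip (x + y) = unip x * unip y := by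
  rw [unip, unip, unip, ofMatrix_mul]
  exact ofMatrix_congr (by ring) (by ring) (by ring) (by ring)

theorem unip_zero : unip (0 : F) = 1 := ofMatrix_one

theorem unip_injective : Function.Injective (unip (F := F)) := by
  intro x y h
  obtain ⟨ε, -, h1, h2, -, -⟩ := ofMatrix_eq_iff.mp h
  rw [h2, ← mul_one ε, ← h1, one_mul]

/-- The image of a diagonal matrix. -/
def diag (a : Fˣ) : PSL(2, F) := ofMatrix a 0 0 (a⁻¹ : Fˣ) (by simp)

theorem diag_one : diag (1 : Fˣ) = 1 := by
  rw [diag, ← ofMatrix_one (F := F) (h := by ring)]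
  exact ofMatrix_congr rfl rfl rfl (by simp)

theorem diag_mul_unip (a : Fˣ) (x : F) : diag a * unip x = unip (a ^ 2 * x) * diag a := by
  rw [diag, unip, unip, ofMatrix_mul, ofMatrix_mul]
  refine ofMatrix_congr (by ring) ?_ (by ring) (by ring)
  simp only [Units.val_inv_eq_inv_val]
  field_simp
  ring

/-- The image of the standard Weyl element. -/
def weyl : PSL(2, F) := ofMatrix 0 1 (-1) 0 (by ring)

theorem weyl_mul_weyl : weyl * weyl = (1 : PSL(2, F)) := by
  rw [weyl, ofMatrix_mul, ← ofMatrix_one (h := by ring), ofMatrix_eq_iff]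
  exact ⟨-1, by ring, by ring, by ring, by ring, by ring⟩

theorem ofMatrix_zero_eq {a b d : F} (h) :
    ∃ (t : Fˣ) (x : F), (t : F) = a ∧ ofMatrix a b 0 d h = diag t * unip x := by
  have ha : a * d = 1 := by linear_combination h
  have ha0 : a ≠ 0 := left_ne_zero_of_mul_eq_one ha
  refine ⟨Units.mk0 a ha0, b / a, rfl, ?_⟩
  rw [diag, unip, ofMatrix_mul]
  refine ofMatrix_congr (by simp) ?_ (by simp) ?_
  · simp [mul_div_cancel₀ _ ha0]
  · simpa using eq_inv_of_mul_eq_one_right ha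

/-- The Bruhat decomposition of `PSL₂(F)`. -/
theorem bruhat (g : PSL(2, F)) :
    (∃ (t : Fˣ) (x : F), g = diag t * unip x) ∨
      ∃ (y : F) (t : Fˣ) (x : F), g = unip y * weyl * (diag t * unip x) := by
  obtain ⟨a, b, c, d, h, rfl⟩ := exists_eq_ofMatrix g
  by_cases hc : c = 0
  · subst hc
    obtain ⟨t, x, -, e⟩ := ofMatrix_zero_eq h
    exact Or.inl ⟨t, x, e⟩
  · obtain ⟨t, x, -, e⟩ := ofMatrix_zero_eq (a := -c) (b := -d) (d := -c⁻¹) (by field_simp; ring)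
    refine Or.inr ⟨a / c, t, x, ?_⟩
    rw [← e, unip, weyl, ofMatrix_mul, ofMatrix_mul]
    refine ofMatrix_congr ?_ ?_ ?_ ?_
    · field_simp
      ring
    · field_simp
      linear_combination -c * h
    · ring
    · ring

theorem weyl_mul_unip_mul_weyl (t : Fˣ) :
    ∃ x : F, weyl * (unip (t : F) * weyl) =
      unip (-((t⁻¹ : Fˣ) : F)) * weyl * (diag t * unip x) := by
  refine ⟨-((t⁻¹ : Fˣ) : F), ?_⟩
  simp only [weyl, unip, diag, ofMatrix_mul]
  rw [ofMatrix_eq_iff]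
  refine ⟨-1, by ring, ?_, ?_, ?_, ?_⟩ <;> simp


section FixedPoints

theorem card_fixedBy_eq_ncard (g : PSL(2, F)) :
    Nat.card (MulAction.fixedBy (Projectivization F (Fin 2 → F)) g) =
      {o : Option F | g • point o = point o}.ncard :=
  (Nat.card_congr ((Equiv.ofBijective _ point_bijective).subtypeEquiv fun _ => Iff.rfl)).symm

theorem card_fixedBy_conj (g h : PSL(2, F)) :
    Nat.card (MulAction.fixedBy (Projectivization F (Fin 2 → F)) (h * g * h⁻¹)) =
      Nat.card (MulAction.fixedBy (Projectivization F (Fin 2 → F)) g) := by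
  rw [← MulAction.smul_fixedBy, Nat.card_coe_set_eq, Nat.card_coe_set_eq, Set.ncard_smul_set]

theorem card_fixedBy_unip {b : F} (hb : b ≠ 0) :
    Nat.card (MulAction.fixedBy (Projectivization F (Fin 2 → F)) (unip b)) = 1 := by
  rw [card_fixedBy_eq_ncard, Set.ncard_eq_one]
  refine ⟨none, Set.ext fun o => ?_⟩
  rw [Set.mem_ofPred_eq, unip]
  cases o with
  | none => simp [ofMatrix_smul_point_none]
  | some z => simp [ofMatrix_smul_point_some, hb]

theorem eq_one_or_unip_or_card_fixedBy_eq_two {g : PSL(2, F)}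
    (hg : g • point (F := F) none = point none) :
    g = 1 ∨ (∃ b ≠ 0, g = unip b) ∨
      Nat.card (MulAction.fixedBy (Projectivization F (Fin 2 → F)) g) = 2 := by
  obtain ⟨a, b, c, d, h, rfl⟩ := exists_eq_ofMatrix g
  obtain rfl := ofMatrix_smul_point_none.mp hg
  by_cases had : d = a
  · subst had
    have hu : ofMatrix d b 0 d h = unip (b * d) := by
      rw [unip, ofMatrix_eq_iff]
      exact ⟨d, by linear_combination h, by linear_combination -h, by ring, by ring,
        by linear_combination -h⟩
    rw [hu]
    by_cases hb : b * d = 0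
    · exact Or.inl (by rw [hb, unip_zero])
    · exact Or.inr (Or.inl ⟨_, hb, rfl⟩)
  · right
    right
    have hda : d - a ≠ 0 := sub_ne_zero.mpr had
    rw [card_fixedBy_eq_ncard, Set.ncard_eq_two]
    refine ⟨none, some (b / (d - a)), by simp, Set.ext fun o => ?_⟩
    rw [Set.mem_ofPred_eq]
    cases o with
    | none => simp [ofMatrix_smul_point_none]
    | some z =>
      rw [ofMatrix_smul_point_some]
      simp only [Set.mem_insert_iff, reduceCtorEq, Set.mem_singleton_iff, Option.some.injEq,
        false_or]
      rw [eq_div_iff hda]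
      constructor <;> intro hz <;> linear_combination -hz

theorem eq_one_or_isConj_unip_or_card_fixedBy (g : PSL(2, F)) :
    g = 1 ∨ (∃ b ≠ 0, IsConj (unip b) g) ∨
      Nat.card (MulAction.fixedBy (Projectivization F (Fin 2 → F)) g) = 0 ∨
      Nat.card (MulAction.fixedBy (Projectivization F (Fin 2 → F)) g) = 2 := by
  rcases (MulAction.fixedBy (Projectivization F (Fin 2 → F)) g).eq_empty_or_nonempty
    with h0 | ⟨x, hx⟩
  · right; right; left
    simp [h0]
  · obtain ⟨y, hy⟩ := exists_ne x
    obtain ⟨z, hz⟩ := exists_ne (point (F := F) none)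
    obtain ⟨k, hk, -⟩ := exists_smul_eq_and_smul_eq hy.symm hz.symm
    have hfix : (k * g * k⁻¹) • point (F := F) none = point none := by
      rw [← hk, mul_smul, mul_smul, inv_smul_smul, MulAction.mem_fixedBy.mp hx]
    rcases eq_one_or_unip_or_card_fixedBy_eq_two hfix with h | ⟨b, hb, h⟩ | h
    · exact Or.inl (conj_eq_one_iff.mp h)
    · exact Or.inr (Or.inl ⟨b, hb, (isConj_iff.mpr ⟨k, h⟩).symm⟩)
    · exact Or.inr (Or.inr (Or.inr (by rwa [card_fixedBy_conj] at h)))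

variable [Fintype F]

theorem chiQ_one : chiQ F 1 = Fintype.card F := by
  rw [chiQ_eq, MulAction.fixedBy_one_eq_univ, Nat.card_univ, card_projectiveLine]
  simp

theorem isIrredChar_chiQ : IsIrredChar (chiQ F) := by
  have := Fintype.ofFinite (Projectivization F (Fin 2 → F))
  rw [funext chiQ_eq]
  exact isIrredChar_of_two_pretransitive exists_smul_eq_and_smul_eq

theorem chiQ_eq_zero_iff {g : PSL(2, F)} : chiQ F g = 0 ↔ ∃ b ≠ 0, IsConj (unip b) g := by
  refine ⟨fun h => ?_, ?_⟩
  · rcases eq_one_or_isConj_unip_or_card_fixedBy g with rfl | h' | h' | h'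
    · rw [chiQ_one] at h
      exact absurd h (by exact_mod_cast Fintype.card_ne_zero)
    · exact h'
    · rw [chiQ_eq, h'] at h
      norm_num at h
    · rw [chiQ_eq, h'] at h
      norm_num at h
  · rintro ⟨b, hb, h⟩
    obtain ⟨k, rfl⟩ := isConj_iff.mp h
    rw [chiQ_eq, card_fixedBy_conj, card_fixedBy_unip hb]
    norm_num

theorem chiQ_eq_one_or_neg_one {g : PSL(2, F)} (hg : g ≠ 1) (h : chiQ F g ≠ 0) :
    chiQ F g = 1 ∨ chiQ F g = -1 := by
  rcases eq_one_or_isConj_unip_or_card_fixedBy g with h' | h' | h' | h'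
  · exact absurd h' hg
  · exact absurd (chiQ_eq_zero_iff.mpr h') h
  · right
    rw [chiQ_eq, h']
    norm_num
  · left
    rw [chiQ_eq, h']
    norm_num

end FixedPoints

section UnipotentClasses

theorem ofMatrix_mul_unip_eq_iff {a b c d x y : F} {h} (hx : x ≠ 0) :
    ofMatrix a b c d h * unip x = unip y * ofMatrix a b c d h ↔ c = 0 ∧ y = a ^ 2 * x := by
  rw [unip, unip, ofMatrix_mul, ofMatrix_mul, ofMatrix_eq_iff]
  refine ⟨?_, ?_⟩
  · rintro ⟨ε, hε, h1, h2, h3, h4⟩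
    have hc : c = 0 := by
      by_contra hc
      have he : ε = 1 := mul_right_cancel₀ hc (by linear_combination -h3)
      subst he
      have : c * x = 0 := by linear_combination -h4
      exact (mul_ne_zero hc hx) this
    subst hc
    have ha : a ≠ 0 := by
      rintro rfl
      simp at h
    have he : ε = 1 := mul_right_cancel₀ ha (by linear_combination -h1)
    subst he
    exact ⟨rfl, by linear_combination a * h2 - y * h⟩
  · rintro ⟨rfl, rfl⟩
    refine ⟨1, by ring, by ring, ?_, by ring, by ring⟩
    linear_combination a * x * h

theorem isConj_unip_iff {x y : F} (hx : x ≠ 0) :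
    IsConj (unip x) (unip y) ↔ ∃ a : Fˣ, y = a ^ 2 * x := by
  rw [isConj_iff]
  constructor
  · rintro ⟨g, hg⟩
    obtain ⟨a, b, c, d, h, rfl⟩ := exists_eq_ofMatrix g
    obtain ⟨rfl, hy⟩ := (ofMatrix_mul_unip_eq_iff hx).mp (mul_inv_eq_iff_eq_mul.mp hg)
    have ha : a ≠ 0 := by
      rintro rfl
      simp at h
    exact ⟨Units.mk0 a ha, hy⟩
  · rintro ⟨a, rfl⟩
    exact ⟨diag a, mul_inv_eq_iff_eq_mul.mpr (diag_mul_unip a x)⟩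

variable [Fintype F]

theorem card_centralizer_unip {x : F} (hx : x ≠ 0) :
    Nat.card (Subgroup.centralizer {(unip x : PSL(2, F))}) = Fintype.card F := by
  have : ((Subgroup.centralizer {(unip x : PSL(2, F))} : Subgroup _) : Set PSL(2, F)) =
      Set.range unip := by
    ext g
    rw [SetLike.mem_coe, Subgroup.mem_centralizer_singleton_iff, Set.mem_range]
    constructor
    · intro hg
      obtain ⟨a, b, c, d, h, rfl⟩ := exists_eq_ofMatrix g
      obtain ⟨rfl, ha⟩ := (ofMatrix_mul_unip_eq_iff hx).mp hg
      have ha' : a ^ 2 = 1 := mul_right_cancel₀ hx (by linear_combination -ha)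
      refine ⟨a * b, ?_⟩
      rw [unip, ofMatrix_eq_iff]
      exact ⟨a, ha', by ring, by linear_combination -b * ha', by ring,
        by linear_combination -d * ha' + a * h⟩
    · rintro ⟨y, rfl⟩
      rw [← unip_add, ← unip_add, add_comm]
  rw [← SetLike.coe_sort_coe, this, Nat.card_range_of_injective unip_injective,
    Nat.card_eq_fintype_card]

theorem card_carrier_unip_mul_card {x : F} (hx : x ≠ 0) :
    Nat.card (ConjClasses.mk (unip x : PSL(2, F))).carrier * Fintype.card F =
      Nat.card PSL(2, F) := by
  rw [← card_centralizer_unip hx, Subgroup.nat_card_centralizer_nat_card_stabilizer,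
    ← ConjAct.orbit_eq_carrier_conjClasses]
  simp only [Nat.card_eq_fintype_card]
  exact MulAction.card_orbit_mul_card_stabilizer_eq_card_group (ConjAct PSL(2, F)) (unip x)

theorem mem_chiQ_zero_classes_iff (C : ConjClasses PSL(2, F)) :
    (∀ g ∈ C.carrier, chiQ F g = 0) ↔ ∃ x ≠ 0, C = ConjClasses.mk (unip x) := by
  induction C using Quotient.inductionOn' with
  | h g =>
    change (∀ k ∈ (ConjClasses.mk g).carrier, _) ↔ ∃ x ≠ 0, ConjClasses.mk g = _
    simp only [ConjClasses.mk_eq_mk_iff_isConj]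
    constructor
    · intro h
      obtain ⟨b, hb, hbg⟩ := chiQ_eq_zero_iff.mp (h g ConjClasses.mem_carrier_mk)
      exact ⟨b, hb, hbg.symm⟩
    · rintro ⟨b, hb, hbg⟩ k hk
      rw [ConjClasses.mem_carrier_iff_mk_eq, ConjClasses.mk_eq_mk_iff_isConj] at hk
      exact chiQ_eq_zero_iff.mpr ⟨b, hb, (hk.trans hbg).symm⟩

theorem exists_eq_sq_of_char_two (hF : ringChar F = 2) {x : F} (hx : x ≠ 0) :
    ∃ a : Fˣ, x = a ^ 2 := by
  obtain ⟨a, rfl⟩ := FiniteField.isSquare_of_char_two hF x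
  exact ⟨Units.mk0 a (left_ne_zero_of_mul hx), (sq a).symm⟩

theorem exists_nonsquare_dichotomy (hF : ringChar F ≠ 2) :
    ∃ ε : F, ε ≠ 0 ∧ (¬ ∃ a : Fˣ, ε = a ^ 2) ∧
      ∀ x : F, x ≠ 0 → ∃ a : Fˣ, x = a ^ 2 ∨ x = a ^ 2 * ε ∧ ∃ b : Fˣ, ε * x = b ^ 2 := by
  obtain ⟨ε, hε⟩ := FiniteField.exists_nonsquare hF
  have h0 : ε ≠ 0 := fun h => hε (h ▸ IsSquare.zero)
  refine ⟨ε, h0, fun ⟨a, ha⟩ => hε ⟨a, by rw [ha, sq]⟩, fun x hx => ?_⟩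
  by_cases hxs : IsSquare x
  · obtain ⟨a, rfl⟩ := hxs
    exact ⟨Units.mk0 a (left_ne_zero_of_mul hx), Or.inl (sq a).symm⟩
  · have hs : IsSquare (ε * x) := by
      rw [← quadraticChar_one_iff_isSquare (mul_ne_zero h0 hx), map_mul,
        quadraticChar_neg_one_iff_not_isSquare.mpr hε,
        quadraticChar_neg_one_iff_not_isSquare.mpr hxs]
      rfl
    obtain ⟨b, hb⟩ := hs
    have hb0 : b ≠ 0 := left_ne_zero_of_mul (hb ▸ mul_ne_zero h0 hx)
    refine ⟨Units.mk0 (b / ε) (div_ne_zero hb0 h0), Or.inr ⟨?_, Units.mk0 b hb0, ?_⟩⟩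
    · rw [Units.val_mk0]
      field_simp
      linear_combination hb
    · rw [Units.val_mk0, hb, sq]

theorem card_chiQ_zero_classes :
    Nat.card {C : ConjClasses PSL(2, F) | ∀ g ∈ C.carrier, chiQ F g = 0} =
      2 / Nat.gcd 2 (Fintype.card F) := by
  simp only [mem_chiQ_zero_classes_iff, Nat.card_coe_set_eq]
  by_cases hF : ringChar F = 2
  · rw [Nat.gcd_eq_left (Nat.dvd_of_mod_eq_zero (FiniteField.even_card_of_char_two hF)),
      Set.ncard_eq_one.mpr ⟨ConjClasses.mk (unip 1), Set.ext fun C => ?_⟩]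
    rw [Set.mem_ofPred_eq, Set.mem_singleton_iff]
    refine ⟨?_, fun h => ⟨1, one_ne_zero, h⟩⟩
    rintro ⟨x, hx, rfl⟩
    obtain ⟨a, rfl⟩ := exists_eq_sq_of_char_two hF hx
    rw [eq_comm, ConjClasses.mk_eq_mk_iff_isConj, isConj_unip_iff one_ne_zero]
    exact ⟨a, (mul_one _).symm⟩
  · have hodd := FiniteField.odd_card_of_char_ne_two hF
    rw [(Nat.coprime_two_left.mpr (Nat.odd_iff.mpr hodd)).gcd_eq_one]
    obtain ⟨ε, h0, hε, hdich⟩ := exists_nonsquare_dichotomy hF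
    rw [Set.ncard_eq_two.mpr ⟨ConjClasses.mk (unip 1), ConjClasses.mk (unip ε), ?_,
      Set.ext fun C => ?_⟩]
    · rw [Ne, ConjClasses.mk_eq_mk_iff_isConj, isConj_unip_iff one_ne_zero]
      simpa using hε
    · rw [Set.mem_ofPred_eq, Set.mem_insert_iff, Set.mem_singleton_iff]
      constructor
      · rintro ⟨x, hx, rfl⟩
        obtain ⟨a, h⟩ := hdich x hx
        simp only [eq_comm (a := ConjClasses.mk (unip x)), ConjClasses.mk_eq_mk_iff_isConj,
          isConj_unip_iff one_ne_zero, isConj_unip_iff h0]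
        exact h.imp (fun h => ⟨a, by rw [mul_one, h]⟩) fun h => ⟨a, h.1⟩
      · rintro (rfl | rfl)
        exacts [⟨1, one_ne_zero, rfl⟩, ⟨ε, h0, rfl⟩]

end UnipotentClasses

section Uniqueness

variable {V : FDRep ℂ PSL(2, F)}

/-- The parametrisation of the unipotent subgroup as a group homomorphism. -/
def unipHom : Multiplicative F →* PSL(2, F) where
  toFun x := unip x.toAdd
  map_one' := unip_zero
  map_mul' x y := unip_add x.toAdd y.toAdd

theorem sum_character_unip [Fintype F] (V : FDRep ℂ PSL(2, F)) :
    ∑ x : F, V.character (unip x) = Fintype.card F *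
      Module.finrank ℂ (Representation.invariants (V.ρ.comp unipHom)) := by
  rw [Fintype.card_congr (Multiplicative.ofAdd (α := F)),
    ← sum_trace_eq_card_mul_finrank_invariants]
  exact (Equiv.sum_comp (Multiplicative.ofAdd (α := F))
    fun x => LinearMap.trace ℂ V (V.ρ (unip x.toAdd)))

theorem character_eq_of_isConj {g h : PSL(2, F)} (hgh : IsConj g h) :
    V.character g = V.character h := by
  obtain ⟨k, rfl⟩ := isConj_iff.mp hgh
  rw [V.char_conj]

theorem character_unip_sq_mul (a : Fˣ) (x : F) :
    V.character (unip (a ^ 2 * x)) = V.character (unip x) := by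
  rw [eq_mul_inv_of_mul_eq (diag_mul_unip a x).symm, V.char_conj]

variable [Fintype F]

theorem sum_norm_sq_character_unip_lt (hV : CategoryTheory.Simple V) (h1 : V.character 1 ≠ 0)
    {S : Finset F} (h0 : 0 ∉ S)
    (hS : ∀ x ∈ S, ∀ y ∈ S, IsConj (unip x) (unip y) → x = y) :
    ∑ x ∈ S, ‖V.character (unip x)‖ ^ 2 < Fintype.card F := by
  have hne {x : F} (hx : x ∈ S) : x ≠ 0 := fun h => h0 (h ▸ hx)
  let T (x : F) : Finset PSL(2, F) := Finset.univ.filter fun g => IsConj (unip x) g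
  have hT {x : F} (hx : x ∈ S) : (T x).card * Fintype.card F = Fintype.card PSL(2, F) := by
    have hcoe : (T x : Set PSL(2, F)) = (ConjClasses.mk (unip x)).carrier := by
      ext g
      rw [ConjClasses.mem_carrier_iff_mk_eq, ConjClasses.mk_eq_mk_iff_isConj, isConj_comm]
      exact Finset.mem_filter_univ g
    rw [← Nat.card_eq_fintype_card (α := PSL(2, F)), ← card_carrier_unip_mul_card (hne hx),
      Nat.card_coe_set_eq, ← hcoe, Set.ncard_coe_finset]
  have hsum : ∑ x ∈ S, ∑ g ∈ T x, ‖V.character g‖ ^ 2 < Fintype.card PSL(2, F) := by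
    rw [← FDRep.sum_norm_sq_character V hV, ← Finset.sum_biUnion]
    · refine Finset.sum_lt_sum_of_subset (Finset.subset_univ _) (Finset.mem_univ 1) ?_
        (by positivity) fun _ _ _ => by positivity
      simp only [Finset.mem_biUnion, T, Finset.mem_filter_univ, not_exists, not_and,
        isConj_one_left]
      exact fun x hx h => hne hx (unip_injective (h.trans unip_zero.symm))
    · intro x hx y hy hxy
      refine Finset.disjoint_left.mpr fun g hgx hgy => hxy (hS x hx y hy ?_)
      exact (Finset.mem_filter_univ _ |>.mp hgx).trans (Finset.mem_filter_univ _ |>.mp hgy).symm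
  have hcard : (0 : ℝ) < Fintype.card PSL(2, F) := by exact_mod_cast Fintype.card_pos
  have hconst {x : F} (hx : x ∈ S) : (∑ g ∈ T x, ‖V.character g‖ ^ 2) * Fintype.card F =
      Fintype.card PSL(2, F) * ‖V.character (unip x)‖ ^ 2 := by
    rw [Finset.sum_congr rfl fun g hg => by
      rw [← character_eq_of_isConj (Finset.mem_filter_univ _ |>.mp hg)], Finset.sum_const,
      nsmul_eq_mul, ← hT hx]
    push_cast
    ring
  have hq : (0 : ℝ) < Fintype.card F := by exact_mod_cast Fintype.card_pos
  refine lt_of_mul_lt_mul_left ?_ hcard.le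
  rw [Finset.mul_sum, ← Finset.sum_congr rfl fun x hx => hconst hx, ← Finset.sum_mul]
  exact mul_lt_mul_of_pos_right hsum hq

/-- An algebraic integer `s` of absolute value less than `q` such that `(q - 1) * s` is an integral
multiple of `q` vanishes. -/
theorem eq_zero_of_isIntegral_of_norm_lt {s : ℂ} (hs : IsIntegral ℤ s) {q : ℕ} (hq : 1 < q)
    {n : ℤ} (h : (q - 1) * s = q * n) (hlt : ‖s‖ ^ 2 < q ^ 2) : s = 0 := by
  have hq0 : (q : ℂ) - 1 ≠ 0 := sub_ne_zero.mpr (by exact_mod_cast hq.ne')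
  obtain ⟨k, rfl⟩ := (IsIntegral.exists_int_iff_exists_rat hs).mp
    ⟨q * n / (q - 1), by push_cast; rw [← h, mul_div_cancel_left₀ _ hq0]⟩
  have hk : k = q * (k - n) := by
    have : ((q : ℤ) - 1) * k = q * n := by exact_mod_cast h
    linear_combination -this
  have hk0 : k = 0 := by
    refine Int.eq_zero_of_abs_lt_dvd ⟨_, hk⟩ ?_
    rw [Complex.norm_intCast, sq_lt_sq₀ (abs_nonneg _) (Nat.cast_nonneg _)] at hlt
    exact_mod_cast hlt
  rw [hk0, Int.cast_zero]

theorem finrank_invariants_unipHom (hV : CategoryTheory.Simple V)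
    (h1 : V.character 1 = Fintype.card F) :
    Module.finrank ℂ (Representation.invariants (V.ρ.comp unipHom)) = 1 := by
  have hq : 1 < Fintype.card F := Fintype.one_lt_card
  have hq0 : (Fintype.card F : ℂ) ≠ 0 := by exact_mod_cast Fintype.card_ne_zero
  have hqR : (1 : ℝ) < Fintype.card F := by exact_mod_cast hq
  have h1' : V.character 1 ≠ 0 := by rwa [h1]
  have hsum := sum_character_unip V
  rw [← Finset.add_sum_erase _ _ (Finset.mem_univ 0), unip_zero, h1] at hsum
  set m := Module.finrank ℂ (Representation.invariants (V.ρ.comp unipHom))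
  suffices h : ∑ x ∈ Finset.univ.erase 0, V.character (unip x) = 0 by
    rw [h, add_zero, eq_comm, mul_eq_left₀ hq0] at hsum
    exact_mod_cast hsum
  have hcard : (((Finset.univ.erase (0 : F)).card : ℕ) : ℂ) = Fintype.card F - 1 := by
    rw [Finset.card_erase_of_mem (Finset.mem_univ 0), Finset.card_univ, Nat.cast_sub hq.le,
      Nat.cast_one]
  by_cases hF : ringChar F = 2
  · have hconst : ∀ x ∈ Finset.univ.erase (0 : F), V.character (unip x) = V.character (unip 1) := by
      intro x hx
      obtain ⟨a, rfl⟩ := exists_eq_sq_of_char_two hF (Finset.ne_of_mem_erase hx)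
      rw [← mul_one ((a : F) ^ 2), character_unip_sq_mul]
    have hlt := sum_norm_sq_character_unip_lt hV h1' (S := {1}) (by simp) (by simp)
    rw [Finset.sum_singleton] at hlt
    rw [Finset.sum_congr rfl hconst, Finset.sum_const, nsmul_eq_mul, hcard] at hsum ⊢
    rw [eq_zero_of_isIntegral_of_norm_lt (V.isIntegral_character (unip 1)) hq (n := m - 1) ?_ ?_,
      mul_zero]
    · push_cast
      linear_combination hsum
    · nlinarith
  · obtain ⟨ε, h0, hε, hdich⟩ := exists_nonsquare_dichotomy hF
    have hpair : ∀ x ∈ Finset.univ.erase (0 : F),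
        V.character (unip x) + V.character (unip (ε * x)) = V.character (unip 1) + V.character (unip ε) := by
      intro x hx
      obtain ⟨a, rfl | ⟨rfl, b, hb⟩⟩ := hdich x (Finset.ne_of_mem_erase hx)
      · rw [mul_comm ε, character_unip_sq_mul, ← mul_one ((a : F) ^ 2), character_unip_sq_mul]
      · rw [hb, character_unip_sq_mul, ← mul_one ((b : F) ^ 2), character_unip_sq_mul, add_comm]
    have hperm : ∑ x ∈ Finset.univ.erase 0, V.character (unip (ε * x)) =
        ∑ x ∈ Finset.univ.erase 0, V.character (unip x) :=
      Finset.sum_equiv (Equiv.mulLeft₀ ε h0) (by simp [h0]) fun _ _ => rfl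
    have hs := Finset.sum_congr rfl hpair
    rw [Finset.sum_add_distrib, hperm, Finset.sum_const, nsmul_eq_mul, hcard] at hs
    have hconj : ¬ IsConj (unip 1) (unip ε) := by
      rw [isConj_unip_iff one_ne_zero]
      simpa using hε
    have hne : (1 : F) ≠ ε := fun h => hconj (h ▸ IsConj.refl _)
    have hlt := sum_norm_sq_character_unip_lt hV h1' (S := {1, ε}) (by simp [h0.symm]) (by
      simp only [Finset.mem_insert, Finset.mem_singleton]
      rintro x (rfl | rfl) y (rfl | rfl) h
      exacts [rfl, absurd h hconj, absurd h.symm hconj, rfl])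
    rw [Finset.sum_pair hne] at hlt
    rw [eq_zero_of_isIntegral_of_norm_lt
      ((V.isIntegral_character (unip 1)).add (V.isIntegral_character (unip ε))) hq
      (n := 2 * (m - 1)) ?_ ?_] at hs
    · linear_combination hs / 2
    · push_cast
      linear_combination 2 * hsum - hs
    · have hn := norm_add_le (V.character (unip 1)) (V.character (unip ε))
      have hq2 : (2 : ℝ) ≤ Fintype.card F := by exact_mod_cast hq
      have h3 : ‖V.character (unip 1) + V.character (unip ε)‖ ^ 2 ≤
          (‖V.character (unip 1)‖ + ‖V.character (unip ε)‖) ^ 2 := by gcongr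
      nlinarith [sq_nonneg (‖V.character (unip 1)‖ - ‖V.character (unip ε)‖)]

theorem exists_ne_zero_fixed_by_stabilizer (hV : CategoryTheory.Simple V)
    (h1 : V.character 1 = Fintype.card F) :
    ∃ v : V, v ≠ 0 ∧
      ∀ g : PSL(2, F), g • point (F := F) none = point none → V.ρ g v = v := by
  obtain ⟨⟨v, hvU⟩, hv0, hspan⟩ := finrank_eq_one_iff'.mp (finrank_invariants_unipHom hV h1)
  replace hv0 : v ≠ 0 := fun h => hv0 (Subtype.ext h)
  have hU (x : F) : V.ρ (unip x) v = v := hvU (Multiplicative.ofAdd x)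
  have hinv {w : V} (hw : ∀ x : F, V.ρ (unip x) w = w) : ∃ c : ℂ, w = c • v := by
    obtain ⟨c, hc⟩ := hspan ⟨w, fun x => hw x.toAdd⟩
    exact ⟨c, (congrArg Subtype.val hc).symm⟩
  have hdiag (t : Fˣ) : ∃ c : ℂ, V.ρ (diag t) v = c • v := by
    refine hinv fun x => ?_
    have ht : unip x * diag t = diag t * unip (((t : F) ^ 2)⁻¹ * x) := by
      rw [diag_mul_unip, mul_inv_cancel_left₀ (pow_ne_zero 2 t.ne_zero)]
    rw [← Module.End.mul_apply, ← map_mul, ht, map_mul, Module.End.mul_apply, hU]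
  choose l hl using hdiag
  have hborel (t : Fˣ) (x : F) : V.ρ (diag t * unip x) v = l t • v := by
    rw [map_mul, Module.End.mul_apply, hU, hl]
  have hl1 : l 1 = 1 := by
    have h := hl 1
    rw [diag_one, map_one, Module.End.one_apply] at h
    exact smul_left_injective ℂ hv0 (by simpa using h.symm)
  let f (x : F) : V := V.ρ (unip x) (V.ρ weyl v)
  have hbig (y : F) (t : Fˣ) (x : F) :
      V.ρ (unip y * weyl * (diag t * unip x)) v = l t • f y := by
    rw [map_mul, Module.End.mul_apply, hborel, map_smul, map_mul, Module.End.mul_apply]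
  obtain ⟨k, hk⟩ : ∃ k : ℂ, ∑ x, f x = k • v := by
    refine hinv fun y => ?_
    rw [map_sum, ← Equiv.sum_comp (Equiv.addLeft y) f]
    refine Finset.sum_congr rfl fun x _ => ?_
    rw [Equiv.coe_addLeft, ← Module.End.mul_apply, ← map_mul, ← unip_add]
  have hweyl0 : V.ρ weyl (f 0) = v := by
    change V.ρ weyl (V.ρ (unip 0) (V.ρ weyl v)) = v
    rw [unip_zero, map_one, Module.End.one_apply, ← Module.End.mul_apply, ← map_mul,
      weyl_mul_weyl, map_one, Module.End.one_apply]
  have hweyl (t : Fˣ) : V.ρ weyl (f t) = l t • f (-((t⁻¹ : Fˣ) : F)) := by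
    obtain ⟨x, hx⟩ := weyl_mul_unip_mul_weyl t
    rw [← hbig _ t x, ← hx, map_mul, map_mul]
    rfl
  let μ (y : F) : ℂ := if h : y = 0 then k else -l (-(Units.mk0 y h)⁻¹)
  have hv : v = ∑ y, μ y • f y := by
    have hsum : ∑ y, V.ρ weyl (f (-y⁻¹)) = k • f 0 := by
      have hperm := Equiv.sum_comp ((Equiv.inv F).trans (Equiv.neg F)) fun x => V.ρ weyl (f x)
      refine hperm.trans ?_
      rw [← map_sum, hk, map_smul]
      change _ = k • V.ρ (unip 0) (V.ρ weyl v)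
      rw [unip_zero, map_one, Module.End.one_apply]
    rw [← Finset.add_sum_erase _ _ (Finset.mem_univ 0), _root_.inv_zero, neg_zero, hweyl0] at hsum
    rw [← Finset.add_sum_erase _ _ (Finset.mem_univ 0), eq_sub_of_add_eq hsum, sub_eq_add_neg,
      ← Finset.sum_neg_distrib]
    congr 1
    · simp [μ]
    · refine Finset.sum_congr rfl fun y hy => ?_
      have hy0 := Finset.ne_of_mem_erase hy
      have h := hweyl (-(Units.mk0 y hy0)⁻¹)
      simp only [Units.val_neg, Units.val_inv_eq_inv_val, Units.val_mk0, inv_neg, inv_inv,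
        neg_neg] at h
      rw [h, ← neg_smul]
      simp [μ, hy0]
  have hvmem : v ∈ Submodule.span ℂ (Set.range f) := by
    rw [hv]
    exact Submodule.sum_smul_mem _ _ fun y _ => Submodule.subset_span ⟨y, rfl⟩
  have horbit (g : PSL(2, F)) : V.ρ g v ∈ Submodule.span ℂ (Set.range f) := by
    rcases bruhat g with ⟨t, x, rfl⟩ | ⟨y, t, x, rfl⟩
    · rw [hborel]
      exact Submodule.smul_mem _ _ hvmem
    · rw [hbig]
      exact Submodule.smul_mem _ _ (Submodule.subset_span ⟨y, rfl⟩)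
  have htop : Submodule.span ℂ (Set.range f) = ⊤ := by
    have hW : Submodule.span ℂ (Set.range fun g => V.ρ g v) = ⊤ := by
      refine FDRep.eq_top_of_simple hV (fun g => ?_) ?_
      · change Submodule.span ℂ _ ≤ (Submodule.span ℂ _).comap (V.ρ g)
        rw [Submodule.span_le]
        rintro _ ⟨h, rfl⟩
        refine Submodule.subset_span ⟨g * h, ?_⟩
        simp only [map_mul, Module.End.mul_apply]
      · exact (Submodule.ne_bot_iff _).mpr ⟨v, Submodule.subset_span ⟨1, by simp⟩, hv0⟩
    rw [eq_top_iff, ← hW, Submodule.span_le]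
    rintro _ ⟨g, rfl⟩
    exact horbit g
  have hli : LinearIndependent ℂ f := by
    refine linearIndependent_of_top_le_span_of_card_eq_finrank htop.ge ?_
    rw [V.char_one] at h1
    exact_mod_cast h1.symm
  have hcoef (y : F) : k * μ y = 1 := by
    have hrel : ∑ y, (k * μ y - 1) • f y = 0 := by
      simp only [sub_smul, one_smul, mul_smul, Finset.sum_sub_distrib, ← Finset.smul_sum]
      rw [← hv, hk, sub_self]
    exact sub_eq_zero.mp (Fintype.linearIndependent_iff.mp hli _ hrel y)
  have hμ (t : Fˣ) : μ (-((t⁻¹ : Fˣ) : F)) = -l t := by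
    have h : -((t⁻¹ : Fˣ) : F) ≠ 0 := neg_ne_zero.mpr (t⁻¹).ne_zero
    have ht : -(Units.mk0 _ h)⁻¹ = t := by
      ext
      simp
    simp only [μ, dif_neg h, ht]
  have hk1 : k = -1 := by
    have h := hcoef (-(((1 : Fˣ)⁻¹ : Fˣ) : F))
    rw [hμ, hl1] at h
    linear_combination -h
  have hl_one (t : Fˣ) : l t = 1 := by
    have h := hcoef (-((t⁻¹ : Fˣ) : F))
    rw [hμ, hk1] at h
    linear_combination h
  refine ⟨v, hv0, fun g hg => ?_⟩
  obtain ⟨a, b, c, d, h, rfl⟩ := exists_eq_ofMatrix g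
  obtain rfl := ofMatrix_smul_point_none.mp hg
  obtain ⟨t, x, -, e⟩ := ofMatrix_zero_eq h
  rw [e, hborel, hl_one, one_smul]

theorem character_eq_chiQ (hV : CategoryTheory.Simple V) (h1 : V.character 1 = Fintype.card F) :
    V.character = chiQ F := by
  have := Fintype.ofFinite (Projectivization F (Fin 2 → F))
  obtain ⟨v, hv0, hv⟩ := exists_ne_zero_fixed_by_stabilizer hV h1
  funext g
  rw [chiQ_eq]
  refine FDRep.character_eq_of_two_pretransitive exists_smul_eq_and_smul_eq hV ?_ hv0 hv g
  rw [h1]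
  exact_mod_cast Fintype.one_lt_card.ne'

end Uniqueness

end PSLTwo

/-- For a finite field `F` with `q` elements, `PSL₂(F)` acts faithfully on the projective
line over `F`, and `χ_q = π_q - 1` is the unique irreducible character of `PSL₂(F)` of
degree `q`.  Moreover (1) `χ_q` vanishes on exactly `2/gcd(2,q)` conjugacy classes, each
of size `|PSL₂(F)|/q`, and (2) if `g ≠ 1` and `χ_q g ≠ 0` then `χ_q g = ±1`. -/
theorem chiQ_spec (F : Type) [Field F] [Fintype F] (q : ℕ) (hq : q = Fintype.card F) :
    (∀ g : ProjectiveSpecialLinearGroup (Fin 2) F,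
        (∀ x : Projectivization F (Fin 2 → F), FixedPt g x) → g = 1) ∧
    IsIrredChar (chiQ F) ∧
    chiQ F 1 = (q : ℂ) ∧
    (∀ χ : ProjectiveSpecialLinearGroup (Fin 2) F → ℂ,
        IsIrredChar χ → χ 1 = (q : ℂ) → χ = chiQ F) ∧
    Nat.card {C : ConjClasses (ProjectiveSpecialLinearGroup (Fin 2) F) |
        ∀ g ∈ C.carrier, chiQ F g = 0} = 2 / Nat.gcd 2 q ∧
    (∀ C : ConjClasses (ProjectiveSpecialLinearGroup (Fin 2) F),
        (∀ g ∈ C.carrier, chiQ F g = 0) →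
          Nat.card C.carrier =
            Nat.card (ProjectiveSpecialLinearGroup (Fin 2) F) / q) ∧
    (∀ g : ProjectiveSpecialLinearGroup (Fin 2) F,
        g ≠ 1 → chiQ F g ≠ 0 → chiQ F g = 1 ∨ chiQ F g = -1) := by
  subst hq
  refine ⟨fun g hg => ?_, PSLTwo.isIrredChar_chiQ, PSLTwo.chiQ_one, ?_,
    PSLTwo.card_chiQ_zero_classes, fun C hC => ?_, fun g => PSLTwo.chiQ_eq_one_or_neg_one⟩
  · refine eq_of_smul_eq_smul (α := Projectivization F (Fin 2 → F)) fun x => ?_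
    rw [(PSLTwo.fixedPt_iff g x).mp (hg x), one_smul]
  · rintro _ ⟨V, hV, rfl⟩ h1
    exact PSLTwo.character_eq_chiQ hV h1
  · obtain ⟨x, hx, rfl⟩ := (PSLTwo.mem_chiQ_zero_classes_iff C).mp hC
    rw [← PSLTwo.card_carrier_unip_mul_card hx, Nat.mul_div_cancel _ Fintype.card_pos]
end
end

section
/- If E is an extraspecial group of order p^{2n+1} for a prime p and positive integer n, then u_I(E) = p^{2n}/(p^{2n} + p − 1), z_I(E) = (p−1)(p^{2n+1} − p) / ((p^{2n} + p − 1)·p^{2n+1}), u_II(E) = p^{2n}/(p^{2n} + p − 1), and z_II(E) = (p−1)(p^{2n} − 1)/(p^{2n} + p − 1)². -/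
open scoped Classical

noncomputable section

/-- A finite `p`-group `E` is extraspecial if its center, derived subgroup, and Frattini
subgroup all coincide and have order `p`. -/
def IsExtraspecial (p : ℕ) (E : Type) [Group E] : Prop :=
  IsPGroup p E ∧ Subgroup.center E = commutator E ∧ commutator E = frattini E ∧
    Nat.card (Subgroup.center E) = p

section IrreducibleCharacters

variable {G : Type} [Group G]

lemma FDRep.character_mul_of_eq_smul_one (V : FDRep ℂ G) {g : G} {c : ℂ}
    (hg : V.ρ g = c • 1) (h : G) : V.character (g * h) = c * V.character h := by
  simp [FDRep.character, hg]

lemma FDRep.character_of_eq_smul_one (V : FDRep ℂ G) {g : G} {c : ℂ}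
    (hg : V.ρ g = c • 1) : V.character g = c * Module.finrank ℂ V := by
  simp [FDRep.character, hg]

variable [Fintype G]

/-- Schur's lemma for a simple object of `FDRep ℂ G`. -/
lemma FDRep.exists_smul_one_of_commute (V : FDRep ℂ G) [CategoryTheory.Simple V]
    (T : V →ₗ[ℂ] V) (hT : ∀ g, Commute T (V.ρ g)) : ∃ c : ℂ, T = c • 1 := by
  have := invertibleOfNonzero (NeZero.ne (Nat.card G : ℂ))
  have h1 : Module.finrank ℂ (Representation.IntertwiningMap V.ρ V.ρ) = 1 := by
    have h := Representation.card_inv_mul_sum_char_mul_char_eq_finrank V.ρ V.ρ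
    have h' := V.scalar_product_char_eq_finrank_equivariant V
    rw [(FDRep.simple_iff_end_is_rank_one V).1 inferInstance] at h'
    exact_mod_cast h.symm.trans h'
  have hV : (1 : V →ₗ[ℂ] V) ≠ 0 := by
    intro h0
    obtain ⟨f, hf⟩ := (Module.finrank_pos_iff_exists_ne_zero
      (R := ℂ) (M := Representation.IntertwiningMap V.ρ V.ρ)).1 (by omega)
    apply hf
    apply Representation.IntertwiningMap.ext
    rw [← mul_one f.toLinearMap, h0, mul_zero]
    rfl
  let I : Representation.IntertwiningMap V.ρ V.ρ := ⟨1, fun g ↦ rfl⟩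
  have hI : I ≠ 0 := fun h ↦ hV congr(($h).toLinearMap)
  obtain ⟨c, hc⟩ := (finrank_eq_one_iff_of_nonzero' I hI).1 h1 ⟨T, fun g ↦ hT g⟩
  exact ⟨c, congr(($hc).toLinearMap).symm⟩

lemma FDRep.finrank_ne_zero_of_simple (V : FDRep ℂ G) [CategoryTheory.Simple V] :
    (Module.finrank ℂ V : ℂ) ≠ 0 := by
  intro h
  have h0 : Module.finrank ℂ V = 0 := by exact_mod_cast h
  have := Module.finrank_zero_iff.1 h0
  have hs := (FDRep.simple_iff_char_is_norm_one V).1 inferInstance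
  have hz : ∀ g, V.character g = 0 := fun g ↦ by
    rw [FDRep.character, Subsingleton.elim (V.ρ g) 0, map_zero]
  simp [hz, eq_comm] at hs

/-- If the image of `f` commutes with the whole of `V.ρ`, it acts through a linear character. -/
lemma FDRep.exists_monoidHom_of_commute (V : FDRep ℂ G) [CategoryTheory.Simple V]
    {H : Type} [Group H] (f : H →* G) (hf : ∀ h g, Commute (V.ρ (f h)) (V.ρ g)) :
    ∃ ω : H →* ℂˣ, ∀ h, V.ρ (f h) = (ω h : ℂ) • 1 := by
  choose c hc using fun h ↦ V.exists_smul_one_of_commute (V.ρ (f h)) (hf h)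
  have hd := V.finrank_ne_zero_of_simple
  have hn : Nontrivial V := by
    refine Module.nontrivial_of_finrank_pos (R := ℂ) (Nat.pos_of_ne_zero ?_)
    exact_mod_cast hd
  have hinj : Function.Injective fun a : ℂ ↦ a • (1 : V →ₗ[ℂ] V) :=
    smul_left_injective ℂ one_ne_zero
  let c' : H →* ℂ :=
    { toFun := c
      map_one' := hinj (by simp [← hc])
      map_mul' := fun x y ↦ hinj (by
        simp only [← hc, map_mul]
        rw [hc x, hc y, smul_mul_smul_comm, one_mul]) }
  exact ⟨c'.toHomUnits, fun h ↦ hc h⟩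

lemma isIrredChar_linear (l : G →* ℂˣ) : IsIrredChar fun g ↦ (l g : ℂ) := by
  let ρ : Representation ℂ G ℂ :=
    { toFun := fun g ↦ (l g : ℂ) • 1
      map_one' := by simp
      map_mul' := fun x y ↦ by simp [smul_smul, mul_comm] }
  have hχ : (FDRep.of ρ).character = fun g ↦ (l g : ℂ) := by
    funext g
    change LinearMap.trace ℂ ℂ ((l g : ℂ) • 1) = _
    simp
  refine ⟨FDRep.of ρ, ?_, hχ.symm⟩
  rw [FDRep.simple_iff_char_is_norm_one, hχ]
  simp

/-- A simple representation whose operators all commute has a linear character. -/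
lemma FDRep.exists_character_eq_of_commute (V : FDRep ℂ G) [CategoryTheory.Simple V]
    (hV : ∀ g h, Commute (V.ρ g) (V.ρ h)) :
    ∃ l : G →* ℂˣ, V.character = fun g ↦ (l g : ℂ) := by
  obtain ⟨l, hl⟩ := V.exists_monoidHom_of_commute (MonoidHom.id G) hV
  have hχ : ∀ g, V.character g = l g * Module.finrank ℂ V :=
    fun g ↦ V.character_of_eq_smul_one (hl g)
  have hs := (FDRep.simple_iff_char_is_norm_one V).1 inferInstance
  have h1 : ∀ g, V.character g * V.character g⁻¹ = (Module.finrank ℂ V : ℂ) ^ 2 := fun g ↦ by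
    have : (l g : ℂ) * l g⁻¹ = 1 := by simp
    rw [hχ, hχ]
    linear_combination (Module.finrank ℂ V : ℂ) ^ 2 * this
  simp only [h1, Finset.sum_const, Finset.card_univ, nsmul_eq_mul, Nat.card_eq_fintype_card] at hs
  have hG : (Fintype.card G : ℂ) ≠ 0 := by simp
  have hd : Module.finrank ℂ V = 1 := by
    have : (Module.finrank ℂ V : ℂ) ^ 2 = 1 := mul_left_cancel₀ hG (by rw [hs, mul_one])
    have : Module.finrank ℂ V ^ 2 = 1 := by exact_mod_cast this
    simpa using this
  exact ⟨l, funext fun g ↦ by simp [hχ, hd]⟩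


open MonoidAlgebra in
/-- A simple `ℂ[G]`-module gives a simple object of `FDRep ℂ G`. -/
lemma exists_simple_of_isSimpleModule (M : Type) [AddCommGroup M] [Module (MonoidAlgebra ℂ G) M]
    [hM : IsSimpleModule (MonoidAlgebra ℂ G) M] :
    ∃ V : FDRep ℂ G, CategoryTheory.Simple V ∧
      ∀ g : G, ∀ c : ℂ, (∀ m : M, single g (1 : ℂ) • m = single (1 : G) c • m) →
        V.ρ g = c • 1 := by
  let : Module ℂ M := Module.compHom M (algebraMap ℂ (MonoidAlgebra ℂ G))
  have : IsScalarTower ℂ (MonoidAlgebra ℂ G) M := .of_algebraMap_smul fun _ _ ↦ rfl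
  have hfin : Module.Finite ℂ M := Module.Finite.trans (MonoidAlgebra ℂ G) _
  let ρ : Representation ℂ G M := Representation.ofModule' M
  have hlift : ρ.asAlgebraHom = Algebra.lsmul ℂ ℂ M :=
    (MonoidAlgebra.lift ℂ (M →ₗ[ℂ] M) G).apply_symm_apply _
  let e : ρ.asModule ≃ₗ[MonoidAlgebra ℂ G] M :=
    { ρ.asModuleEquiv with
      map_smul' := fun a m ↦ by
        have := congr($hlift a (ρ.asModuleEquiv m))
        exact (ρ.asModuleEquiv_map_smul a m).trans this }
  have : ρ.IsIrreducible :=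
    (Representation.irreducible_iff_isSimpleModule_asModule ρ).2 (IsSimpleModule.congr e)
  have := invertibleOfNonzero (NeZero.ne (Nat.card G : ℂ))
  refine ⟨FDRep.of ρ, ?_, fun g c h ↦ ?_⟩
  · rw [FDRep.simple_iff_char_is_norm_one]
    have h := Representation.char_orthonormal ρ ρ
    rw [if_pos ⟨.refl _⟩, inv_mul_eq_one₀ (by simp)] at h
    exact h.symm
  · exact LinearMap.ext fun m ↦ h m

open MonoidAlgebra in
/-- Every linear character of the center is the central character of some simple
representation. -/
lemma exists_simple_of_central_character (ω : Subgroup.center G →* ℂˣ) :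
    ∃ V : FDRep ℂ G, CategoryTheory.Simple V ∧
      ∀ z : Subgroup.center G, V.ρ z = (ω z : ℂ) • 1 := by
  let e : MonoidAlgebra ℂ G := ∑ z : Subgroup.center G, single (z : G) ((ω z⁻¹ : ℂˣ) : ℂ)
  have he : e ≠ 0 := by
    intro h
    have h1 := congr(($h).coeff 1)
    simp [e, MonoidAlgebra.coeff_sum, Finsupp.single_apply] at h1
  have hze : ∀ (z : Subgroup.center G) (x : MonoidAlgebra ℂ G),
      single (z : G) (1 : ℂ) * (x * e) = single (1 : G) (ω z : ℂ) * (x * e) := by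
    intro z x
    have hc : ∀ (z : Subgroup.center G) (c : ℂ), Commute (single (z : G) c) x := fun z c ↦
      single_commute (fun g ↦ (Subgroup.mem_center_iff.1 z.2 g).symm) (fun r ↦ .all c r) x
    rw [← mul_assoc, (hc z 1).eq, ← mul_assoc, ← OneMemClass.coe_one (Subgroup.center G),
      (hc 1 _).eq, mul_assoc, mul_assoc]
    congr 1
    simp only [e, Finset.mul_sum]
    refine Fintype.sum_equiv (Equiv.mulLeft z) _ _ fun w ↦ ?_
    simp [mul_comm ((ω w : ℂ)⁻¹)]
  obtain ⟨S, hS, hSe⟩ := (eq_bot_or_exists_atom_le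
    (Submodule.span (MonoidAlgebra ℂ G) {e})).resolve_left (by simpa using he)
  have : IsSimpleModule (MonoidAlgebra ℂ G) S := isSimpleModule_iff_isAtom.2 hS
  obtain ⟨V, hV, h⟩ := exists_simple_of_isSimpleModule (G := G) S
  refine ⟨V, hV, fun z ↦ h z _ fun m ↦ Subtype.ext ?_⟩
  obtain ⟨x, hx⟩ := Submodule.mem_span_singleton.1 (hSe m.2)
  simp only [Submodule.coe_smul, smul_eq_mul, ← hx, hze]

end IrreducibleCharacters

section Extraspecial

open Subgroup
open scoped commutatorElement

variable {E : Type} [Group E] {p : ℕ}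

/-- The coset of a noncentral element modulo a central derived subgroup of prime order is a
conjugacy class. -/
lemma exists_conj_eq_center_mul (hp : p.Prime) (hZ : Nat.card (center E) = p)
    (hE : commutator E ≤ center E) {g : E} (hg : g ∉ center E) (z : center E) :
    ∃ h : E, h * g * h⁻¹ = z * g := by
  have : Fact p.Prime := ⟨hp⟩
  obtain ⟨h, hh⟩ : ∃ h, h * g ≠ g * h := by
    simpa [mem_center_iff] using hg
  have hc : ⁅h, g⁆ ∈ center E :=
    hE (commutator_mem_commutator (mem_top h) (mem_top g))
  have hc1 : (⟨⁅h, g⁆, hc⟩ : center E) ≠ 1 := by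
    rw [Ne, Subtype.ext_iff]
    exact fun h0 ↦ hh (commutatorElement_eq_one_iff_mul_comm.1 h0)
  obtain ⟨k, rfl⟩ := mem_powers_of_prime_card hZ hc1 (g' := z)
  refine ⟨h ^ k, ?_⟩
  induction k with
  | zero => simp
  | succ k ih =>
    have hk := mem_center_iff.1 (pow_mem hc k) h
    calc h ^ (k + 1) * g * (h ^ (k + 1))⁻¹ = h * (h ^ k * g * (h ^ k)⁻¹) * h⁻¹ := by group
      _ = h * ⁅h, g⁆ ^ k * g * h⁻¹ := by rw [ih]; simp [mul_assoc]
      _ = ⁅h, g⁆ ^ k * ⁅h, g⁆ * g := by rw [hk, commutatorElement_def]; group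
      _ = _ := by simp [pow_succ]

lemma carrier_eq_image_center (hp : p.Prime) (hZ : Nat.card (center E) = p)
    (hE : commutator E ≤ center E) {g : E} (hg : g ∉ center E) :
    (ConjClasses.mk g).carrier = (· * g) '' (center E : Set E) := by
  ext x
  rw [ConjClasses.mem_carrier_iff_mk_eq, eq_comm, ConjClasses.mk_eq_mk_iff_isConj, isConj_iff]
  constructor
  · rintro ⟨h, rfl⟩
    refine ⟨⁅h, g⁆, hE (commutator_mem_commutator (mem_top h) (mem_top g)), ?_⟩
    simp [commutatorElement_def]
  · rintro ⟨z, hz, rfl⟩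
    exact exists_conj_eq_center_mul hp hZ hE hg ⟨z, hz⟩

lemma card_noncenter_mul [Finite E] (hp : p.Prime) (hZ : Nat.card (center E) = p)
    (hE : commutator E ≤ center E) :
    p + Nat.card (ConjClasses.noncenter E) * p = Nat.card E := by
  have h := Group.nat_card_center_add_sum_card_noncenter_eq_card E
  have hC : ∀ x ∈ ConjClasses.noncenter E, Nat.card x.carrier = p := by
    intro x hx
    obtain ⟨g, rfl⟩ := x.exists_rep
    have hg : g ∉ center E := fun hg ↦ (ConjClasses.mk_bijOn E).mapsTo hg hx
    rw [carrier_eq_image_center hp hZ hE hg,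
      Nat.card_image_of_injective (mul_left_injective g), ← hZ]
    rfl
  rw [finsum_mem_congr rfl hC, hZ] at h
  rw [← h, finsum_mem_eq_finite_toFinset_sum _ (Set.toFinite _), Finset.sum_const, smul_eq_mul,
    Nat.card_coe_set_eq, Set.ncard_eq_toFinset_card _ (Set.toFinite _)]

lemma card_conjClasses [Finite E] :
    Nat.card (ConjClasses E) = Nat.card (ConjClasses.noncenter E) + Nat.card (center E) := by
  have h : Nat.card (center E) = Nat.card ((ConjClasses.noncenter E)ᶜ : Set _) :=
    Nat.card_congr ((ConjClasses.mk_bijOn E).equiv _)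
  rw [h, Nat.card_coe_set_eq, Nat.card_coe_set_eq, Set.ncard_add_ncard_compl]

lemma card_linear_characters [Finite E] :
    Nat.card (E →* ℂˣ) = (commutator E).index := by
  rw [Nat.card_congr (Abelianization.lift (G := E) (A := ℂˣ)),
    CommGroup.card_monoidHom_of_hasEnoughRootsOfUnity]
  rfl

/-- The function that is `p ^ n * ω` on the center and vanishes elsewhere. -/
def centralChar (p n : ℕ) (ω : center E →* ℂˣ) (g : E) : ℂ :=
  if h : g ∈ center E then (p : ℂ) ^ n * ω ⟨g, h⟩ else 0

lemma centralChar_coe (n : ℕ) (ω : center E →* ℂˣ) (z : center E) :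
    centralChar p n ω z = (p : ℂ) ^ n * ω z := dif_pos z.2

lemma centralChar_injective (hp : p.Prime) (n : ℕ) :
    Function.Injective (centralChar (E := E) p n) := by
  intro ω ω' h
  ext z
  have hz := congrFun h z
  rw [centralChar_coe, centralChar_coe] at hz
  exact mul_left_cancel₀ (pow_ne_zero _ (Nat.cast_ne_zero.2 hp.ne_zero)) hz

lemma IsRootOfUnity.norm_eq_one {z : ℂ} (hz : IsRootOfUnity z) : ‖z‖ = 1 := by
  obtain ⟨m, hm, h⟩ := hz
  exact Complex.norm_eq_one_of_pow_eq_one h hm.ne'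

lemma isRootOfUnity_linear {G : Type} [Group G] [Finite G] (l : G →* ℂˣ) (g : G) :
    IsRootOfUnity (l g) :=
  ⟨Nat.card G, Nat.card_pos, by rw [← Units.val_pow_eq_pow_val, ← map_pow, pow_card_eq_one']; simp⟩

lemma centralChar_eq_zero_iff (hp : p.Prime) (n : ℕ) (ω : center E →* ℂˣ) (g : E) :
    centralChar p n ω g = 0 ↔ g ∉ center E := by
  unfold centralChar
  split_ifs with h <;> simp [h, hp.ne_zero]

lemma not_isRootOfUnity_centralChar [Finite E] (hp : p.Prime) {n : ℕ} (hn : 0 < n)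
    (ω : center E →* ℂˣ) (g : E) : ¬ IsRootOfUnity (centralChar p n ω g) := by
  intro h
  have h1 := h.norm_eq_one
  unfold centralChar at h1
  split_ifs at h1 with hg
  · rw [norm_mul, (isRootOfUnity_linear ω _).norm_eq_one, mul_one, norm_pow,
      Complex.norm_natCast] at h1
    exact (one_lt_pow₀ (by exact_mod_cast hp.one_lt) hn.ne').ne' h1
  · simp at h1

lemma linear_injective : Function.Injective fun (l : E →* ℂˣ) (g : E) ↦ (l g : ℂ) :=
  fun _ _ h ↦ MonoidHom.ext fun g ↦ Units.ext (congrFun h g)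

lemma mem_noncenter_iff_forall (C : ConjClasses E) :
    C ∈ ConjClasses.noncenter E ↔ ∀ g ∈ C.carrier, g ∉ center E := by
  constructor
  · intro hC g hg hgZ
    rw [ConjClasses.mem_carrier_iff_mk_eq] at hg
    exact (ConjClasses.mk_bijOn E).mapsTo hgZ (hg ▸ hC)
  · intro h
    by_contra hC
    obtain ⟨g, hg, rfl⟩ := (ConjClasses.mk_bijOn E).surjOn hC
    exact h g ConjClasses.mem_carrier_mk hg

variable [Fintype E]

/-- A simple representation with nontrivial central character `ω` has character
`centralChar p n ω`. -/
lemma character_eq_centralChar (hp : p.Prime) {n : ℕ} (hZ : Nat.card (center E) = p)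
    (hE : commutator E ≤ center E) (hcard : Nat.card E = p ^ (2 * n + 1))
    (V : FDRep ℂ E) [CategoryTheory.Simple V] {ω : center E →* ℂˣ} (hω : ω ≠ 1)
    (hV : ∀ z : center E, V.ρ z = (ω z : ℂ) • 1) : V.character = centralChar p n ω := by
  have h0 : ∀ g ∉ center E, V.character g = 0 := by
    intro g hg
    obtain ⟨z, hz⟩ : ∃ z, ω z ≠ 1 := by
      by_contra! h
      exact hω (MonoidHom.ext h)
    obtain ⟨h, hh⟩ := exists_conj_eq_center_mul hp hZ hE hg z
    have h1 := V.char_conj g h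
    rw [hh, V.character_mul_of_eq_smul_one (hV z)] at h1
    by_contra hg0
    exact hz (Units.ext (by simpa using mul_right_cancel₀ hg0 (h1.trans (one_mul _).symm)))
  have hd : (Module.finrank ℂ V) = p ^ n := by
    have hs := (FDRep.simple_iff_char_is_norm_one V).1 inferInstance
    have h1 : ∀ g, V.character g * V.character g⁻¹ =
        if g ∈ center E then (Module.finrank ℂ V : ℂ) ^ 2 else 0 := by
      intro g
      split_ifs with hg
      · have : (ω ⟨g, hg⟩ : ℂ) * ω ⟨g, hg⟩⁻¹ = 1 := by simp
        rw [V.character_of_eq_smul_one (hV ⟨g, hg⟩), V.character_of_eq_smul_one (g := g⁻¹) (hV ⟨g, hg⟩⁻¹)]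
        linear_combination (Module.finrank ℂ V : ℂ) ^ 2 * this
      · rw [h0 g hg, zero_mul]
    have hc : (Finset.univ.filter (· ∈ center E)).card = p := by
      rw [← hZ, Nat.card_eq_fintype_card, Fintype.card_subtype]
    rw [Finset.sum_congr rfl fun g _ ↦ h1 g, ← Finset.sum_filter, Finset.sum_const, hc,
      hcard, nsmul_eq_mul] at hs
    have h2 : p * Module.finrank ℂ V ^ 2 = p * (p ^ n) ^ 2 := by
      rw [← pow_mul, mul_comm n, ← pow_succ']
      exact_mod_cast hs
    exact Nat.pow_left_injective two_ne_zero (Nat.eq_of_mul_eq_mul_left hp.pos h2)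
  funext g
  unfold centralChar
  split_ifs with hg
  · rw [V.character_of_eq_smul_one (hV ⟨g, hg⟩), hd, mul_comm, Nat.cast_pow]
  · exact h0 g hg

lemma isIrredChar_iff (hp : p.Prime) {n : ℕ} (hZ : Nat.card (center E) = p)
    (hE : commutator E ≤ center E) (hcard : Nat.card E = p ^ (2 * n + 1)) (χ : E → ℂ) :
    IsIrredChar χ ↔ (∃ l : E →* ℂˣ, (fun g ↦ (l g : ℂ)) = χ) ∨
      ∃ ω : {ω : center E →* ℂˣ // ω ≠ 1}, centralChar p n ω.1 = χ := by
  constructor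
  · rintro ⟨V, hV, rfl⟩
    obtain ⟨ω, hω⟩ := V.exists_monoidHom_of_commute (center E).subtype fun z g ↦ by
      rw [commute_iff_eq, ← map_mul, ← map_mul]
      exact congrArg _ (mem_center_iff.1 z.2 g).symm
    by_cases h : ω = 1
    · left
      obtain ⟨l, hl⟩ := V.exists_character_eq_of_commute fun g h' ↦ by
        have hc := hω ⟨⁅g, h'⁆, hE (commutator_mem_commutator (mem_top g) (mem_top h'))⟩
        rw [h, MonoidHom.one_apply, Units.val_one, one_smul] at hc
        have : g * h' = ⁅g, h'⁆ * (h' * g) := by rw [commutatorElement_def]; group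
        rw [commute_iff_eq, ← map_mul, this, map_mul]
        erw [hc]
        rw [one_mul, map_mul]
      exact ⟨l, hl.symm⟩
    · exact .inr ⟨⟨ω, h⟩, (character_eq_centralChar hp hZ hE hcard V h hω).symm⟩
  · rintro (⟨l, rfl⟩ | ⟨⟨ω, hω⟩, rfl⟩)
    · exact isIrredChar_linear l
    · obtain ⟨V, hV, h⟩ := exists_simple_of_central_character ω
      exact ⟨V, hV, (character_eq_centralChar hp hZ hE hcard V hω h).symm⟩

lemma card_nontrivial_central_characters :
    Nat.card {ω : center E →* ℂˣ // ω ≠ 1} + 1 = Nat.card (center E) := by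
  let : CommGroup (center E) :=
    { (inferInstance : Group (center E)) with
      mul_comm := fun x y ↦ Subtype.ext (mem_center_iff.1 y.2 x) }
  have h : Nat.card (center E →* ℂˣ) = Nat.card (center E) :=
    CommGroup.card_monoidHom_of_hasEnoughRootsOfUnity (center E) ℂ
  have : Finite (center E →* ℂˣ) := Nat.finite_of_card_ne_zero (h ▸ Nat.card_pos.ne')
  rw [← h, ← Set.ncard_add_ncard_compl {(1 : center E →* ℂˣ)}, Set.ncard_singleton, add_comm,
    ← Nat.card_coe_set_eq]
  rfl

end Extraspecial

section Counting

variable {α β : Type*}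

/-- Counting the pairs in `s × T` that satisfy a condition which, on `s`, only constrains the
second coordinate. -/
lemma card_pairs_eq {ι κ : Type*} [Finite ι] [Finite κ] [Finite β] {I : α → Prop}
    {Q : α → β → Prop} {f : ι → α} {g : κ → α} (hf : f.Injective) (hg : g.Injective)
    (hI : ∀ a, I a ↔ (∃ i, f i = a) ∨ ∃ k, g k = a) (hfg : ∀ i k, f i ≠ g k)
    {S T : Set β} (hfQ : ∀ i b, Q (f i) b ↔ b ∈ S) (hgQ : ∀ k b, Q (g k) b ↔ b ∈ T) :
    Nat.card {q : α × β | I q.1 ∧ Q q.1 q.2} =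
      Nat.card ι * Nat.card S + Nat.card κ * Nat.card T := by
  have h : {q : α × β | I q.1 ∧ Q q.1 q.2} = Set.range f ×ˢ S ∪ Set.range g ×ˢ T := by
    ext ⟨a, b⟩
    simp only [Set.mem_ofPred_eq, hI, Set.mem_union, Set.mem_prod, Set.mem_range]
    constructor
    · rintro ⟨⟨i, rfl⟩ | ⟨k, rfl⟩, h⟩
      · exact .inl ⟨⟨i, rfl⟩, (hfQ i b).1 h⟩
      · exact .inr ⟨⟨k, rfl⟩, (hgQ k b).1 h⟩
    · rintro (⟨⟨i, rfl⟩, h⟩ | ⟨⟨k, rfl⟩, h⟩)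
      · exact ⟨.inl ⟨i, rfl⟩, (hfQ i b).2 h⟩
      · exact ⟨.inr ⟨k, rfl⟩, (hgQ k b).2 h⟩
  have hd : Disjoint (Set.range f ×ˢ S) (Set.range g ×ˢ T) :=
    Set.disjoint_prod.2 (.inl (Set.disjoint_range_iff.2 hfg))
  rw [h, Nat.card_coe_set_eq, Set.ncard_union_eq hd (Set.toFinite _) (Set.toFinite _),
    Set.ncard_prod, Set.ncard_prod, ← Nat.card_coe_set_eq (Set.range f),
    ← Nat.card_coe_set_eq (Set.range g), ← Nat.card_coe_set_eq S, ← Nat.card_coe_set_eq T,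
    Nat.card_range_of_injective hf, Nat.card_range_of_injective hg]

end Counting

/-- The values of `u_I`, `z_I`, `u_II`, `z_II` on an extraspecial group of order
`p^(2n+1)`. -/
theorem extraspecial_stats (p n : ℕ) (hp : p.Prime) (hn : 0 < n)
    (E : Type) [Group E] [Fintype E] (hE : IsExtraspecial p E)
    (hcard : Nat.card E = p ^ (2 * n + 1)) :
    uIG E = (p : ℝ) ^ (2 * n) / ((p : ℝ) ^ (2 * n) + p - 1) ∧
    zIG E = ((p : ℝ) - 1) * ((p : ℝ) ^ (2 * n + 1) - p) /
      (((p : ℝ) ^ (2 * n) + p - 1) * (p : ℝ) ^ (2 * n + 1)) ∧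
    uIIG E = (p : ℝ) ^ (2 * n) / ((p : ℝ) ^ (2 * n) + p - 1) ∧
    zIIG E = ((p : ℝ) - 1) * ((p : ℝ) ^ (2 * n) - 1) /
      ((p : ℝ) ^ (2 * n) + p - 1) ^ 2 := by
  obtain ⟨-, hcomm, -, hZ⟩ := hE
  have hE : commutator E ≤ Subgroup.center E := hcomm.ge
  have hL : Nat.card (E →* ℂˣ) = p ^ (2 * n) := by
    have h := (commutator E).card_mul_index
    rw [← hcomm, hZ, hcard, pow_succ', hcomm] at h
    rw [card_linear_characters, Nat.eq_of_mul_eq_mul_left hp.pos h]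
  have hN : Nat.card {ω : Subgroup.center E →* ℂˣ // ω ≠ 1} + 1 = p := by
    rw [card_nontrivial_central_characters, hZ]
  have : Finite (E →* ℂˣ) := Nat.finite_of_card_ne_zero (by simp [hL, hp.ne_zero])
  have hK : Nat.card (ConjClasses.noncenter E) + 1 = p ^ (2 * n) := by
    have h := card_noncenter_mul hp hZ hE
    rw [hcard, pow_succ] at h
    exact Nat.eq_of_mul_eq_mul_right hp.pos (by linarith)
  have hC : Nat.card (ConjClasses E) + 1 = p ^ (2 * n) + p := by
    rw [card_conjClasses, hZ, ← hK]; ring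
  have hf := linear_injective (E := E)
  have hg : Function.Injective fun ω : {ω : Subgroup.center E →* ℂˣ // ω ≠ 1} ↦
      centralChar p n ω.1 := (centralChar_injective hp n).comp Subtype.val_injective
  have hI := isIrredChar_iff hp hZ hE hcard
  have hfg : ∀ (l : E →* ℂˣ) (ω : {ω : Subgroup.center E →* ℂˣ // ω ≠ 1}),
      (fun g ↦ (l g : ℂ)) ≠ centralChar p n ω.1 := fun l ω h ↦
    not_isRootOfUnity_centralChar hp hn ω.1 1 (h ▸ isRootOfUnity_linear l 1)
  have hIrr : Nat.card {χ : E → ℂ | IsIrredChar χ} + 1 = p ^ (2 * n) + p := by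
    have h : {χ : E → ℂ | IsIrredChar χ} = Set.range (fun (l : E →* ℂˣ) (g : E) ↦ (l g : ℂ)) ∪
        Set.range fun ω : {ω : Subgroup.center E →* ℂˣ // ω ≠ 1} ↦ centralChar p n ω.1 :=
      Set.ext hI
    rw [h, Nat.card_coe_set_eq, Set.ncard_union_eq (Set.disjoint_range_iff.2 hfg)
      (Set.finite_range _) (Set.finite_range _), ← Nat.card_coe_set_eq, ← Nat.card_coe_set_eq,
      Nat.card_range_of_injective hf, Nat.card_range_of_injective hg, hL, add_assoc, hN]
  have huI := card_pairs_eq (β := E) (Q := fun χ g ↦ IsRootOfUnity (χ g))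
    (S := Set.univ) (T := ∅) hf hg hI hfg
    (fun l g ↦ iff_of_true (isRootOfUnity_linear l g) trivial)
    (fun ω g ↦ iff_of_false (not_isRootOfUnity_centralChar hp hn ω.1 g) id)
  have hzI := card_pairs_eq (β := E) (Q := fun χ g ↦ χ g = 0)
    (S := ∅) (T := (Subgroup.center E : Set E)ᶜ) hf hg hI hfg
    (fun l g ↦ iff_of_false (l g).ne_zero id)
    (fun ω g ↦ centralChar_eq_zero_iff hp n ω.1 g)
  have huII := card_pairs_eq (β := ConjClasses E)
    (Q := fun χ C ↦ ∃ g, ConjClasses.mk g = C ∧ IsRootOfUnity (χ g))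
    (S := Set.univ) (T := ∅) hf hg hI hfg
    (fun l C ↦ iff_of_true (C.exists_rep.imp fun g hg ↦ ⟨hg, isRootOfUnity_linear l g⟩) trivial)
    (fun ω C ↦ iff_of_false
      (fun ⟨g, _, h⟩ ↦ not_isRootOfUnity_centralChar hp hn ω.1 g h) id)
  have hzII := card_pairs_eq (β := ConjClasses E)
    (Q := fun χ C ↦ ∀ g ∈ C.carrier, χ g = 0)
    (S := ∅) (T := ConjClasses.noncenter E) hf hg hI hfg
    (fun l C ↦ iff_of_false (fun h ↦ by
      obtain ⟨g, rfl⟩ := C.exists_rep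
      exact (l g).ne_zero (h g ConjClasses.mem_carrier_mk)) id)
    (fun ω C ↦ by
      simp only [centralChar_eq_zero_iff hp n, mem_noncenter_iff_forall])
  have hZc : Nat.card ((Subgroup.center E : Set E)ᶜ : Set E) + p = p ^ (2 * n + 1) := by
    rw [← hcard, ← hZ, Nat.card_coe_set_eq, add_comm]
    exact Set.ncard_add_ncard_compl (Subgroup.center E : Set E)
  simp only [Set.coe_ofPred, Nat.card_univ, Nat.card_of_isEmpty, mul_zero, add_zero, zero_add, hL]
    at huI hzI huII hzII
  rw [hcard] at huI
  have hNr : (Nat.card {ω : Subgroup.center E →* ℂˣ // ω ≠ 1} : ℝ) = p - 1 :=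
    eq_sub_of_add_eq (by exact_mod_cast hN)
  have hKr : (Nat.card (ConjClasses.noncenter E) : ℝ) = (p : ℝ) ^ (2 * n) - 1 :=
    eq_sub_of_add_eq (by exact_mod_cast hK)
  have hCr : (Nat.card (ConjClasses E) : ℝ) = (p : ℝ) ^ (2 * n) + p - 1 :=
    eq_sub_of_add_eq (by exact_mod_cast hC)
  have hIr : (Nat.card {χ : E → ℂ | IsIrredChar χ} : ℝ) = (p : ℝ) ^ (2 * n) + p - 1 :=
    eq_sub_of_add_eq (by exact_mod_cast hIrr)
  have hZr : (Nat.card ((Subgroup.center E : Set E)ᶜ : Set E) : ℝ) = (p : ℝ) ^ (2 * n + 1) - p :=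
    eq_sub_of_add_eq (by exact_mod_cast hZc)
  have hp0 : (p : ℝ) ^ (2 * n + 1) ≠ 0 := pow_ne_zero _ (Nat.cast_ne_zero.2 hp.ne_zero)
  have hk0 : (p : ℝ) ^ (2 * n) + p - 1 ≠ 0 := hCr ▸ Nat.cast_ne_zero.2 Nat.card_pos.ne'
  simp only [Set.coe_ofPred] at hIr
  simp only [uIG, zIG, uIIG, zIIG, Set.coe_ofPred, huI, hzI, huII, hzII, hcard, Nat.cast_mul,
    Nat.cast_pow, hNr, hKr, hCr, hIr, hZr]
  exact ⟨mul_div_mul_right _ _ hp0, trivial, mul_div_mul_right _ _ hk0, by rw [sq]⟩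
end
end

section
/- Let n and h be positive integers with 0 < h < 2^{n−1}, let G_n = ⟨s, t | s² = t^{2ⁿ} = (st)² = 1⟩ be the dihedral group of order 2^{n+1}, and let η_h be its irreducible character of degree 2 determined by η_h(t^k) = 2cos(πhk/2^{n−1}) and η_h(st^k) = 0. Then: (1) η_h(g) = 0 for exactly 2^{ν₂(h)+1} + 2ⁿ elements g ∈ G_n, where ν₂ denotes the 2-adic valuation; (2) η_h vanishes on exactly 2^{ν₂(h)} + 2 conjugacy classes of G_n; (3) the number of pairs (χ, g) ∈ Irr(G_n) × G_n with χ(g) = 0 equals 2^{n−1}(n−1) + 2^{2n−1} − 2ⁿ; (4) the number of pairs (χ, C) ∈ Irr(G_n) × Cl(G_n) with χ vanishing on C (i.e. the number of zeros in the character table of G_n) equals 2^{n−2}(n−1) + 2ⁿ − 2. -/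
open scoped Classical

noncomputable section

/-- The degree-2 irreducible character `η_h` of the dihedral group
`G_n = ⟨s, t ∣ s² = t^(2ⁿ) = (st)² = 1⟩` of order `2^(n+1)` (realized as
`DihedralGroup (2^n)`, with `t^k = r k` and `s·t^k = sr k`), determined by
`η_h(t^k) = 2·cos(πhk/2^(n-1))` and `η_h(s·t^k) = 0`. -/
def etaH (n h : ℕ) : DihedralGroup (2 ^ n) → ℂ :=
  fun g =>
    match g with
    | DihedralGroup.r k =>
        ((2 * Real.cos (Real.pi * h * k.val / 2 ^ (n - 1)) : ℝ) : ℂ)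
    | DihedralGroup.sr _ => 0

namespace DihedralGroup

open CategoryTheory

variable {N : ℕ}

theorem sum_eq_sum_r_add_sum_sr [NeZero N] {M : Type*} [AddCommMonoid M]
    (f : DihedralGroup N → M) : ∑ g, f g = ∑ k, f (r k) + ∑ k, f (sr k) := by
  rw [← equivSum.symm.sum_comp, Fintype.sum_sum_type]
  rfl

theorem isConj_r_neg (k : ZMod N) : IsConj (r k) (r (-k)) :=
  isConj_iff.mpr ⟨sr 0, by simp⟩

theorem isConj_r_iff {k l : ZMod N} : IsConj (r k) (r l) ↔ l = k ∨ l = -k := by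
  constructor
  · intro h
    obtain ⟨c | c, hc⟩ := isConj_iff.mp h
    · left
      simpa using hc.symm
    · right
      simpa using hc.symm
  · rintro (rfl | rfl)
    exacts [IsConj.refl _, isConj_r_neg k]

theorem not_isConj_r_sr (k l : ZMod N) : ¬ IsConj (r k) (sr l) := by
  intro h
  obtain ⟨c | c, hc⟩ := isConj_iff.mp h <;> simp at hc

theorem isConj_sr_iff {k l : ZMod N} : IsConj (sr k) (sr l) ↔ ∃ j, l = k + 2 * j := by
  constructor
  · intro h
    obtain ⟨c | c, hc⟩ := isConj_iff.mp h
    · refine ⟨-c, ?_⟩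
      simp only [r_mul_sr, inv_r, sr_mul_r, sr.injEq] at hc
      rw [← hc]
      ring
    · refine ⟨c - k, ?_⟩
      simp only [sr_mul_sr, inv_sr, r_mul_sr, sr.injEq] at hc
      rw [← hc]
      ring
  · rintro ⟨j, rfl⟩
    refine isConj_iff.mpr ⟨r (-j), ?_⟩
    simp only [r_mul_sr, inv_r, sr_mul_r, sr.injEq]
    ring

theorem isConj_sr_zero_or_one [NeZero N] (k : ZMod N) :
    IsConj (sr k) (sr 0) ∨ IsConj (sr k) (sr 1) := by
  have hk : ((k.val : ℕ) : ZMod N) = k := ZMod.natCast_rightInverse k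
  obtain ⟨m, hm | hm⟩ := k.val.even_or_odd'
  · left
    refine isConj_sr_iff.mpr ⟨-m, ?_⟩
    rw [← hk, hm]
    push_cast
    ring
  · right
    refine isConj_sr_iff.mpr ⟨-m, ?_⟩
    rw [← hk, hm]
    push_cast
    ring

theorem not_isConj_sr_zero_sr_one (hN : 2 ∣ N) : ¬ IsConj (sr 0 : DihedralGroup N) (sr 1) := by
  intro h
  obtain ⟨j, hj⟩ := isConj_sr_iff.mp h
  have := congrArg (ZMod.castHom hN (ZMod 2)) hj
  rw [map_one, map_add, map_mul, map_zero, map_ofNat] at this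
  revert this
  generalize ZMod.castHom hN (ZMod 2) j = x
  revert x
  decide

variable [NeZero N]

/-- The matrices of the representation of the dihedral group induced from the character
`k ↦ exp (2πi a k / N)` of its rotation subgroup. -/
def inducedMatrix (a : ZMod N) : DihedralGroup N → Matrix (Fin 2) (Fin 2) ℂ
  | r k => !![ZMod.stdAddChar (k * a), 0; 0, ZMod.stdAddChar (-(k * a))]
  | sr k => !![0, ZMod.stdAddChar (-(k * a)); ZMod.stdAddChar (k * a), 0]

theorem inducedMatrix_one (a : ZMod N) : inducedMatrix a 1 = 1 := by
  rw [one_def]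
  ext i j
  fin_cases i <;> fin_cases j <;> simp [inducedMatrix]

theorem inducedMatrix_mul (a : ZMod N) (g g' : DihedralGroup N) :
    inducedMatrix a (g * g') = inducedMatrix a g * inducedMatrix a g' := by
  rcases g with k | k <;> rcases g' with l | l <;> ext i j <;> fin_cases i <;> fin_cases j <;>
    simp [inducedMatrix, Matrix.mul_apply, ← AddChar.map_add_eq_mul] <;> ring_nf

/-- The representation of the dihedral group induced from the character
`k ↦ exp (2πi a k / N)` of its rotation subgroup. -/
def inducedRep (a : ZMod N) : FDRep ℂ (DihedralGroup N) :=
  FDRep.of (V := Fin 2 → ℂ)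
    { toFun := fun g => Matrix.toLin' (inducedMatrix a g)
      map_one' := by rw [inducedMatrix_one, Matrix.toLin'_one]; rfl
      map_mul' := fun g g' => by rw [inducedMatrix_mul, Matrix.toLin'_mul]; rfl }

theorem character_inducedRep (a : ZMod N) (g : DihedralGroup N) :
    (inducedRep a).character g = (inducedMatrix a g).trace :=
  Matrix.trace_toLin'_eq _

theorem character_inducedRep_r (a k : ZMod N) : (inducedRep a).character (r k) =
    ZMod.stdAddChar (k * a) + ZMod.stdAddChar (-(k * a)) := by
  rw [character_inducedRep]
  simp [inducedMatrix, Matrix.trace_fin_two]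

theorem character_inducedRep_sr (a k : ZMod N) : (inducedRep a).character (sr k) = 0 := by
  rw [character_inducedRep]
  simp [inducedMatrix, Matrix.trace_fin_two]

theorem character_inducedRep_neg (a : ZMod N) :
    (inducedRep (-a)).character = (inducedRep a).character := by
  ext (k | k)
  · simp only [character_inducedRep_r, mul_neg, neg_neg]
    ring
  · simp only [character_inducedRep_sr]

theorem simple_inducedRep {a : ZMod N} (ha : 2 * a ≠ 0) : Simple (inducedRep a) := by
  rw [FDRep.simple_iff_char_is_norm_one, sum_eq_sum_r_add_sum_sr, nat_card]
  have hsum : ∀ b : ZMod N, b ≠ 0 → ∑ k : ZMod N, ZMod.stdAddChar (k * b) = (0 : ℂ) := by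
    intro b hb
    rw [AddChar.sum_mulShift b (ZMod.isPrimitive_stdAddChar N), if_neg hb, Nat.cast_zero]
  have hterm : ∀ k : ZMod N, (inducedRep a).character (r k) * (inducedRep a).character (r k)⁻¹ =
      ZMod.stdAddChar (k * (2 * a)) + ZMod.stdAddChar (k * (-(2 * a))) + 2 := by
    intro k
    have h₁ : k * (2 * a) = k * a + k * a := by ring
    have h₂ : k * (-(2 * a)) = -(k * a) + -(k * a) := by ring
    have h₃ : ZMod.stdAddChar (k * a) * ZMod.stdAddChar (-(k * a)) = (1 : ℂ) := by
      rw [← AddChar.map_add_eq_mul, add_neg_cancel, AddChar.map_zero_eq_one]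
    rw [inv_r, character_inducedRep_r, character_inducedRep_r, neg_mul, neg_neg, h₁, h₂,
      AddChar.map_add_eq_mul, AddChar.map_add_eq_mul]
    linear_combination 2 * h₃
  simp only [hterm, character_inducedRep_sr, zero_mul, Finset.sum_const_zero, add_zero,
    Finset.sum_add_distrib, hsum _ ha, hsum _ (neg_ne_zero.mpr ha)]
  simp [mul_comm]

/-- The linear character extending the character `k ↦ exp (2πi a k / N)` of the rotation subgroup,
where `2 * a = 0`, with value `ε` at the reflection `sr 0`. -/
def linearChar {a : ZMod N} (ha : 2 * a = 0) {ε : ℂ} (hε : ε * ε = 1) : DihedralGroup N →* ℂ where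
  toFun
    | r k => ZMod.stdAddChar (k * a)
    | sr k => ε * ZMod.stdAddChar (k * a)
  map_one' := by simp [one_def, -r_zero]
  map_mul' := by
    have hneg : ∀ k l : ZMod N, (ZMod.stdAddChar ((k - l) * a) : ℂ) =
        ZMod.stdAddChar (k * a) * ZMod.stdAddChar (l * a) := by
      intro k l
      rw [← AddChar.map_add_eq_mul]
      congr 1
      linear_combination -l * ha
    rintro (k | k) (l | l)
    · simp [add_mul, AddChar.map_add_eq_mul]
    · simp only [r_mul_sr, hneg]
      ring
    · simp only [sr_mul_r, add_mul, AddChar.map_add_eq_mul]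
      ring
    · simp only [sr_mul_sr, hneg]
      linear_combination -ZMod.stdAddChar (k * a) * ZMod.stdAddChar (l * a) * hε

end DihedralGroup

section LinearCharacters

variable {G : Type} [Group G]

/-- The one-dimensional representation attached to a linear character. -/
def linearRep (φ : G →* ℂ) : FDRep ℂ G :=
  FDRep.of (V := ℂ)
    { toFun := fun g => φ g • LinearMap.id
      map_one' := by rw [map_one, one_smul]; rfl
      map_mul' := fun g g' => by ext; simp [mul_comm] }

theorem character_linearRep (φ : G →* ℂ) (g : G) : (linearRep φ).character g = φ g := by
  change LinearMap.trace ℂ ℂ (φ g • LinearMap.id) = φ g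
  simp

theorem simple_linearRep [Fintype G] (φ : G →* ℂ) : CategoryTheory.Simple (linearRep φ) := by
  rw [FDRep.simple_iff_char_is_norm_one]
  simp only [character_linearRep, ← map_mul, mul_inv_cancel, map_one]
  simp

theorem FDRep.sum_character_mul_eq_zero [Fintype G] {V W : FDRep ℂ G} (hV : CategoryTheory.Simple V)
    (hW : CategoryTheory.Simple W) (h : V.character ≠ W.character) :
    ∑ g, V.character g * W.character g⁻¹ = 0 := by
  have := invertibleOfNonzero (NeZero.ne (Nat.card G : ℂ))
  have horth := FDRep.char_orthonormal V W
  rw [if_neg (fun ⟨i⟩ => h (FDRep.char_iso i))] at horth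
  exact (mul_eq_zero.mp horth).resolve_left (inv_ne_zero (NeZero.ne _))

theorem FDRep.character_one_ne_zero [Finite G] {V : FDRep ℂ G} (hV : CategoryTheory.Simple V) :
    V.character 1 ≠ 0 := by
  have := Fintype.ofFinite G
  intro h
  rw [FDRep.char_one, Nat.cast_eq_zero] at h
  have hs : Subsingleton V := Module.finrank_zero_iff.mp h
  have hzero : ∀ g, V.character g = 0 := fun g => by
    rw [FDRep.character, Subsingleton.elim (V.ρ g) 0, map_zero]
  rw [FDRep.simple_iff_char_is_norm_one] at hV
  simp only [hzero, zero_mul, Finset.sum_const_zero] at hV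
  exact NeZero.ne (Nat.card G : ℂ) hV.symm

end LinearCharacters

namespace DihedralGroup

open CategoryTheory

variable {N : ℕ} [NeZero N]

theorem linearChar_add_linearChar {a : ZMod N} (ha : 2 * a = 0) (g : DihedralGroup N) :
    linearChar ha (one_mul 1) g + linearChar ha (by norm_num : (-1 : ℂ) * -1 = 1) g =
      (inducedRep a).character g := by
  rcases g with k | k
  · have hk : k * a = -(k * a) := by linear_combination k * ha
    rw [character_inducedRep_r, ← hk]
    rfl
  · rw [character_inducedRep_sr]
    simp [linearChar]

/-- An irreducible character of a dihedral group is linear or induced from the rotation subgroup. -/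
theorem character_eq_of_simple {V : FDRep ℂ (DihedralGroup N)} (hV : Simple V) :
    (∃ φ : DihedralGroup N →* ℂ, V.character = φ) ∨
      ∃ a : ZMod N, 2 * a ≠ 0 ∧ V.character = (inducedRep a).character := by
  by_contra! hcon
  obtain ⟨hlin, hind⟩ := hcon
  have horth : ∀ a : ZMod N, ∑ g, V.character g * (inducedRep a).character g⁻¹ = 0 := by
    intro a
    by_cases ha : 2 * a = 0
    · simp only [← linearChar_add_linearChar ha, mul_add, Finset.sum_add_distrib,
        ← character_linearRep]
      rw [FDRep.sum_character_mul_eq_zero hV (simple_linearRep _),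
        FDRep.sum_character_mul_eq_zero hV (simple_linearRep _), add_zero]
      all_goals
        rw [funext (character_linearRep _)]
        exact hlin _
    · exact FDRep.sum_character_mul_eq_zero hV (simple_inducedRep ha) (hind a ha)
  have hneg : ∀ k : ZMod N, V.character (r (-k)) = V.character (r k) := by
    intro k
    obtain ⟨c, hc⟩ := isConj_iff.mp (isConj_r_neg k)
    rw [← hc, FDRep.char_conj]
  have hfourier : ∀ a : ZMod N, ∑ k, V.character (r k) * ZMod.stdAddChar (k * a) = 0 := by
    intro a
    have h := horth a
    rw [sum_eq_sum_r_add_sum_sr] at h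
    simp only [inv_r, inv_sr, character_inducedRep_r, character_inducedRep_sr, mul_zero,
      Finset.sum_const_zero, add_zero, mul_add, Finset.sum_add_distrib, neg_mul, neg_neg] at h
    have hflip : ∑ k, V.character (r k) * ZMod.stdAddChar (-(k * a)) =
        ∑ k, V.character (r k) * ZMod.stdAddChar (k * a) := by
      refine Fintype.sum_equiv (Equiv.neg (ZMod N)) _ _ fun k => ?_
      rw [Equiv.neg_apply, hneg, neg_mul]
    rw [hflip] at h
    linear_combination h / 2
  have htotal : ∑ a : ZMod N, ∑ k : ZMod N, V.character (r k) * ZMod.stdAddChar (k * a) = 0 := by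
    simp only [hfourier, Finset.sum_const_zero]
  rw [Finset.sum_comm] at htotal
  have hinner : ∀ k : ZMod N, ∑ a : ZMod N, V.character (r k) * ZMod.stdAddChar (k * a) =
      if k = 0 then V.character 1 * N else 0 := by
    intro k
    simp only [← Finset.mul_sum, mul_comm k,
      AddChar.sum_mulShift k (ZMod.isPrimitive_stdAddChar N), ZMod.card]
    split_ifs with hk
    · rw [hk, r_zero]
    · rw [Nat.cast_zero, mul_zero]
  simp only [hinner, Finset.sum_ite_eq', Finset.mem_univ, if_true] at htotal
  exact (mul_ne_zero (FDRep.character_one_ne_zero hV) (NeZero.ne _)) htotal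

end DihedralGroup

section DihedralTwoGroup

open DihedralGroup

theorem etaH_eq_character {n : ℕ} (hn : 0 < n) (h : ℕ) :
    etaH n h = (inducedRep (h : ZMod (2 ^ n))).character := by
  obtain ⟨m, rfl⟩ := Nat.exists_eq_succ_of_ne_zero hn.ne'
  ext (k | k)
  · have hk : k * (h : ZMod (2 ^ (m + 1))) = ((k.val * h : ℤ) : ZMod (2 ^ (m + 1))) := by
      push_cast
      rw [ZMod.natCast_rightInverse k]
    have hk' : -(k * (h : ZMod (2 ^ (m + 1)))) = ((-(k.val * h) : ℤ) : ZMod (2 ^ (m + 1))) := by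
      rw [hk]
      push_cast
      rfl
    rw [character_inducedRep_r, hk', hk, ZMod.stdAddChar_coe, ZMod.stdAddChar_coe]
    simp only [etaH, Nat.succ_eq_add_one, Nat.add_sub_cancel]
    push_cast
    rw [Complex.two_cos]
    congr 2
    all_goals
      field_simp
      try ring
  · rw [character_inducedRep_sr]
    rfl

theorem two_mul_natCast_ne_zero {n h : ℕ} (hh : 0 < h) (hh' : h < 2 ^ (n - 1)) :
    2 * (h : ZMod (2 ^ n)) ≠ 0 := by
  have hn : n - 1 + 1 = n := by
    rcases n with _ | n
    · simp at hh'
      omega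
    · rfl
  intro h0
  have : ((2 * h : ℕ) : ZMod (2 ^ n)) = 0 := by exact_mod_cast h0
  rw [ZMod.natCast_eq_zero_iff, ← hn, pow_succ'] at this
  have := Nat.le_of_dvd (by omega) this
  omega

theorem pos_of_lt_two_pow_pred {n h : ℕ} (hh : 0 < h) (hh' : h < 2 ^ (n - 1)) : 0 < n := by
  rcases n with _ | n
  · simp at hh'
    omega
  · exact n.succ_pos

theorem isIrredChar_etaH {n h : ℕ} (hh : 0 < h) (hh' : h < 2 ^ (n - 1)) :
    IsIrredChar (etaH n h) :=
  ⟨_, simple_inducedRep (two_mul_natCast_ne_zero hh hh'),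
    etaH_eq_character (pos_of_lt_two_pow_pred hh hh') h⟩

theorem etaH_eq_of_isConj {n : ℕ} (hn : 0 < n) (h : ℕ) {g g' : DihedralGroup (2 ^ n)}
    (hg : IsConj g g') : etaH n h g' = etaH n h g := by
  obtain ⟨c, rfl⟩ := isConj_iff.mp hg
  rw [etaH_eq_character hn, FDRep.char_conj]

theorem IsIrredChar.exists_eq_etaH {n : ℕ} (hn : 0 < n) {χ : DihedralGroup (2 ^ n) → ℂ}
    (hχ : IsIrredChar χ) {g : DihedralGroup (2 ^ n)} (hg : χ g = 0) :
    ∃ h ∈ Finset.Ioo 0 (2 ^ (n - 1)), χ = etaH n h := by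
  obtain ⟨V, hV, rfl⟩ := hχ
  obtain ⟨φ, hφ⟩ | ⟨a, ha, hVa⟩ := character_eq_of_simple hV
  · have : φ g * φ g⁻¹ = 1 := by rw [← map_mul, mul_inv_cancel, map_one]
    rw [← hφ, hg, zero_mul] at this
    exact absurd this zero_ne_one
  · have hpow : 2 ^ n = 2 * 2 ^ (n - 1) := by
      rw [← pow_succ']
      congr 1
      omega
    have hcast : ((a.val : ℕ) : ZMod (2 ^ n)) = a := ZMod.natCast_rightInverse a
    have hlt := ZMod.val_lt a
    have h0 : a.val ≠ 0 := by
      intro h0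
      rw [← hcast, h0] at ha
      simp at ha
    have hhalf : a.val ≠ 2 ^ (n - 1) := by
      intro h1
      apply ha
      rw [← hcast, h1]
      have : ((2 * 2 ^ (n - 1) : ℕ) : ZMod (2 ^ n)) = 0 := by
        rw [← hpow, ZMod.natCast_self]
      exact_mod_cast this
    rcases lt_or_gt_of_ne hhalf with h1 | h1
    · refine ⟨a.val, Finset.mem_Ioo.mpr ⟨by omega, h1⟩, ?_⟩
      rw [etaH_eq_character hn, hcast, hVa]
    · refine ⟨2 ^ n - a.val, Finset.mem_Ioo.mpr ⟨by omega, by omega⟩, ?_⟩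
      rw [etaH_eq_character hn, Nat.cast_sub hlt.le, hcast, ZMod.natCast_self, zero_sub,
        character_inducedRep_neg, hVa]

theorem injOn_etaH {n : ℕ} (hn : 0 < n) :
    Set.InjOn (etaH n) (Finset.Ioo 0 (2 ^ (n - 1)) : Finset ℕ) := by
  intro h hh h' hh' heq
  rw [Finset.mem_coe, Finset.mem_Ioo] at hh hh'
  have hval : (1 : ZMod (2 ^ n)).val = 1 := by
    have : Fact (1 < 2 ^ n) := ⟨Nat.one_lt_two_pow hn.ne'⟩
    exact ZMod.val_one _
  have h1 := congrFun heq (r 1)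
  simp only [etaH, hval, Nat.cast_one, mul_one] at h1
  have h2 := Complex.ofReal_injective h1
  have hmem : ∀ j : ℕ, j < 2 ^ (n - 1) →
      Real.pi * j / 2 ^ (n - 1) ∈ Set.Icc 0 Real.pi := by
    intro j hj
    have hj' : (j : ℝ) ≤ 2 ^ (n - 1) := by exact_mod_cast hj.le
    refine ⟨by positivity, ?_⟩
    rw [div_le_iff₀ (by positivity)]
    exact mul_le_mul_of_nonneg_left hj' Real.pi_pos.le
  have h3 := Real.injOn_cos (hmem h hh.2) (hmem h' hh'.2) (by linarith)
  have hpi := Real.pi_ne_zero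
  field_simp at h3
  exact_mod_cast h3

/-- Pairs consisting of an irreducible character and a point at which it vanishes, in a sense
given by `P`, are counted by summing over the characters `η_h`. -/
theorem card_isIrredChar_pairs {n : ℕ} (hn : 0 < n) {β : Type*} [Finite β]
    (P : (DihedralGroup (2 ^ n) → ℂ) → β → Prop)
    (hP : ∀ χ b, P χ b → ∃ g, χ g = 0) :
    Nat.card {x : (DihedralGroup (2 ^ n) → ℂ) × β | IsIrredChar x.1 ∧ P x.1 x.2} =
      ∑ h ∈ Finset.Ioo 0 (2 ^ (n - 1)), Nat.card {b | P (etaH n h) b} := by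
  rw [← Finset.sum_coe_sort, ← Nat.card_sigma]
  symm
  refine Nat.card_congr (Equiv.ofBijective (fun x => ⟨(etaH n x.1, x.2), ?_, x.2.2⟩) ⟨?_, ?_⟩)
  · exact isIrredChar_etaH (Finset.mem_Ioo.mp x.1.2).1 (Finset.mem_Ioo.mp x.1.2).2
  · rintro ⟨⟨h, hh⟩, ⟨b, hb⟩⟩ ⟨⟨h', hh'⟩, ⟨b', hb'⟩⟩ heq
    simp only [Subtype.mk.injEq, Prod.mk.injEq] at heq
    obtain rfl := injOn_etaH hn hh hh' heq.1
    obtain rfl := heq.2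
    rfl
  · rintro ⟨⟨χ, b⟩, hχ, hb⟩
    obtain ⟨g, hg⟩ := hP _ _ hb
    obtain ⟨h, hh, rfl⟩ := IsIrredChar.exists_eq_etaH hn hχ hg
    exact ⟨⟨⟨h, hh⟩, ⟨b, hb⟩⟩, rfl⟩

/-- The zeros of `η_h` on the rotation subgroup, for `h = 2 ^ a * (2 * v + 1)`. -/
theorem etaH_r_eq_zero_iff (a b v : ℕ) (k : ZMod (2 ^ (a + b + 2))) :
    etaH (a + b + 2) (2 ^ a * (2 * v + 1)) (r k) = 0 ↔
      ∃ i < 2 ^ (a + 1), k.val = (2 * i + 1) * 2 ^ b := by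
  have hcos : etaH (a + b + 2) (2 ^ a * (2 * v + 1)) (r k) = 0 ↔
      ∃ m : ℤ, ((2 * v + 1) * k.val : ℤ) = (2 * m + 1) * 2 ^ b := by
    simp only [etaH, Complex.ofReal_eq_zero, mul_eq_zero, OfNat.ofNat_ne_zero, false_or,
      Real.cos_eq_zero_iff]
    refine exists_congr fun m => ?_
    have hpi := Real.pi_ne_zero
    generalize k.val = c
    rw [← @Int.cast_inj ℝ, show a + b + 2 - 1 = a + b + 1 from rfl, pow_succ, pow_add]
    push_cast
    field_simp
  rw [hcos]
  constructor
  · rintro ⟨m, hm⟩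
    have hdvd : 2 ^ b ∣ (2 * v + 1) * k.val := by
      have : (2 ^ b : ℤ) ∣ (2 * v + 1) * k.val := ⟨2 * m + 1, by rw [hm, mul_comm]⟩
      exact_mod_cast this
    have hcop : Nat.Coprime (2 ^ b) (2 * v + 1) := Nat.Coprime.pow_left _ (by simp)
    obtain ⟨c, hc⟩ := hcop.dvd_of_dvd_mul_left hdvd
    have hodd : Odd c := by
      rw [hc] at hm
      have h1 : ((2 * v + 1) * c : ℤ) = 2 * m + 1 := by
        apply mul_right_cancel₀ (pow_ne_zero b (two_ne_zero : (2 : ℤ) ≠ 0))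
        rw [← hm]
        push_cast
        ring
      have h2 : Odd ((2 * v + 1) * c : ℤ) := ⟨m, h1⟩
      exact_mod_cast (Int.odd_mul.mp h2).2
    obtain ⟨i, rfl⟩ := hodd
    refine ⟨i, ?_, by rw [hc, mul_comm]⟩
    have hlt := ZMod.val_lt k
    rw [hc, show a + b + 2 = b + (a + 2) by ring, pow_add] at hlt
    have := lt_of_mul_lt_mul_left hlt (Nat.zero_le _)
    rw [pow_succ] at this
    omega
  · rintro ⟨i, -, hi⟩
    refine ⟨2 * v * i + v + i, ?_⟩
    rw [hi]
    push_cast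
    ring

/-- The elements `t ^ ((2 i + 1) 2 ^ b)` of the dihedral group. -/
def oddRotation (n b i : ℕ) : DihedralGroup (2 ^ n) := r (((2 * i + 1) * 2 ^ b : ℕ) : ZMod (2 ^ n))

theorem odd_mul_lt {a b i : ℕ} (hi : i < 2 ^ (a + 1)) :
    (2 * i + 1) * 2 ^ b < 2 ^ (a + b + 2) := by
  rw [show a + b + 2 = (a + 1 + 1) + b by ring, pow_add, pow_succ 2 (a + 1)]
  exact Nat.mul_lt_mul_of_pos_right (by omega) (by positivity)

theorem etaH_eq_zero_iff (a b v : ℕ) (g : DihedralGroup (2 ^ (a + b + 2))) :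
    etaH (a + b + 2) (2 ^ a * (2 * v + 1)) g = 0 ↔
      (∃ i < 2 ^ (a + 1), oddRotation (a + b + 2) b i = g) ∨ ∃ k, sr k = g := by
  rcases g with k | k
  · rw [etaH_r_eq_zero_iff]
    simp only [oddRotation, r.injEq, reduceCtorEq, exists_false, or_false]
    refine exists_congr fun i => and_congr_right fun hi => ?_
    constructor
    · intro h
      rw [← h, ZMod.natCast_rightInverse k]
    · rintro rfl
      rw [ZMod.val_cast_of_lt (odd_mul_lt hi)]
  · exact iff_of_true rfl (Or.inr ⟨k, rfl⟩)

theorem injOn_oddRotation (a b : ℕ) :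
    Set.InjOn (oddRotation (a + b + 2) b) (Finset.range (2 ^ (a + 1)) : Finset ℕ) := by
  intro i hi j hj hij
  rw [Finset.mem_coe, Finset.mem_range] at hi hj
  have := congrArg ZMod.val (r.inj hij)
  rw [ZMod.val_cast_of_lt (odd_mul_lt hi), ZMod.val_cast_of_lt (odd_mul_lt hj)] at this
  have := Nat.eq_of_mul_eq_mul_right (by positivity) this
  omega

theorem neg_oddRotation {a b i : ℕ} (hi : i < 2 ^ (a + 1)) :
    -(((2 * i + 1) * 2 ^ b : ℕ) : ZMod (2 ^ (a + b + 2))) =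
      ((2 * (2 ^ (a + 1) - 1 - i) + 1) * 2 ^ b : ℕ) := by
  rw [neg_eq_iff_add_eq_zero, ← Nat.cast_add, ZMod.natCast_eq_zero_iff, ← add_mul]
  have : 2 * i + 1 + (2 * (2 ^ (a + 1) - 1 - i) + 1) = 2 ^ (a + 2) := by
    rw [pow_succ 2 (a + 1)]
    omega
  rw [this, ← pow_add]
  exact pow_dvd_pow 2 (by omega)

theorem isConj_oddRotation_iff {a b i j : ℕ} (hi : i < 2 ^ (a + 1)) (hj : j < 2 ^ (a + 1)) :
    IsConj (oddRotation (a + b + 2) b i) (oddRotation (a + b + 2) b j) ↔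
      j = i ∨ j = 2 ^ (a + 1) - 1 - i := by
  rw [oddRotation, oddRotation, isConj_r_iff, neg_oddRotation hi, ← r.injEq, ← r.injEq]
  have hi' : 2 ^ (a + 1) - 1 - i < 2 ^ (a + 1) := by omega
  exact or_congr
    ((injOn_oddRotation a b).eq_iff (Finset.mem_coe.mpr (Finset.mem_range.mpr hj))
      (Finset.mem_coe.mpr (Finset.mem_range.mpr hi)))
    ((injOn_oddRotation a b).eq_iff (Finset.mem_coe.mpr (Finset.mem_range.mpr hj))
      (Finset.mem_coe.mpr (Finset.mem_range.mpr hi')))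

theorem card_etaH_eq_zero_aux (a b v : ℕ) :
    Nat.card {g | etaH (a + b + 2) (2 ^ a * (2 * v + 1)) g = 0} =
      2 ^ (a + 1) + 2 ^ (a + b + 2) := by
  have hset : {g | etaH (a + b + 2) (2 ^ a * (2 * v + 1)) g = 0} =
      ((Finset.range (2 ^ (a + 1))).image (oddRotation (a + b + 2) b) ∪
        Finset.univ.image sr : Finset (DihedralGroup (2 ^ (a + b + 2)))) := by
    ext g
    simp [etaH_eq_zero_iff]
  rw [hset, Nat.card_coe_set_eq, Set.ncard_coe_finset, Finset.card_union_of_disjoint,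
    Finset.card_image_of_injOn (injOn_oddRotation a b), Finset.card_range,
    Finset.card_image_of_injective _ fun _ _ => sr.inj, Finset.card_univ, ZMod.card]
  rw [Finset.disjoint_left]
  simp [oddRotation]

theorem card_conjClasses_etaH_eq_zero_aux (a b v : ℕ) :
    Nat.card {C : ConjClasses (DihedralGroup (2 ^ (a + b + 2))) |
      ∀ g ∈ C.carrier, etaH (a + b + 2) (2 ^ a * (2 * v + 1)) g = 0} = 2 ^ a + 2 := by
  have hset : {C : ConjClasses (DihedralGroup (2 ^ (a + b + 2))) |
      ∀ g ∈ C.carrier, etaH (a + b + 2) (2 ^ a * (2 * v + 1)) g = 0} =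
      ((Finset.range (2 ^ a)).image (fun i => ConjClasses.mk (oddRotation (a + b + 2) b i)) ∪
        {ConjClasses.mk (sr 0), ConjClasses.mk (sr 1)} : Finset _) := by
    ext C
    obtain ⟨g, rfl⟩ := ConjClasses.exists_rep C
    have hclass : (∀ g' ∈ (ConjClasses.mk g).carrier,
        etaH (a + b + 2) (2 ^ a * (2 * v + 1)) g' = 0) ↔
        etaH (a + b + 2) (2 ^ a * (2 * v + 1)) g = 0 := by
      refine ⟨fun h => h g ConjClasses.mem_carrier_mk, fun h g' hg' => ?_⟩
      rw [ConjClasses.mem_carrier_iff_mk_eq, ConjClasses.mk_eq_mk_iff_isConj] at hg'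
      rw [← etaH_eq_of_isConj (by omega) _ hg', h]
    rw [Set.mem_ofPred_eq, hclass]
    simp only [Finset.coe_union, Finset.coe_image, Finset.coe_range, Finset.coe_insert,
      Finset.coe_singleton, Set.mem_union, Set.mem_image, Set.mem_Iio, Set.mem_insert_iff,
      Set.mem_singleton_iff, ConjClasses.mk_eq_mk_iff_isConj]
    constructor
    · rw [etaH_eq_zero_iff]
      rintro (⟨i, hi, rfl⟩ | ⟨k, rfl⟩)
      · left
        have hpow := pow_succ' 2 a
        by_cases hia : i < 2 ^ a
        · exact ⟨i, hia, IsConj.refl _⟩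
        · refine ⟨2 ^ (a + 1) - 1 - i, by omega, ?_⟩
          rw [isConj_oddRotation_iff (by omega) hi]
          omega
      · exact Or.inr (isConj_sr_zero_or_one k)
    · rintro (⟨i, hi, h⟩ | h | h)
      · rw [etaH_eq_of_isConj (by omega) _ h, etaH_eq_zero_iff]
        exact Or.inl ⟨i, hi.trans (Nat.pow_lt_pow_right one_lt_two a.lt_succ_self), rfl⟩
      · rw [etaH_eq_of_isConj (by omega) _ h.symm]
        rfl
      · rw [etaH_eq_of_isConj (by omega) _ h.symm]
        rfl
  rw [hset, Nat.card_coe_set_eq, Set.ncard_coe_finset, Finset.card_union_of_disjoint,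
    Finset.card_image_of_injOn, Finset.card_range, Finset.card_pair]
  · rw [Ne, ConjClasses.mk_eq_mk_iff_isConj]
    exact not_isConj_sr_zero_sr_one (dvd_pow_self 2 (by omega))
  · intro i hi j hj hij
    rw [Finset.mem_coe, Finset.mem_range] at hi hj
    have hpow := pow_succ' 2 a
    rw [ConjClasses.mk_eq_mk_iff_isConj, isConj_oddRotation_iff (by omega) (by omega)] at hij
    omega
  · rw [Finset.disjoint_left]
    simp only [Finset.mem_image, Finset.mem_insert, Finset.mem_singleton, forall_exists_index,
      and_imp, forall_apply_eq_imp_iff₂, ConjClasses.mk_eq_mk_iff_isConj]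
    exact fun i _ h => h.elim (not_isConj_r_sr _ _) (not_isConj_r_sr _ _)

theorem exists_eq_two_pow_mul_odd {n h : ℕ} (hh : 0 < h) (hh' : h < 2 ^ (n - 1)) :
    ∃ b v, n = padicValNat 2 h + b + 2 ∧ h = 2 ^ padicValNat 2 h * (2 * v + 1) := by
  have hdvd : 2 ^ padicValNat 2 h ∣ h := pow_padicValNat_dvd
  have hlt : padicValNat 2 h < n - 1 :=
    (Nat.pow_lt_pow_iff_right one_lt_two).mp ((Nat.le_of_dvd hh hdvd).trans_lt hh')
  obtain ⟨c, hc⟩ := hdvd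
  have hodd : Odd c := by
    rw [← Nat.not_even_iff_odd, even_iff_two_dvd]
    rintro ⟨d, rfl⟩
    apply pow_succ_padicValNat_not_dvd (p := 2) hh.ne'
    exact ⟨d, by rw [pow_succ, mul_assoc]; exact hc⟩
  obtain ⟨v, rfl⟩ := hodd
  exact ⟨n - padicValNat 2 h - 2, v, by omega, hc⟩

theorem card_etaH_eq_zero {n h : ℕ} (hh : 0 < h) (hh' : h < 2 ^ (n - 1)) :
    Nat.card {g | etaH n h g = 0} = 2 ^ (padicValNat 2 h + 1) + 2 ^ n := by
  obtain ⟨b, v, hn, hv⟩ := exists_eq_two_pow_mul_odd hh hh'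
  generalize padicValNat 2 h = a at hn hv ⊢
  subst hn hv
  exact card_etaH_eq_zero_aux a b v

theorem card_conjClasses_etaH_eq_zero {n h : ℕ} (hh : 0 < h) (hh' : h < 2 ^ (n - 1)) :
    Nat.card {C : ConjClasses (DihedralGroup (2 ^ n)) | ∀ g ∈ C.carrier, etaH n h g = 0} =
      2 ^ padicValNat 2 h + 2 := by
  obtain ⟨b, v, hn, hv⟩ := exists_eq_two_pow_mul_odd hh hh'
  generalize padicValNat 2 h = a at hn hv ⊢
  subst hn hv
  exact card_conjClasses_etaH_eq_zero_aux a b v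

end DihedralTwoGroup

theorem Finset.sum_range_two_mul_eq {M : Type*} [AddCommMonoid M] (f : ℕ → M) (k : ℕ) :
    ∑ i ∈ Finset.range (2 * k), f i =
      ∑ i ∈ Finset.range k, f (2 * i) + ∑ i ∈ Finset.range k, f (2 * i + 1) := by
  induction k with
  | zero => simp
  | succ k ih =>
    rw [mul_add_one, Finset.sum_range_succ, Finset.sum_range_succ, ih, Finset.sum_range_succ,
      Finset.sum_range_succ]
    abel

theorem sum_Ioo_two_pow_padicValNat (m : ℕ) :
    2 * ∑ h ∈ Finset.Ioo 0 (2 ^ m), 2 ^ padicValNat 2 h = m * 2 ^ m := by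
  have hrange : ∀ m, ∑ h ∈ Finset.range (2 ^ m), 2 ^ padicValNat 2 h =
      1 + ∑ h ∈ Finset.Ioo 0 (2 ^ m), 2 ^ padicValNat 2 h := by
    intro m
    rw [Finset.range_eq_Ico, ← Finset.Ioo_insert_left (by positivity), Finset.sum_insert (by simp)]
    simp
  induction m with
  | zero => rfl
  | succ m ih =>
    have h₁ := hrange m
    have h₂ := hrange (m + 1)
    have hodd : ∀ i, padicValNat 2 (2 * i + 1) = 0 := fun i =>
      padicValNat.eq_zero_of_not_dvd (by omega)
    have heven : ∀ i ∈ Finset.Ioo 0 (2 ^ m),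
        2 ^ padicValNat 2 (2 * i) = 2 * 2 ^ padicValNat 2 i := by
      intro i hi
      have hi0 : i ≠ 0 := (Finset.mem_Ioo.mp hi).1.ne'
      rw [padicValNat.mul two_ne_zero hi0, padicValNat.self one_lt_two, pow_add, pow_one]
    rw [pow_succ', Finset.sum_range_two_mul_eq] at h₂
    simp only [hodd, pow_zero, Finset.sum_const, Finset.card_range, smul_eq_mul, mul_one] at h₂
    rw [Finset.range_eq_Ico, ← Finset.Ioo_insert_left (by positivity), Finset.sum_insert (by simp),
      Finset.sum_congr rfl heven, ← Finset.mul_sum, ih] at h₂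
    rw [mul_zero, padicValNat_zero_right, pow_zero] at h₂
    rw [pow_succ']
    linarith

/-- Zeros of the character `η_h` of the dihedral group of order `2^(n+1)`, where
`0 < h < 2^(n-1)` and `ν₂` is the 2-adic valuation:
(1) `η_h` vanishes at exactly `2^(ν₂(h)+1) + 2ⁿ` elements;
(2) `η_h` vanishes on exactly `2^(ν₂(h)) + 2` conjugacy classes;
(3) the number of pairs `(χ, g) ∈ Irr(G_n) × G_n` with `χ g = 0` is
    `2^(n-1)·(n-1) + 2^(2n-1) - 2ⁿ`;
(4) the number of zeros in the character table of `G_n` is `2^(n-2)·(n-1) + 2ⁿ - 2`. -/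
theorem dihedral_vanishing (n h : ℕ) (hn : 0 < n) (hh : 0 < h) (hh2 : h < 2 ^ (n - 1)) :
    Nat.card {g : DihedralGroup (2 ^ n) | etaH n h g = 0} =
      2 ^ (padicValNat 2 h + 1) + 2 ^ n ∧
    Nat.card {C : ConjClasses (DihedralGroup (2 ^ n)) | ∀ g ∈ C.carrier, etaH n h g = 0} =
      2 ^ padicValNat 2 h + 2 ∧
    Nat.card {x : (DihedralGroup (2 ^ n) → ℂ) × DihedralGroup (2 ^ n) |
        IsIrredChar x.1 ∧ x.1 x.2 = 0} =
      2 ^ (n - 1) * (n - 1) + 2 ^ (2 * n - 1) - 2 ^ n ∧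
    Nat.card {x : (DihedralGroup (2 ^ n) → ℂ) × ConjClasses (DihedralGroup (2 ^ n)) |
        IsIrredChar x.1 ∧ ∀ g ∈ x.2.carrier, x.1 g = 0} =
      2 ^ (n - 2) * (n - 1) + 2 ^ n - 2 := by
  have hzero := fun h (hh : h ∈ Finset.Ioo 0 (2 ^ (n - 1))) =>
    card_etaH_eq_zero (Finset.mem_Ioo.mp hh).1 (Finset.mem_Ioo.mp hh).2
  have hclass := fun h (hh : h ∈ Finset.Ioo 0 (2 ^ (n - 1))) =>
    card_conjClasses_etaH_eq_zero (Finset.mem_Ioo.mp hh).1 (Finset.mem_Ioo.mp hh).2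
  have hmem := Finset.mem_Ioo.mpr ⟨hh, hh2⟩
  have hsum := sum_Ioo_two_pow_padicValNat (n - 1)
  obtain ⟨m, rfl⟩ : ∃ m, n = m + 2 := by
    refine ⟨n - 2, ?_⟩
    have : n ≠ 1 := by
      rintro rfl
      simp at hh2
      omega
    omega
  have hcard : (Finset.Ioo 0 (2 ^ (m + 1))).card = 2 ^ (m + 1) - 1 := by
    rw [Nat.card_Ioo, Nat.sub_zero]
  have hpos : 1 ≤ 2 ^ m := Nat.one_le_two_pow
  refine ⟨hzero h hmem, hclass h hmem, ?_, ?_⟩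
  · rw [card_isIrredChar_pairs hn (fun χ g => χ g = 0) fun χ g hg => ⟨g, hg⟩,
      Finset.sum_congr rfl hzero]
    simp only [pow_succ _ (padicValNat _ _), Finset.sum_add_distrib, ← Finset.sum_mul,
      Finset.sum_const, smul_eq_mul]
    simp only [show m + 2 - 1 = m + 1 from rfl] at hsum ⊢
    rw [hcard, mul_comm _ 2, hsum, Nat.sub_mul, one_mul,
      show 2 * (m + 2) - 1 = m + 1 + (m + 2) by omega, pow_add 2 (m + 1) (m + 2),
      Nat.add_sub_assoc, mul_comm (m + 1)]
    exact Nat.le_mul_of_pos_left _ (by positivity)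
  · rw [card_isIrredChar_pairs hn
      (fun χ (C : ConjClasses (DihedralGroup (2 ^ (m + 2)))) => ∀ g ∈ C.carrier, χ g = 0),
      Finset.sum_congr rfl hclass]
    · simp only [Finset.sum_add_distrib, Finset.sum_const, smul_eq_mul]
      simp only [Nat.add_sub_cancel, show m + 2 - 1 = m + 1 from rfl] at hsum ⊢
      rw [hcard]
      have h₁ : 2 ^ (m + 1) = 2 * 2 ^ m := pow_succ' 2 m
      have h₂ : 2 ^ (m + 2) = 2 * (2 * 2 ^ m) := by rw [pow_succ', h₁]
      have h₃ : (m + 1) * 2 ^ (m + 1) = 2 * (2 ^ m * (m + 1)) := by rw [h₁]; ring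
      omega
    · intro χ C hC
      obtain ⟨g, rfl⟩ := ConjClasses.exists_rep C
      exact ⟨g, hC g ConjClasses.mem_carrier_mk⟩
end
end
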